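/- Fix i ∈ {1,2}. Let C ≥ 1, α ∈ (0,9), δ₀ ∈ (0,1), and let F ⊆ B^{𝔯ᵢ}_1(0) be a finite set satisfying μ_F(B̄(x,δ)) ≤ C·δ^α for every x ∈ 𝔯ᵢ and every δ ≥ δ₀, where B̄(x,δ) is the closed δ-ball for ‖·‖. Then for every ε ∈ (0, 10^{−10}α) there exist constants L_ε, C_ε ≥ 1 depending only on ε and an absolute constant E ≥ 1 such that for every ℓ ≥ L_ε and every δ ∈ [e^{2ℓ}δ₀, e^{−2ℓ}] there is a subset J_{ℓ,δ} ⊆ 𝖡₁ᵁ with m_U(𝖡₁ᵁ ∖ J_{ℓ,δ}) ≤ C_ε·e^{−εℓ} such that: for every u ∈ J_{ℓ,δ} there is F_{ℓ,δ,u} ⊆ F with μ_F(F ∖ F_{ℓ,δ,u}) ≤ C_ε·e^{−εℓ}, and for every w ∈ F_{ℓ,δ,u}, μ_F({w' ∈ F_{ℓ,δ,u} : ‖(a_ℓ u).w' − (a_ℓ u).w‖ ≤ δ}) ≤ C_ε·C·e^{−φ(α)ℓ}·δ^{α − E√ε}. -/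

import Mathlib

open Matrix MeasureTheory
open scoped Classical

noncomputable section

abbrev M4 : Type := Matrix (Fin 4) (Fin 4) ℝ

/-- trace inner product ⟨X,Y⟩ = tr(XYᵀ) -/
def tinner (X Y : M4) : ℝ := (X * Yᵀ).trace

/-- sup norm: maximum absolute value of entries -/
def mnorm (X : M4) : ℝ := ⨆ p : Fin 4 × Fin 4, |X p.1 p.2|

/-- Euclidean (Frobenius) norm -/
def mnorm2 (X : M4) : ℝ := Real.sqrt (tinner X X)

/-- Gram matrices Q₁ (i=0) and Q₂ (i=1) -/
def Qmat (i : Fin 2) : M4 :=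
  if i = 0 then !![0,0,0,-(1/2); 0,0,1/2,0; 0,1/2,0,0; -(1/2),0,0,0]
  else !![0,0,0,-1; 0,1,0,0; 0,0,1,0; -1,0,0,0]

/-- 𝔰𝔩₄(ℝ) as a submodule of 4×4 matrices -/
def sl4 : Submodule ℝ M4 where
  carrier := {X | X.trace = 0}
  add_mem' := by
    intro a b ha hb
    simp only [Set.mem_setOf_eq] at *
    simp [Matrix.trace_add, ha, hb]
  zero_mem' := by simp
  smul_mem' := by
    intro c x hx
    simp only [Set.mem_setOf_eq] at *
    simp [Matrix.trace_smul, hx]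

/-- the involution σᵢ(X) = −QᵢXᵀQᵢ⁻¹ as a linear map -/
def sigmaMap (i : Fin 2) : M4 →ₗ[ℝ] M4 where
  toFun X := -(Qmat i * Xᵀ * (Qmat i)⁻¹)
  map_add' X Y := by
    simp [Matrix.transpose_add, add_mul, mul_add]; abel
  map_smul' c X := by
    simp [Matrix.transpose_smul, Matrix.smul_mul, Matrix.mul_smul]

/-- 𝔯ᵢ = {X ∈ 𝔰𝔩₄ : σᵢ(X) = −X} -/
def rSpace (i : Fin 2) : Submodule ℝ M4 :=
  sl4 ⊓ LinearMap.ker (sigmaMap i + (LinearMap.id : M4 →ₗ[ℝ] M4))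

/-- 𝔥ᵢ = {X ∈ 𝔰𝔩₄ : σᵢ(X) = X} -/
def hSpace (i : Fin 2) : Submodule ℝ M4 :=
  sl4 ⊓ LinearMap.ker (sigmaMap i - (LinearMap.id : M4 →ₗ[ℝ] M4))

/-- 𝐚 = diag(1,0,0,−1) -/
def aWt : M4 := Matrix.diagonal ![1,0,0,-1]

/-- ad(𝐚) = [𝐚, ·] -/
def adA : M4 →ₗ[ℝ] M4 where
  toFun X := aWt * X - X * aWt
  map_add' X Y := by simp [mul_add, add_mul]; abel
  map_smul' c X := by simp [Matrix.mul_smul, Matrix.smul_mul, smul_sub]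

/-- weight space (𝔯ᵢ)_λ -/
def wSpace (i : Fin 2) (lam : ℤ) : Submodule ℝ M4 :=
  rSpace i ⊓ LinearMap.ker (adA - (lam : ℝ) • (LinearMap.id : M4 →ₗ[ℝ] M4))

/-- 𝔯ᵢ^{(λ)} = ⊕_{μ ≥ λ} (𝔯ᵢ)_μ -/
def rUp (i : Fin 2) (lam : ℤ) : Submodule ℝ M4 :=
  ⨆ (μ : ℤ) (_ : lam ≤ μ), wSpace i μ

/-- a_t = diag(e^t, 1, 1, e^{−t}) -/
def aMat (t : ℝ) : M4 := Matrix.diagonal ![Real.exp t, 1, 1, Real.exp (-t)]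

/-- the unipotent elements u^{(i)}_{r,s} -/
def uMat (i : Fin 2) (r s : ℝ) : M4 :=
  if i = 0 then !![1, r, s, s*r; 0,1,0,s; 0,0,1,r; 0,0,0,1]
  else !![1, r, s, (r^2+s^2)/2; 0,1,0,r; 0,0,1,s; 0,0,0,1]

/-- adjoint action g.X = gXg⁻¹ -/
def Adm (g X : M4) : M4 := g * X * g⁻¹

/-- adjoint action as a linear map -/
def AdLin (g : M4) : M4 →ₗ[ℝ] M4 where
  toFun X := g * X * g⁻¹
  map_add' X Y := by simp [mul_add, add_mul]
  map_smul' c X := by simp [Matrix.mul_smul, Matrix.smul_mul]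

/-- the parameter square [−1,1]² -/
def uSq : Set (ℝ × ℝ) := Set.Icc (-1 : ℝ) 1 ×ˢ Set.Icc (-1 : ℝ) 1

/-- m_U = (1/4)·(Lebesgue measure in the parameters) -/
def mU (S : Set (ℝ × ℝ)) : ENNReal := volume S / 4

/-- modified α-energy 𝒢^{(α)}_{F,δ}(w) -/
def energy (α δ : ℝ) (F : Finset M4) (w : M4) : ℝ :=
  ∑ w' ∈ F.erase w, (max (mnorm (w' - w)) δ) ^ (-α)

/-- φ(α) = (1/36)·min{(8/9)α, 1 − α/9} -/
def phiFn (α : ℝ) : ℝ := (1/36) * min ((8/9)*α) (1 - α/9)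

/-- δ-covering number by closed balls for the sup norm -/
def covNum (δ : ℝ) (A : Set M4) : ℕ :=
  sInf {n : ℕ | ∃ t : Finset M4, t.card = n ∧ A ⊆ ⋃ c ∈ t, {y : M4 | mnorm (y - c) ≤ δ}}

/-- orthonormal basis of a subspace, as a tuple -/
def IsONB {n : Type} [Fintype n] (v : n → M4) (V : Submodule ℝ M4) : Prop :=
  (∀ k, v k ∈ V) ∧ (∀ k l, tinner (v k) (v l) = if k = l then 1 else 0) ∧
    Submodule.span ℝ (Set.range v) = V

/-- Gram matrix of a tuple of vectors -/
def gram {n : Type} [Fintype n] (v : n → M4) : Matrix n n ℝ :=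
  Matrix.of fun a b => tinner (v a) (v b)

/-- weights λ₁,…,λ₅ = −2,…,2 -/
def lamOf : Fin 5 → ℤ := ![-2,-1,0,1,2]

/-- dimension differences 𝖽 = (1,2,3,2,1) -/
def dOf : Fin 5 → ℝ := ![1,2,3,2,1]

/-- Index of the atom of 𝒟^𝐫_ρ containing x, for an adapted orthonormal basis b with weights wt. -/
def atomIdx (b : Fin 9 → M4) (wt : Fin 9 → ℤ) (r : Fin 5 → ℝ) (ρ : ℝ) (x : M4) :
    Fin 5 → Fin 9 → ℤ :=
  fun j k => if lamOf j ≤ wt k then ⌊ tinner x (b k) / ρ ^ (r j) ⌋ else 0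

end

/-! ### Entropy of partitions of a finite set -/

/-- Number of points of `A` in the same fibre of `f` as `w`. -/
noncomputable def fibCard {Ω β : Type*} (A : Finset Ω) (f : Ω → β) (w : Ω) : ℝ :=
  ((A.filter (fun w' => f w' = f w)).card : ℝ)

/-- Shannon entropy of `f` for the uniform measure on `A`. -/
noncomputable def ent {Ω β : Type*} (A : Finset Ω) (f : Ω → β) : ℝ :=
  Real.log A.card - (∑ w ∈ A, Real.log (fibCard A f w)) / A.card

section entropy

variable {Ω β γ ζ : Type*} {A : Finset Ω}

lemma fibCard_pos (f : Ω → β) {w : Ω} (hw : w ∈ A) : 0 < fibCard A f w := by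
  unfold fibCard
  exact_mod_cast Finset.card_pos.2 ⟨w, by simp [hw]⟩

lemma fibCard_congr (f : Ω → β) {w w' : Ω} (h : f w = f w') :
    fibCard A f w = fibCard A f w' := by
  simp [fibCard, h]

lemma sum_inv_fibCard (f : Ω → β) (w₀ : Ω) (hw₀ : w₀ ∈ A) :
    ∑ w ∈ A.filter (fun w => f w = f w₀), (fibCard A f w)⁻¹ = 1 := by
  have h : ∀ w ∈ A.filter (fun w => f w = f w₀), (fibCard A f w)⁻¹ = (fibCard A f w₀)⁻¹ := by
    intro w hw
    rw [fibCard_congr f (Finset.mem_filter.1 hw).2]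
  rw [Finset.sum_congr rfl h, Finset.sum_const, nsmul_eq_mul]
  exact mul_inv_cancel₀ (fibCard_pos f hw₀).ne'

lemma log_le_log_add_div_sub_one {x y : ℝ} (hx : 0 < x) (hy : 0 < y) :
    Real.log x ≤ Real.log y + x / y - 1 := by
  have h := Real.log_le_sub_one_of_pos (div_pos hx hy)
  rw [Real.log_div hx.ne' hy.ne'] at h
  linarith

lemma ent_le_of_sum_log {f : Ω → β} {g : Ω → γ} {c : ℝ} (hA : A.Nonempty)
    (h : ∑ w ∈ A, Real.log (fibCard A f w)
      ≤ ∑ w ∈ A, Real.log (fibCard A g w) + A.card * c) :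
    ent A g ≤ ent A f + c := by
  have hc : (0 : ℝ) < A.card := by exact_mod_cast hA.card_pos
  have : (∑ w ∈ A, Real.log (fibCard A f w)) / A.card
      ≤ (∑ w ∈ A, Real.log (fibCard A g w)) / A.card + c := by
    rw [div_add' _ _ _ hc.ne', div_le_div_iff_of_pos_right hc]
    linarith
  unfold ent
  linarith

/-- If every fibre of `f` meets at most `K` fibres of `z`, then adjoining `z` to `f` raises the
entropy by at most `log K`. -/
lemma ent_pair_le {f : Ω → β} {z : Ω → ζ} {K : ℝ} (hA : A.Nonempty) (hK : 0 < K)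
    (h : ∀ w ∈ A, (((A.filter (fun w' => f w' = f w)).image z).card : ℝ) ≤ K) :
    ent A (fun w => (f w, z w)) ≤ ent A f + Real.log K := by
  apply ent_le_of_sum_log hA
  set p : Ω → β × ζ := fun w => (f w, z w) with hp
  have key : ∑ w ∈ A, fibCard A f w / fibCard A p w ≤ K * A.card := by
    have h1 : ∀ w₁ ∈ A, ∑ w ∈ A.filter (fun w => f w = f w₁), (fibCard A p w)⁻¹ ≤ K := by
      intro w₁ hw₁
      refine le_trans (le_of_eq ?_) (h w₁ hw₁)
      rw [← Finset.sum_fiberwise_of_maps_to (s := A.filter (fun w => f w = f w₁))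
        (t := (A.filter (fun w' => f w' = f w₁)).image z) (g := z)
        (fun w hw => Finset.mem_image_of_mem z hw)]
      rw [Finset.sum_congr rfl (g := fun _ => (1 : ℝ))]
      · simp
      · intro b hb
        obtain ⟨w₂, hw₂, rfl⟩ := Finset.mem_image.1 hb
        have hw₂' := Finset.mem_filter.1 hw₂
        rw [← sum_inv_fibCard p w₂ hw₂'.1]
        apply Finset.sum_congr _ (fun _ _ => rfl)
        ext w
        simp only [Finset.mem_filter, hp, Prod.mk.injEq, hw₂'.2]
        tauto
    have h2 : ∑ w ∈ A, fibCard A f w / fibCard A p w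
        = ∑ w₁ ∈ A, ∑ w ∈ A.filter (fun w => f w = f w₁), (fibCard A p w)⁻¹ := by
      simp_rw [Finset.sum_filter]
      rw [Finset.sum_comm]
      apply Finset.sum_congr rfl
      intro w hw
      rw [← Finset.sum_filter, Finset.sum_const, nsmul_eq_mul, div_eq_mul_inv]
      congr 1
      unfold fibCard
      congr 2
      ext; simp [eq_comm]
    rw [h2]
    calc _ ≤ ∑ w₁ ∈ A, K := Finset.sum_le_sum h1
      _ = K * A.card := by simp [mul_comm]
  have h3 : ∀ w ∈ A, Real.log (fibCard A f w) ≤ Real.log (fibCard A p w)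
      + (Real.log K - 1 + (fibCard A f w / fibCard A p w) / K) := by
    intro w hw
    have hf := fibCard_pos f hw
    have hpp := fibCard_pos p hw
    have := log_le_log_add_div_sub_one (div_pos hf hpp) hK
    rw [Real.log_div hf.ne' hpp.ne'] at this
    linarith
  refine (Finset.sum_le_sum h3).trans ?_
  rw [Finset.sum_add_distrib, Finset.sum_add_distrib, ← Finset.sum_div, Finset.sum_const,
    nsmul_eq_mul]
  have : (∑ w ∈ A, fibCard A f w / fibCard A p w) / K ≤ A.card := by
    rw [div_le_iff₀ hK]; linarith
  linarith

lemma ent_le_of_determines {f : Ω → β} {g : Ω → γ} (hA : A.Nonempty)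
    (h : ∀ w ∈ A, ∀ w' ∈ A, f w = f w' → g w = g w') : ent A g ≤ ent A f := by
  have := ent_le_of_sum_log (A := A) (f := f) (g := g) (c := 0) hA ?_
  · linarith
  · rw [mul_zero, add_zero]
    apply Finset.sum_le_sum
    intro w hw
    apply Real.log_le_log (fibCard_pos f hw)
    unfold fibCard
    exact_mod_cast Finset.card_le_card fun w' hw' => by
      rw [Finset.mem_filter] at hw' ⊢
      exact ⟨hw'.1, h _ hw'.1 _ hw hw'.2⟩

lemma ent_le_add_log {f : Ω → β} {z : Ω → ζ} {K : ℝ} (hA : A.Nonempty) (hK : 0 < K)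
    (h : ∀ w ∈ A, (((A.filter (fun w' => f w' = f w)).image z).card : ℝ) ≤ K) :
    ent A z ≤ ent A f + Real.log K :=
  (ent_le_of_determines hA (by intro _ _ _ _ h; exact (Prod.mk.inj h).2)).trans
    (ent_pair_le hA hK h)

/-- Strong subadditivity of entropy. -/
lemma ent_submodular (hA : A.Nonempty) (f : Ω → β) (g : Ω → γ) (z : Ω → ζ) :
    ent A (fun w => (f w, g w, z w)) + ent A z
      ≤ ent A (fun w => (f w, z w)) + ent A (fun w => (g w, z w)) := by
  set p : Ω → β × ζ := fun w => (f w, z w) with hp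
  set q : Ω → γ × ζ := fun w => (g w, z w) with hq
  set t : Ω → β × γ × ζ := fun w => (f w, g w, z w) with ht
  have hc : (0 : ℝ) < A.card := by exact_mod_cast hA.card_pos
  have key : ∑ w ∈ A, (fibCard A p w * fibCard A q w) / (fibCard A t w * fibCard A z w)
      ≤ A.card := by
    have e1 : ∀ w ∈ A, (fibCard A p w * fibCard A q w) / (fibCard A t w * fibCard A z w)
        = ∑ w₁ ∈ A, ∑ w₂ ∈ A, if p w₁ = p w ∧ q w₂ = q w then
            (fibCard A t w)⁻¹ * (fibCard A z w)⁻¹ else 0 := by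
      intro w hw
      have e0 : ∀ w₁ ∈ A, (∑ w₂ ∈ A, if p w₁ = p w ∧ q w₂ = q w then
            (fibCard A t w)⁻¹ * (fibCard A z w)⁻¹ else 0) = if p w₁ = p w then
            fibCard A q w * ((fibCard A t w)⁻¹ * (fibCard A z w)⁻¹) else 0 := by
        intro w₁ _
        split_ifs with hpw
        · simp only [hpw, true_and]
          rw [← Finset.sum_filter, Finset.sum_const, nsmul_eq_mul]
          unfold fibCard
          congr!
        · simp [hpw]
      rw [Finset.sum_congr rfl e0, ← Finset.sum_filter, Finset.sum_const, nsmul_eq_mul,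
        div_eq_mul_inv, mul_inv, mul_assoc]
      unfold fibCard
      congr!
    rw [Finset.sum_congr rfl e1, Finset.sum_comm]
    have e2 : ∀ w₁ ∈ A, (∑ w ∈ A, ∑ w₂ ∈ A, if p w₁ = p w ∧ q w₂ = q w then
        (fibCard A t w)⁻¹ * (fibCard A z w)⁻¹ else 0) ≤ 1 := by
      intro w₁ hw₁
      rw [Finset.sum_comm]
      calc _ ≤ ∑ w₂ ∈ A, if z w₂ = z w₁ then (fibCard A z w₁)⁻¹ else 0 := by
            apply Finset.sum_le_sum
            intro w₂ hw₂
            by_cases hex : ∃ w₀ ∈ A, p w₁ = p w₀ ∧ q w₂ = q w₀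
            · obtain ⟨w₀, hw₀, h1, h2⟩ := hex
              have hz1 : z w₁ = z w₀ := (Prod.mk.inj h1).2
              have hz2 : z w₂ = z w₀ := (Prod.mk.inj h2).2
              rw [if_pos (hz2.trans hz1.symm)]
              rw [← Finset.sum_filter]
              have e3 : A.filter (fun w => p w₁ = p w ∧ q w₂ = q w)
                  = A.filter (fun w => t w = t w₀) := by
                ext w
                simp only [Finset.mem_filter, hp, hq, ht, Prod.mk.injEq] at *
                constructor
                · rintro ⟨a, ⟨b, c⟩, d, e⟩
                  exact ⟨a, by rw [← b, h1.1], by rw [← d, h2.1], by rw [← c, hz1]⟩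
                · rintro ⟨a, b, c, d⟩
                  refine ⟨a, ⟨by rw [b, h1.1], by rw [d, hz1]⟩, by rw [c, h2.1], by rw [d, hz2]⟩
              rw [e3]
              have e4 : ∀ w ∈ A.filter (fun w => t w = t w₀),
                  (fibCard A t w)⁻¹ * (fibCard A z w)⁻¹
                    = (fibCard A t w)⁻¹ * (fibCard A z w₁)⁻¹ := by
                intro w hw
                have := (Finset.mem_filter.1 hw).2
                simp only [ht, Prod.mk.injEq] at this
                rw [fibCard_congr z (this.2.2.trans hz1.symm)]
              rw [Finset.sum_congr rfl e4, ← Finset.sum_mul]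
              have e5 := sum_inv_fibCard t w₀ hw₀
              refine le_of_eq ?_
              convert one_mul _
              convert e5
            · rw [Finset.sum_eq_zero]
              · split_ifs
                · exact inv_nonneg.2 (fibCard_pos z hw₁).le
                · exact le_rfl
              · intro w hw
                rw [if_neg]
                exact fun hh => hex ⟨w, hw, hh⟩
        _ = 1 := by
            rw [← Finset.sum_filter, Finset.sum_const, nsmul_eq_mul]
            exact mul_inv_cancel₀ (fibCard_pos z hw₁).ne'
    calc _ ≤ ∑ w₁ ∈ A, (1 : ℝ) := by
          rw [← Finset.sum_comm]
          rw [Finset.sum_comm]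
          exact Finset.sum_le_sum e2
      _ = A.card := by simp
  have h3 : ∀ w ∈ A, Real.log (fibCard A p w) + Real.log (fibCard A q w)
      ≤ Real.log (fibCard A t w) + Real.log (fibCard A z w)
        + ((fibCard A p w * fibCard A q w) / (fibCard A t w * fibCard A z w) - 1) := by
    intro w hw
    have a := fibCard_pos p hw
    have b := fibCard_pos q hw
    have c := fibCard_pos t hw
    have d := fibCard_pos z hw
    have := log_le_log_add_div_sub_one (mul_pos a b) (mul_pos c d)
    rw [Real.log_mul a.ne' b.ne', Real.log_mul c.ne' d.ne'] at this
    linarith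
  have h4 := Finset.sum_le_sum h3
  simp only [Finset.sum_add_distrib, Finset.sum_sub_distrib, Finset.sum_const, nsmul_eq_mul,
    mul_one] at h4
  have h5 : (∑ w ∈ A, Real.log (fibCard A p w)) / A.card
      + (∑ w ∈ A, Real.log (fibCard A q w)) / A.card
      ≤ (∑ w ∈ A, Real.log (fibCard A t w)) / A.card
      + (∑ w ∈ A, Real.log (fibCard A z w)) / A.card := by
    rw [← add_div, ← add_div, div_le_div_iff_of_pos_right hc]
    linarith
  unfold ent
  linarith

/-- Approximate submodularity: `z` is nearly a function of `f` and nearly a function of `g`. -/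
lemma ent_submodular_approx (hA : A.Nonempty) {f : Ω → β} {g : Ω → γ} {z : Ω → ζ} {K K' : ℝ}
    (hK : 0 < K) (hK' : 0 < K')
    (h : ∀ w ∈ A, (((A.filter (fun w' => f w' = f w)).image z).card : ℝ) ≤ K)
    (h' : ∀ w ∈ A, (((A.filter (fun w' => g w' = g w)).image z).card : ℝ) ≤ K') :
    ent A (fun w => (f w, g w)) + ent A z
      ≤ ent A f + ent A g + Real.log K + Real.log K' := by
  have h1 := ent_submodular hA f g z
  have h2 := ent_pair_le hA hK h
  have h3 := ent_pair_le hA hK' h'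
  have h4 : ent A (fun w => (f w, g w)) ≤ ent A (fun w => (f w, g w, z w)) :=
    ent_le_of_determines hA (by
      intro _ _ _ _ h
      simp only [Prod.mk.injEq] at h ⊢
      exact ⟨h.1, h.2.1⟩)
  linarith

/-- Entropy is at least `-log b` when every fibre has proportion at most `b`. -/
lemma neg_log_le_ent (hA : A.Nonempty) {f : Ω → β} {b : ℝ}
    (h : ∀ w ∈ A, fibCard A f w ≤ b * A.card) : -Real.log b ≤ ent A f := by
  have hc : (0 : ℝ) < A.card := by exact_mod_cast hA.card_pos
  obtain ⟨w₀, hw₀⟩ := hA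
  have hb : 0 < b := by
    have := (fibCard_pos f hw₀).trans_le (h w₀ hw₀)
    exact (pos_iff_pos_of_mul_pos this).2 hc
  have : (∑ w ∈ A, Real.log (fibCard A f w)) / A.card ≤ Real.log b + Real.log A.card := by
    rw [div_le_iff₀ hc, ← Real.log_mul hb.ne' hc.ne']
    calc _ ≤ ∑ w ∈ A, Real.log (b * A.card) :=
          Finset.sum_le_sum fun w hw => Real.log_le_log (fibCard_pos f hw) (h w hw)
      _ = _ := by simp [mul_comm]
  unfold ent
  linarith

lemma ent_const (hA : A.Nonempty) (f : Ω → β) (h : ∀ w w', f w = f w') : ent A f = 0 := by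
  have hc : (0 : ℝ) < A.card := by exact_mod_cast hA.card_pos
  have : ∀ w ∈ A, Real.log (fibCard A f w) = Real.log A.card := by
    intro w _
    unfold fibCard
    rw [Finset.filter_true_of_mem (fun w' _ => h w' w)]
  unfold ent
  rw [Finset.sum_congr rfl this, Finset.sum_const, nsmul_eq_mul, mul_div_cancel_left₀ _ hc.ne',
    sub_self]

lemma ent_le_log_image (hA : A.Nonempty) {f : Ω → β} {K : ℝ} (hK : 0 < K)
    (h : ((A.image f).card : ℝ) ≤ K) : ent A f ≤ Real.log K := by
  have h1 := ent_le_add_log (A := A) (f := fun _ => ()) (z := f) hA hK (by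
    intro w _; simpa using h)
  rw [ent_const hA (fun _ => ()) (fun _ _ => rfl)] at h1
  linarith

end entropy

/-! ### Entropy of discretised linear observables -/

/-- Ambient coordinate space. -/
abbrev V9 : Type := Fin 9 → ℝ

/-- The vector of integer parts of the functionals in `X`. -/
noncomputable def obs {Ω : Type*} (ξ : Ω → V9) (X : Finset V9) (w : Ω) : V9 → ℤ :=
  fun v => if v ∈ X then ⌊v ⬝ᵥ ξ w⌋ else 0

/-- The functionals in `Z` are bounded by `M` wherever those in `X` are bounded by `1`. -/
def Controls (X Z : Finset V9) (M : ℝ) : Prop :=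
  ∀ v : V9, (∀ x ∈ X, |x ⬝ᵥ v| ≤ 1) → ∀ z ∈ Z, |z ⬝ᵥ v| ≤ M

section observables

variable {Ω : Type*} {A : Finset Ω} {ξ : Ω → V9}

lemma Controls.mono {X X' Z Z' : Finset V9} {M M' : ℝ} (h : Controls X Z M) (hX : X ⊆ X')
    (hZ : Z' ⊆ Z) (hM : M ≤ M') : Controls X' Z' M' :=
  fun v hv z hz => (h v (fun x hx => hv x (hX hx)) z (hZ hz)).trans hM

lemma controls_of_subset {X Z : Finset V9} (h : Z ⊆ X) {M : ℝ} (hM : 1 ≤ M) : Controls X Z M :=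
  fun _ hv z hz => (hv z (h hz)).trans hM

lemma Controls.union {X Z Z' : Finset V9} {M : ℝ} (h : Controls X Z M) (h' : Controls X Z' M) :
    Controls X (Z ∪ Z') M := by
  intro v hv z hz
  rcases Finset.mem_union.1 hz with hz | hz
  · exact h v hv z hz
  · exact h' v hv z hz

lemma Controls.trans {X Y Z : Finset V9} {M M' : ℝ} (hM : 0 < M) (h : Controls X Y M)
    (h' : Controls Y Z M') : Controls X Z (M * M') := by
  intro v hv z hz
  have := h' (M⁻¹ • v) (fun y hy => by
    rw [dotProduct_smul, smul_eq_mul, abs_mul, abs_of_pos (inv_pos.2 hM)]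
    calc M⁻¹ * |y ⬝ᵥ v| ≤ M⁻¹ * M := by
          gcongr; exact h v hv y hy
      _ = 1 := inv_mul_cancel₀ hM.ne') z hz
  rw [dotProduct_smul, smul_eq_mul, abs_mul, abs_of_pos (inv_pos.2 hM)] at this
  calc |z ⬝ᵥ v| = M * (M⁻¹ * |z ⬝ᵥ v|) := by field_simp
    _ ≤ M * M' := by gcongr

lemma controls_smul {X Z : Finset V9} {M ρ : ℝ} (h : Controls X Z M) :
    Controls (X.image (fun v => ρ • v)) (Z.image (fun v => ρ • v)) M := by
  intro v hv z hz
  obtain ⟨z', hz', rfl⟩ := Finset.mem_image.1 hz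
  have := h (ρ • v) (fun x hx => by
    have := hv _ (Finset.mem_image_of_mem _ hx)
    rwa [smul_dotProduct, ← dotProduct_smul] at this) z' hz'
  rwa [smul_dotProduct, ← dotProduct_smul]

lemma card_image_obs_le {S : Finset Ω} {Z : Finset V9} {w : Ω} {M : ℝ} (hM : 0 ≤ M)
    (h : ∀ w' ∈ S, ∀ z ∈ Z, |z ⬝ᵥ (ξ w' - ξ w)| ≤ M) :
    ((S.image (obs ξ Z)).card : ℝ) ≤ (2 * M + 3) ^ Z.card := by
  set n : ℤ := ⌊M⌋ + 1 with hn
  have hsub : (S.image (obs ξ Z)).image (fun φ : V9 → ℤ => fun z : Z => φ z)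
      ⊆ Fintype.piFinset (fun z : Z => Finset.Icc (⌊(z : V9) ⬝ᵥ ξ w⌋ - n) (⌊(z : V9) ⬝ᵥ ξ w⌋ + n)) := by
    intro φ hφ
    simp only [Finset.mem_image] at hφ
    obtain ⟨_, ⟨w', hw', rfl⟩, rfl⟩ := hφ
    rw [Fintype.mem_piFinset]
    rintro ⟨z, hz⟩
    simp only [obs, hz, if_true, Finset.mem_Icc]
    have h1 := abs_le.1 (h w' hw' z hz)
    rw [dotProduct_sub] at h1
    have a1 := Int.floor_le (z ⬝ᵥ ξ w)
    have a2 := Int.lt_floor_add_one (z ⬝ᵥ ξ w)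
    have a3 := Int.floor_le (z ⬝ᵥ ξ w')
    have a4 := Int.lt_floor_add_one (z ⬝ᵥ ξ w')
    have a5 := Int.lt_floor_add_one M
    constructor
    · have : ((⌊z ⬝ᵥ ξ w⌋ - ⌊z ⬝ᵥ ξ w'⌋ : ℤ) : ℝ) < ((⌊M⌋ + 2 : ℤ) : ℝ) := by
        push_cast; linarith
      have := Int.cast_lt.1 this
      omega
    · have : ((⌊z ⬝ᵥ ξ w'⌋ - ⌊z ⬝ᵥ ξ w⌋ : ℤ) : ℝ) < ((⌊M⌋ + 2 : ℤ) : ℝ) := by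
        push_cast; linarith
      have := Int.cast_lt.1 this
      omega
  have hinj : Set.InjOn (fun φ : V9 → ℤ => fun z : Z => φ z) (S.image (obs ξ Z)) := by
    intro φ hφ φ' hφ' heq
    simp only [Finset.coe_image, Set.mem_image, Finset.mem_coe] at hφ hφ'
    obtain ⟨w₁, _, rfl⟩ := hφ
    obtain ⟨w₂, _, rfl⟩ := hφ'
    funext v
    by_cases hv : v ∈ Z
    · exact congrFun heq ⟨v, hv⟩
    · simp [obs, hv]
  have hcard := Finset.card_le_card hsub
  rw [Finset.card_image_of_injOn hinj, Fintype.card_piFinset] at hcard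
  have hn0 : 0 ≤ ⌊M⌋ := Int.floor_nonneg.2 hM
  calc ((S.image (obs ξ Z)).card : ℝ) ≤ ((∏ z : Z, (Finset.Icc (⌊(z : V9) ⬝ᵥ ξ w⌋ - n)
        (⌊(z : V9) ⬝ᵥ ξ w⌋ + n)).card : ℕ) : ℝ) := by exact_mod_cast hcard
    _ = ∏ z : Z, ((Finset.Icc (⌊(z : V9) ⬝ᵥ ξ w⌋ - n)
        (⌊(z : V9) ⬝ᵥ ξ w⌋ + n)).card : ℝ) := by push_cast; rfl
    _ ≤ ∏ z : Z, (2 * M + 3) := by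
        apply Finset.prod_le_prod
        · intros; positivity
        · intro z _
          rw [Int.card_Icc]
          have : (⌊(z : V9) ⬝ᵥ ξ w⌋ + n + 1 - (⌊(z : V9) ⬝ᵥ ξ w⌋ - n)) = 2 * ⌊M⌋ + 3 := by
            rw [hn]; ring
          rw [this]
          have h2 : (((2 * ⌊M⌋ + 3).toNat : ℤ) : ℝ) = 2 * (⌊M⌋ : ℝ) + 3 := by
            rw [Int.toNat_of_nonneg (by omega)]; push_cast; ring
          have h3 : (((2 * ⌊M⌋ + 3).toNat : ℕ) : ℝ) = 2 * (⌊M⌋ : ℝ) + 3 := by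
            rw [← h2]; norm_cast
          rw [h3]
          linarith [Int.floor_le M]
    _ = (2 * M + 3) ^ Z.card := by simp

lemma obs_eq_imp {X : Finset V9} {w w' : Ω} (h : obs ξ X w' = obs ξ X w) :
    ∀ x ∈ X, |x ⬝ᵥ (ξ w' - ξ w)| ≤ 1 := by
  intro x hx
  have h1 := congrFun h x
  simp only [obs, hx, if_true] at h1
  rw [dotProduct_sub]
  exact (Int.abs_sub_lt_one_of_floor_eq_floor h1).le

/-- Entropy of the discretisation of a finite set of functionals. -/
noncomputable def obsEnt (A : Finset Ω) (ξ : Ω → V9) (X : Finset V9) : ℝ := ent A (obs ξ X)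

lemma card_fibre_image_le {X Z : Finset V9} {M : ℝ} (hM : 1 ≤ M) (h : Controls X Z M) (w : Ω) :
    (((A.filter (fun w' => obs ξ X w' = obs ξ X w)).image (obs ξ Z)).card : ℝ)
      ≤ (2 * M + 3) ^ Z.card :=
  card_image_obs_le (w := w) (by linarith) fun w' hw' z hz =>
    h _ (obs_eq_imp (Finset.mem_filter.1 hw').2) z hz

lemma obsEnt_le (hA : A.Nonempty) {X Z : Finset V9} {M : ℝ} (hM : 1 ≤ M)
    (h : Controls X Z M) :
    obsEnt A ξ Z ≤ obsEnt A ξ X + Z.card * Real.log (2 * M + 3) := by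
  have := ent_le_add_log (A := A) (f := obs ξ X) (z := obs ξ Z) hA
    (K := (2 * M + 3) ^ Z.card) (by positivity) (fun w _ => card_fibre_image_le hM h w)
  rwa [Real.log_pow] at this

lemma obsEnt_submodular (hA : A.Nonempty) {X Y Z : Finset V9} {M : ℝ} (hM : 1 ≤ M)
    (h : Controls X Z M) (h' : Controls Y Z M) :
    obsEnt A ξ (X ∪ Y) + obsEnt A ξ Z
      ≤ obsEnt A ξ X + obsEnt A ξ Y + 2 * (Z.card * Real.log (2 * M + 3)) := by
  have h1 := ent_submodular_approx (A := A) (f := obs ξ X) (g := obs ξ Y) (z := obs ξ Z) hA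
    (K := (2 * M + 3) ^ Z.card) (K' := (2 * M + 3) ^ Z.card) (by positivity) (by positivity)
    (fun w _ => card_fibre_image_le hM h w) (fun w _ => card_fibre_image_le hM h' w)
  rw [Real.log_pow] at h1
  have h2 : ent A (obs ξ (X ∪ Y)) ≤ ent A (fun w => (obs ξ X w, obs ξ Y w)) := by
    apply ent_le_of_determines hA
    intro w _ w' _ hh
    simp only [Prod.mk.injEq] at hh
    funext v
    have e1 := congrFun hh.1 v
    have e2 := congrFun hh.2 v
    by_cases hx : v ∈ X
    · simpa [obs, hx] using e1
    · by_cases hy : v ∈ Y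
      · simpa [obs, hy] using e2
      · simp [obs, hx, hy]
  unfold obsEnt
  linarith

end observables

/-- Abstract form of the approximate monotonicity and submodularity of `obsEnt`. -/
structure SubLike (Φ : Finset V9 → ℝ) (c : ℝ) : Prop where
  le : ∀ {X Z : Finset V9} {M : ℝ}, 1 ≤ M → Z.card ≤ 45 → Controls X Z M →
    Φ Z ≤ Φ X + c * Real.log (2 * M + 3)
  sub : ∀ {X Y Z : Finset V9} {M : ℝ}, 1 ≤ M → Z.card ≤ 45 → Controls X Z M → Controls Y Z M →
    Φ (X ∪ Y) + Φ Z ≤ Φ X + Φ Y + c * Real.log (2 * M + 3)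

/-- The standard coordinate functionals. -/
noncomputable def stdSet : Finset V9 := Finset.univ.image (fun k : Fin 9 => Pi.single k (1 : ℝ))

lemma card_stdSet_le : stdSet.card ≤ 9 := Finset.card_image_le.trans (by simp)

/-- Rescaling of a set of functionals. -/
noncomputable def scaled (ρ : ℝ) (X : Finset V9) : Finset V9 := X.image (fun v => ρ⁻¹ • v)

lemma scaled_union (ρ : ℝ) (X Y : Finset V9) : scaled ρ (X ∪ Y) = scaled ρ X ∪ scaled ρ Y :=
  Finset.image_union _ _

lemma card_scaled_le (ρ : ℝ) (X : Finset V9) : (scaled ρ X).card ≤ X.card := Finset.card_image_le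

lemma subLike_obsEnt {Ω : Type*} {A : Finset Ω} (ξ : Ω → V9) (hA : A.Nonempty) :
    SubLike (obsEnt A ξ) 90 where
  le := by
    intro X Z M hM hZ h
    have := obsEnt_le (ξ := ξ) hA hM h
    have hl : 0 ≤ Real.log (2 * M + 3) := Real.log_nonneg (by linarith)
    have hZ' : (Z.card : ℝ) ≤ 45 := by exact_mod_cast hZ
    nlinarith
  sub := by
    intro X Y Z M hM hZ h h'
    have := obsEnt_submodular (ξ := ξ) hA hM h h'
    have hl : 0 ≤ Real.log (2 * M + 3) := Real.log_nonneg (by linarith)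
    have hZ' : (Z.card : ℝ) ≤ 45 := by exact_mod_cast hZ
    nlinarith

/-- Observables at scale `ρ` relative to the isotropic partition at scale `ρ'`. -/
noncomputable def relSet (ρ ρ' : ℝ) (X : Finset V9) : Finset V9 := scaled ρ X ∪ scaled ρ' stdSet

lemma controls_relSet {X Z : Finset V9} {M ρ ρ' : ℝ} (hM : 1 ≤ M)
    (h : Controls X Z M) : Controls (relSet ρ ρ' X) (relSet ρ ρ' Z) M :=
  ((controls_smul h).mono Finset.subset_union_left subset_rfl le_rfl).union
    (controls_of_subset Finset.subset_union_right hM)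

lemma card_relSet_le {ρ ρ' : ℝ} {Z : Finset V9} (hZ : Z.card ≤ 36) : (relSet ρ ρ' Z).card ≤ 45 :=
  (Finset.card_union_le _ _).trans (add_le_add ((card_scaled_le _ _).trans hZ)
    ((card_scaled_le _ _).trans card_stdSet_le))

/-- Relative version of `SubLike`, with a smaller bound on the number of functionals. -/
structure RelLike (Φ : Finset V9 → ℝ) (c : ℝ) : Prop where
  le : ∀ {X Z : Finset V9} {M : ℝ}, 1 ≤ M → Z.card ≤ 36 → Controls X Z M →
    Φ Z ≤ Φ X + c * Real.log (2 * M + 3)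
  sub : ∀ {X Y Z : Finset V9} {M : ℝ}, 1 ≤ M → Z.card ≤ 36 → Controls X Z M → Controls Y Z M →
    Φ (X ∪ Y) + Φ Z ≤ Φ X + Φ Y + c * Real.log (2 * M + 3)

lemma SubLike.relLike {h : Finset V9 → ℝ} {c : ℝ} (hh : SubLike h c) (ρ ρ' : ℝ) :
    RelLike (fun X => h (relSet ρ ρ' X)) c where
  le := fun hM hZ hc => hh.le hM (card_relSet_le hZ) (controls_relSet hM hc)
  sub := by
    intro X Y Z M hM hZ hc hc'
    have := hh.sub hM (card_relSet_le (ρ := ρ) (ρ' := ρ') hZ) (controls_relSet hM hc)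
      (controls_relSet hM hc')
    have e : relSet ρ ρ' X ∪ relSet ρ ρ' Y = relSet ρ ρ' (X ∪ Y) := by
      simp only [relSet, scaled_union]
      ext; simp only [Finset.mem_union]; tauto
    rwa [e] at this

/-- Cost of one comparison. -/
noncomputable def lossUnit (M : ℝ) : ℝ := Real.log (2 * M + 3)

lemma lossUnit_nonneg {M : ℝ} (hM : 1 ≤ M) : 0 ≤ lossUnit M := Real.log_nonneg (by linarith)


section relLike

variable {Φ : Finset V9 → ℝ} {c : ℝ}

lemma RelLike.sum_lines (hΦ : RelLike Φ c) {ι : Type*} (T : Finset ι) (Y : ι → Finset V9)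
    (hT : T.Nonempty) (hc : 0 ≤ c) :
    Φ (T.biUnion Y) + (T.card - 1 : ℝ) * Φ ∅ ≤ ∑ t ∈ T, Φ (Y t) + T.card * (c * lossUnit 1) := by
  induction hT using Finset.Nonempty.cons_induction with
  | singleton t =>
    have := mul_nonneg hc (lossUnit_nonneg le_rfl)
    simp; linarith
  | cons t T ht hT ih =>
    rw [Finset.cons_eq_insert, Finset.biUnion_insert, Finset.sum_insert ht,
      Finset.card_insert_of_notMem ht]
    have := hΦ.sub (X := Y t) (Y := T.biUnion Y) (Z := ∅) (M := 1) le_rfl (by simp)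
      (fun _ _ z hz => by simp at hz) (fun _ _ z hz => by simp at hz)
    unfold lossUnit at *
    push_cast
    linarith

/-- Nine lines spanning the whole space. -/
lemma RelLike.nine_lines (hΦ : RelLike Φ c) (hc : 0 ≤ c) {Y : Fin 9 → Finset V9} {M : ℝ}
    (hM : 1 ≤ M) (h : Controls (Finset.univ.biUnion Y) stdSet M) :
    Φ stdSet + 8 * Φ ∅ ≤ ∑ t, Φ (Y t) + 10 * (c * lossUnit M) := by
  have h1 := hΦ.sum_lines Finset.univ Y Finset.univ_nonempty hc
  have h2 := hΦ.le hM (card_stdSet_le.trans (by norm_num)) h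
  have h3 : lossUnit 1 ≤ lossUnit M := Real.log_le_log (by norm_num) (by linarith)
  have h4 := mul_le_mul_of_nonneg_left h3 hc
  simp only [Finset.card_univ, Fintype.card_fin] at h1
  unfold lossUnit at *
  push_cast at h1
  linarith

/-- A family of nine hyperplanes `X t`, and a basis `g` such that `X t` contains every `g s` with
`s ≠ t`, in a quantitative sense. -/
structure HanData (X : Fin 9 → Finset V9) (g : Fin 9 → V9) (M : ℝ) : Prop where
  ctrl : ∀ t s, s ≠ t → Controls (X t) {g s} M
  full : ∀ t, Controls (X t ∪ {g t}) stdSet M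

lemma RelLike.han (hΦ : RelLike Φ c) (hc : 0 ≤ c) {X : Fin 9 → Finset V9} {g : Fin 9 → V9}
    {M : ℝ} (hM : 1 ≤ M) (h : HanData X g M) (T : Finset (Fin 9)) (hT : T.Nonempty) :
    (T.card - 1 : ℝ) * Φ stdSet + Φ (Tᶜ.image g)
      ≤ ∑ t ∈ T, Φ (X t) + T.card * (2 * (c * lossUnit M)) := by
  have hl := mul_nonneg hc (lossUnit_nonneg hM)
  have hg : ∀ (S : Finset (Fin 9)) (t : Fin 9), t ∉ S → Controls (X t) (S.image g) M := by
    intro S t ht v hv z hz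
    obtain ⟨s, hs, rfl⟩ := Finset.mem_image.1 hz
    exact h.ctrl t s (fun hst => ht (hst ▸ hs)) v hv _ (Finset.mem_singleton_self _)
  have hcard : ∀ S : Finset (Fin 9), (S.image g).card ≤ 36 := fun S =>
    Finset.card_image_le.trans ((Finset.card_le_univ S).trans (by simp))
  induction hT using Finset.Nonempty.cons_induction with
  | singleton t =>
    have := hΦ.le hM (hcard _) (hg {t}ᶜ t (by simp))
    unfold lossUnit at *
    simp; linarith
  | cons t T ht hT ih =>
    rw [Finset.cons_eq_insert, Finset.sum_insert ht, Finset.card_insert_of_notMem ht]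
    have h1 := hΦ.sub (X := X t) (Y := Tᶜ.image g) (Z := (insert t T)ᶜ.image g) hM (hcard _)
      (hg _ t (by simp)) (controls_of_subset (Finset.image_subset_image (by
        intro a; simp only [Finset.mem_compl, Finset.mem_insert]; tauto)) hM)
    have h2 := hΦ.le (Z := stdSet) hM (card_stdSet_le.trans (by norm_num))
      ((h.full t).mono (X' := X t ∪ Tᶜ.image g) (Finset.union_subset_union subset_rfl (by
        rw [Finset.singleton_subset_iff]
        exact Finset.mem_image_of_mem _ (by simpa using ht))) subset_rfl le_rfl)
    unfold lossUnit at *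
    push_cast
    linarith

lemma RelLike.han_univ (hΦ : RelLike Φ c) (hc : 0 ≤ c) {X : Fin 9 → Finset V9} {g : Fin 9 → V9}
    {M : ℝ} (hM : 1 ≤ M) (h : HanData X g M) :
    8 * Φ stdSet + Φ ∅ ≤ ∑ t, Φ (X t) + 18 * (c * lossUnit M) := by
  have := hΦ.han hc hM h Finset.univ Finset.univ_nonempty
  simp only [Finset.card_univ, Fintype.card_fin, Finset.compl_univ, Finset.image_empty] at this
  push_cast at this
  linarith

lemma RelLike.han_gain (hΦ : RelLike Φ c) (hc : 0 ≤ c) {X : Fin 9 → Finset V9} {g : Fin 9 → V9}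
    {M : ℝ} (hM : 1 ≤ M) (h : HanData X g M) :
    63 * Φ stdSet + ∑ s, Φ {g s} ≤ 8 * ∑ t, Φ (X t) + 144 * (c * lossUnit M) := by
  have h1 : ∀ s : Fin 9, 7 * Φ stdSet + Φ {g s}
      ≤ (∑ t, Φ (X t) - Φ (X s)) + 16 * (c * lossUnit M) := by
    intro s
    have := hΦ.han hc hM h {s}ᶜ ⟨s + 1, by revert s; decide⟩
    rw [compl_compl, Finset.image_singleton, Finset.card_compl, Finset.card_singleton,
      Fintype.card_fin] at this
    have h2 : ∑ t ∈ ({s}ᶜ : Finset (Fin 9)), Φ (X t) = ∑ t, Φ (X t) - Φ (X s) := by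
      rw [eq_sub_iff_add_eq, ← Finset.sum_compl_add_sum {s}, Finset.sum_singleton]
    rw [h2] at this
    push_cast at this
    linarith
  have h2 := Finset.sum_le_sum (fun s (_ : s ∈ Finset.univ) => h1 s)
  simp only [Finset.sum_add_distrib, Finset.sum_sub_distrib, Finset.sum_const, Finset.card_univ,
    Fintype.card_fin, nsmul_eq_mul] at h2
  push_cast at h2
  linarith

end relLike

/-! ### Flags at twenty-seven points -/

section flags

variable {Φ : Finset V9 → ℝ} {c : ℝ}

lemma RelLike.three_three (hΦ : RelLike Φ c) {M : ℝ} (hM : 1 ≤ M)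
    {L₁ L₂ L₃ : Finset V9} {p : V9} (h : Controls (L₁ ∪ L₂) {p} M) (h' : Controls L₃ {p} M) :
    Φ (L₁ ∪ L₂ ∪ L₃) + Φ {p} + Φ ∅ ≤ Φ L₁ + Φ L₂ + Φ L₃ + 2 * (c * lossUnit M) := by
  have h1 := hΦ.sub (X := L₁) (Y := L₂) (Z := ∅) hM (by simp)
    (fun _ _ z hz => by simp at hz) (fun _ _ z hz => by simp at hz)
  have h2 := hΦ.sub hM (by simp) h h'
  unfold lossUnit
  linarith

lemma RelLike.three_six (hΦ : RelLike Φ c) {M : ℝ} (hM : 1 ≤ M)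
    {Y₁ Y₂ Y₃ Z : Finset V9} {q : V9} (hZ : Z.card ≤ 36) (h₁ : Controls Y₁ Z M)
    (h₂ : Controls Y₂ Z M) (h : Controls (Y₁ ∪ Y₂) stdSet M) (hq : Controls Z {q} M)
    (h₃ : Controls Y₃ {q} M) :
    Φ stdSet + Φ (Z ∪ Y₃) + Φ {q} ≤ Φ Y₁ + Φ Y₂ + Φ Y₃ + 3 * (c * lossUnit M) := by
  have h1 := hΦ.sub hM hZ h₁ h₂
  have h2 := hΦ.sub hM (by simp) hq h₃
  have h3 := hΦ.le hM (card_stdSet_le.trans (by norm_num)) h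
  unfold lossUnit
  linarith

/-- First `n` functionals of a list of nine. -/
noncomputable def flag (c : Fin 9 → V9) (n : ℕ) : Finset V9 :=
  (Finset.univ.filter (fun k : Fin 9 => k.val < n)).image c

lemma card_flag_le (c : Fin 9 → V9) (n : ℕ) : (flag c n).card ≤ 9 :=
  Finset.card_image_le.trans ((Finset.card_filter_le _ _).trans (by simp))

/-- Quantitative general position of the flags at a `9 × 3` array of points. -/
structure GenPos (c : Fin 9 → Fin 3 → Fin 9 → V9) (g : Fin 3 → Fin 9 → V9) (M : ℝ) : Prop where
  lines : ∀ j, Controls (Finset.univ.biUnion fun t => flag (c t j) 1) stdSet M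
  three : ∃ p : Fin 9 → V9, ∃ g' : Fin 9 → V9,
    (∀ t, Controls (flag (c t 0) 3 ∪ flag (c t 1) 3) {p t} M) ∧
    (∀ t, Controls (flag (c t 2) 3) {p t} M) ∧
    Controls (Finset.univ.biUnion fun t => {p t}) stdSet M ∧
    HanData (fun t => flag (c t 0) 3 ∪ flag (c t 1) 3 ∪ flag (c t 2) 3) g' M
  six : ∃ q : Fin 9 → V9, ∃ g' : Fin 9 → V9, ∃ Z : Fin 9 → Finset V9,
    (∀ t, (Z t).card ≤ 36) ∧
    (∀ t, Controls (flag (c t 0) 6) (Z t) M) ∧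
    (∀ t, Controls (flag (c t 1) 6) (Z t) M) ∧
    (∀ t, Controls (flag (c t 0) 6 ∪ flag (c t 1) 6) stdSet M) ∧
    (∀ t, Controls (Z t) {q t} M) ∧
    (∀ t, Controls (flag (c t 2) 6) {q t} M) ∧
    Controls (Finset.univ.biUnion fun t => {q t}) stdSet M ∧
    HanData (fun t => Z t ∪ flag (c t 2) 6) g' M
  eight : ∀ j, HanData (fun t => flag (c t j) 8) (g j) M
  bdd : ∀ t j, Controls stdSet (flag (c t j) 9) M
  full : ∀ t j, Controls (flag (c t j) 9) stdSet M

variable {cv : Fin 9 → Fin 3 → Fin 9 → V9} {g : Fin 3 → Fin 9 → V9} {M : ℝ}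

lemma RelLike.sum_flag_one (hΦ : RelLike Φ c) (hc : 0 ≤ c) (hM : 1 ≤ M) (h : GenPos cv g M) :
    3 * (Φ stdSet + 8 * Φ ∅) ≤ ∑ t, ∑ j, Φ (flag (cv t j) 1) + 30 * (c * lossUnit M) := by
  have h1 := Finset.sum_le_sum fun j (_ : j ∈ (Finset.univ : Finset (Fin 3))) =>
    hΦ.nine_lines hc hM (h.lines j)
  rw [Finset.sum_add_distrib (f := fun j => ∑ t, Φ (flag (cv t j) 1)), Finset.sum_comm] at h1
  simp only [Finset.sum_const, Finset.card_univ, Fintype.card_fin, nsmul_eq_mul] at h1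
  push_cast at h1
  linarith

lemma RelLike.sum_flag_three (hΦ : RelLike Φ c) (hc : 0 ≤ c) (hM : 1 ≤ M) (h : GenPos cv g M) :
    9 * Φ stdSet + 18 * Φ ∅ ≤ ∑ t, ∑ j, Φ (flag (cv t j) 3) + 46 * (c * lossUnit M) := by
  obtain ⟨p, g', h1, h2, h3, h4⟩ := h.three
  have e1 := hΦ.nine_lines hc hM h3
  have e2 := hΦ.han_univ hc hM h4
  have e3 := Finset.sum_le_sum fun t (_ : t ∈ (Finset.univ : Finset (Fin 9))) =>
    hΦ.three_three hM (h1 t) (h2 t)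
  simp only [Finset.sum_add_distrib, Finset.sum_const, Finset.card_univ, Fintype.card_fin,
    nsmul_eq_mul] at e3
  simp only [Fin.sum_univ_three, Finset.sum_add_distrib]
  push_cast at e3
  linarith

lemma RelLike.sum_flag_six (hΦ : RelLike Φ c) (hc : 0 ≤ c) (hM : 1 ≤ M) (h : GenPos cv g M) :
    18 * Φ stdSet + 9 * Φ ∅ ≤ ∑ t, ∑ j, Φ (flag (cv t j) 6) + 55 * (c * lossUnit M) := by
  obtain ⟨q, g', Z, hZ, h1, h2, h3, h4, h5, h6, h7⟩ := h.six
  have e1 := hΦ.nine_lines hc hM h6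
  have e2 := hΦ.han_univ hc hM h7
  have e3 := Finset.sum_le_sum fun t (_ : t ∈ (Finset.univ : Finset (Fin 9))) =>
    hΦ.three_six hM (hZ t) (h1 t) (h2 t) (h3 t) (h4 t) (h5 t)
  simp only [Finset.sum_add_distrib, Finset.sum_const, Finset.card_univ, Fintype.card_fin,
    nsmul_eq_mul] at e3
  simp only [Fin.sum_univ_three, Finset.sum_add_distrib]
  push_cast at e3
  linarith

lemma RelLike.sum_flag_eight (hΦ : RelLike Φ c) (hc : 0 ≤ c) (hM : 1 ≤ M) (h : GenPos cv g M) :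
    189 * Φ stdSet + ∑ j, ∑ s, Φ {g j s}
      ≤ 8 * ∑ t, ∑ j, Φ (flag (cv t j) 8) + 432 * (c * lossUnit M) := by
  have h1 := Finset.sum_le_sum fun j (_ : j ∈ (Finset.univ : Finset (Fin 3))) =>
    hΦ.han_gain hc hM (h.eight j)
  rw [Finset.sum_add_distrib, Finset.sum_add_distrib,
    ← Finset.mul_sum (f := fun j => ∑ t, Φ (flag (cv t j) 8)),
    Finset.sum_comm (f := fun j t => Φ (flag (cv t j) 8))] at h1
  simp only [Finset.sum_const, Finset.card_univ, Fintype.card_fin, nsmul_eq_mul] at h1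
  push_cast at h1
  linarith

end flags

/-! ### The chain of scales -/

section chain

variable {h : Finset V9 → ℝ} {c : ℝ}

lemma SubLike.chain_step (hh : SubLike h c) {M : ℝ} (hM : 1 ≤ M) {Z R Q : Finset V9}
    (hR : R.card ≤ 45) (hZQ : (Z ∪ Q).card ≤ 45) (hQ : Controls Q R M) :
    h R + h (Z ∪ Q) ≤ h (Z ∪ R) + h Q + 2 * (c * lossUnit M) := by
  have h1 := hh.sub (X := Z ∪ R) (Y := Q) hM hR
    (controls_of_subset Finset.subset_union_right hM) hQ
  have h2 := hh.le (X := Z ∪ R ∪ Q) (Z := Z ∪ Q) hM hZQ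
    (controls_of_subset (by intro a; simp only [Finset.mem_union]; tauto) hM)
  unfold lossUnit
  linarith

lemma scaled_controls_scaled {X Z : Finset V9} {M ρ ρ' : ℝ} (h : Controls X Z M) (hρ : 0 < ρ)
    (hρ' : ρ ≤ ρ') : Controls (scaled ρ X) (scaled ρ' Z) M := by
  have h1 : Controls (scaled ρ X) (scaled ρ Z) M := controls_smul h
  intro v hv z hz
  obtain ⟨z', hz', rfl⟩ := Finset.mem_image.1 hz
  have h2 := h1 v hv _ (Finset.mem_image_of_mem _ hz')
  rw [smul_dotProduct, smul_eq_mul, abs_mul, abs_of_pos (inv_pos.2 hρ)] at h2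
  rw [smul_dotProduct, smul_eq_mul, abs_mul, abs_of_pos (inv_pos.2 (hρ.trans_le hρ'))]
  refine le_trans ?_ h2
  gcongr

/-- Scale level of each functional of a flag. -/
def lev : Fin 9 → Fin 5 := ![0, 1, 1, 2, 2, 2, 3, 3, 4]

/-- The functionals of a flag, each rescaled according to its level. -/
noncomputable def boxSet (s : Fin 5 → ℝ) (c : Fin 9 → V9) : Finset V9 :=
  Finset.univ.image fun k => (s (lev k))⁻¹ • c k

lemma boxSet_controls_scaled_flag {s : Fin 5 → ℝ} (hs : ∀ a, 0 < s a) (hmono : Monotone s)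
    {cv : Fin 9 → V9} {n : ℕ} {a : Fin 5} (ha : ∀ k : Fin 9, k.val < n → lev k ≤ a) :
    Controls (boxSet s cv) (scaled (s a) (flag cv n)) 1 := by
  intro v hv z hz
  obtain ⟨z', hz', rfl⟩ := Finset.mem_image.1 hz
  obtain ⟨k, hk, rfl⟩ := Finset.mem_image.1 hz'
  have h2 := hv _ (Finset.mem_image_of_mem _ (Finset.mem_univ k))
  rw [smul_dotProduct, smul_eq_mul, abs_mul, abs_of_pos (inv_pos.2 (hs _))] at h2 ⊢
  refine le_trans ?_ h2
  have := hs (lev k)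
  have := hmono (ha k (Finset.mem_filter.1 hk).2)
  gcongr

lemma SubLike.chain (hh : SubLike h c) (hc : 0 ≤ c) {M : ℝ} (hM : 1 ≤ M) {s : Fin 5 → ℝ}
    (hs : ∀ a, 0 < s a) (hmono : Monotone s) {cv : Fin 9 → V9}
    (hb : Controls stdSet (flag cv 9) M) (hf : Controls (flag cv 9) stdSet M) :
    (h (relSet (s 0) (s 1) (flag cv 1)) - h (relSet (s 0) (s 1) ∅))
    + (h (relSet (s 1) (s 2) (flag cv 3)) - h (relSet (s 1) (s 2) ∅))
    + (h (relSet (s 2) (s 3) (flag cv 6)) - h (relSet (s 2) (s 3) ∅))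
    + (h (relSet (s 3) (s 4) (flag cv 8)) - h (relSet (s 3) (s 4) ∅))
    + h (relSet (s 3) (s 4) ∅) ≤ h (boxSet s cv) + 10 * (c * lossUnit M) := by
  have rel0 : ∀ a b, relSet a b ∅ = scaled b stdSet := by
    intro a b; simp [relSet, scaled]
  have hl := mul_nonneg hc (lossUnit_nonneg hM)
  have hfl : ∀ n, flag cv n ⊆ flag cv 9 := fun n => by
    apply Finset.image_subset_image
    intro k; simp
  have ctr : ∀ {a b : Fin 5} (n : ℕ), a ≤ b → Controls (scaled (s a) stdSet)
      (scaled (s b) (flag cv n)) M := fun n hab =>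
    scaled_controls_scaled (hb.mono subset_rfl (hfl n) le_rfl) (hs _) (hmono hab)
  have ctrS : ∀ {a b : Fin 5}, a ≤ b → Controls (scaled (s a) stdSet)
      (scaled (s b) stdSet) M := fun hab =>
    scaled_controls_scaled (controls_of_subset subset_rfl hM) (hs _) (hmono hab)
  have cardf : ∀ (r : ℝ) n, (scaled r (flag cv n)).card ≤ 9 := fun r n =>
    (card_scaled_le _ _).trans (card_flag_le _ _)
  have cards : ∀ (r : ℝ), (scaled r stdSet).card ≤ 9 := fun r =>
    (card_scaled_le _ _).trans card_stdSet_le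
  have cardu : ∀ (X Y : Finset V9) (m n : ℕ), X.card ≤ m → Y.card ≤ n → (X ∪ Y).card ≤ m + n :=
    fun X Y m n hX hY => (Finset.card_union_le _ _).trans (add_le_add hX hY)
  set R4 := scaled (s 4) stdSet with hR4
  set R3 := scaled (s 3) (flag cv 8) ∪ R4 with hR3
  set R2 := scaled (s 2) (flag cv 6) ∪ R3 with hR2
  set R1 := scaled (s 1) (flag cv 3) ∪ R2 with hR1
  set R0 := scaled (s 0) (flag cv 1) ∪ R1 with hR0
  have c4 : R4.card ≤ 9 := cards _
  have c3 : R3.card ≤ 9 + 9 := cardu _ _ _ _ (cardf _ _) c4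
  have c2 : R2.card ≤ 9 + (9 + 9) := cardu _ _ _ _ (cardf _ _) c3
  have c1 : R1.card ≤ 9 + (9 + (9 + 9)) := cardu _ _ _ _ (cardf _ _) c2
  have c0 : R0.card ≤ 9 + (9 + (9 + (9 + 9))) := cardu _ _ _ _ (cardf _ _) c1
  have k3 : Controls (scaled (s 3) stdSet) R3 M := (ctr 8 le_rfl).union (ctrS (by decide))
  have k2 : Controls (scaled (s 2) stdSet) R2 M :=
    (ctr 6 le_rfl).union ((ctr 8 (by decide)).union (ctrS (by decide)))
  have k1 : Controls (scaled (s 1) stdSet) R1 M :=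
    (ctr 3 le_rfl).union ((ctr 6 (by decide)).union ((ctr 8 (by decide)).union
      (ctrS (by decide))))
  have b : ∀ {n : ℕ} {a : Fin 5}, (∀ k : Fin 9, k.val < n → lev k ≤ a) →
      Controls (boxSet s cv) (scaled (s a) (flag cv n)) M := fun hh' =>
    (boxSet_controls_scaled_flag hs hmono hh').mono subset_rfl subset_rfl hM
  have b4 : Controls (boxSet s cv) R4 M := by
    have e1 := boxSet_controls_scaled_flag hs hmono (cv := cv) (n := 9) (a := 4)
      (fun k _ => by revert k; decide)
    have e2 : Controls (scaled (s 4) (flag cv 9)) R4 M :=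
      scaled_controls_scaled hf (hs _) le_rfl
    simpa using e1.trans one_pos e2
  have b0 : Controls (boxSet s cv) R0 M :=
    (b (by decide)).union ((b (by decide)).union ((b (by decide)).union
      ((b (by decide)).union b4)))
  have f0 := hh.le hM (by omega) b0
  have f1 := hh.chain_step hM (Z := scaled (s 0) (flag cv 1)) (by omega)
    ((cardu _ _ _ _ (cardf _ _) (cards _)).trans (by norm_num)) k1
  have f2 := hh.chain_step hM (Z := scaled (s 1) (flag cv 3)) (by omega)
    ((cardu _ _ _ _ (cardf _ _) (cards _)).trans (by norm_num)) k2
  have f3 := hh.chain_step hM (Z := scaled (s 2) (flag cv 6)) (by omega)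
    ((cardu _ _ _ _ (cardf _ _) (cards _)).trans (by norm_num)) k3
  simp only [rel0]
  change _ ≤ _
  have r1 : ∀ a b X, relSet a b X = scaled a X ∪ scaled b stdSet := fun _ _ _ => rfl
  simp only [r1]
  have f4 : h (scaled (s 3) (flag cv 8) ∪ scaled (s 4) stdSet) = h R3 := rfl
  rw [f4]
  unfold lossUnit at *
  rw [← hR0] at f1
  rw [← hR1] at f2
  rw [← hR2] at f3
  linarith

/-- Total entropy of the boxes at all the points, in terms of isotropic entropies and entropies
along single functionals. -/
theorem SubLike.sum_boxSet (hh : SubLike h c) (hc : 0 ≤ c) {M : ℝ} (hM : 1 ≤ M) {s : Fin 5 → ℝ}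
    (hs : ∀ a, 0 < s a) (hmono : Monotone s) {cv : Fin 9 → Fin 3 → Fin 9 → V9}
    {g : Fin 3 → Fin 9 → V9} (hg : GenPos cv g M) :
    3 * h (scaled (s 0) stdSet) + 6 * h (scaled (s 1) stdSet) + 9 * h (scaled (s 2) stdSet)
      + 45 / 8 * h (scaled (s 3) stdSet)
      + 1 / 8 * ∑ j, ∑ a, h (relSet (s 3) (s 4) {g j a})
    ≤ ∑ t, ∑ j, h (boxSet s (cv t j)) + 1000 * (c * lossUnit M) := by
  have hl := mul_nonneg hc (lossUnit_nonneg hM)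
  have rel0 : ∀ a b, relSet a b ∅ = scaled b stdSet := by
    intro a b; simp [relSet, scaled]
  have e1 := (hh.relLike (s 0) (s 1)).sum_flag_one hc hM hg
  have e2 := (hh.relLike (s 1) (s 2)).sum_flag_three hc hM hg
  have e3 := (hh.relLike (s 2) (s 3)).sum_flag_six hc hM hg
  have e4 := (hh.relLike (s 3) (s 4)).sum_flag_eight hc hM hg
  have e5 := Finset.sum_le_sum fun t (_ : t ∈ (Finset.univ : Finset (Fin 9))) =>
    Finset.sum_le_sum fun j (_ : j ∈ (Finset.univ : Finset (Fin 3))) =>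
      hh.chain hc hM hs hmono (hg.bdd t j) (hg.full t j)
  have v : ∀ a b : ℝ, h (scaled a stdSet) ≤ h (relSet a b stdSet) + c * lossUnit M := fun a b =>
    hh.le hM ((card_scaled_le _ _).trans (card_stdSet_le.trans (by norm_num)))
      (controls_of_subset Finset.subset_union_left hM)
  have v1 := v (s 0) (s 1)
  have v2 := v (s 1) (s 2)
  have v3 := v (s 2) (s 3)
  have v4 := v (s 3) (s 4)
  simp only [rel0, Finset.sum_add_distrib, Finset.sum_sub_distrib, Finset.sum_const,
    Finset.card_univ, Fintype.card_fin, nsmul_eq_mul] at e1 e2 e3 e4 e5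
  push_cast at e1 e2 e3 e4 e5
  linarith

end chain

/-! ### Entropy bounds from counting -/

section counting

variable {Ω : Type*} {A F : Finset Ω} {ξ : Ω → V9}

lemma le_obsEnt_of_card_le (hA : A.Nonempty) (hAF : A ⊆ F) {b N : ℝ} (hb : 0 < b) (hN : 0 < N)
    (hbA : b * F.card ≤ A.card) {X : Finset V9}
    (h : ∀ w ∈ A, ((F.filter (fun w' => ∀ x ∈ X, |x ⬝ᵥ (ξ w' - ξ w)| ≤ 1)).card : ℝ)
      ≤ N * F.card) :
    Real.log b - Real.log N ≤ obsEnt A ξ X := by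
  have := neg_log_le_ent (A := A) hA (f := obs ξ X) (b := N / b) (by
    intro w hw
    calc fibCard A (obs ξ X) w
        ≤ ((F.filter (fun w' => ∀ x ∈ X, |x ⬝ᵥ (ξ w' - ξ w)| ≤ 1)).card : ℝ) := by
          unfold fibCard
          exact_mod_cast Finset.card_le_card fun w' hw' => by
            rw [Finset.mem_filter] at hw' ⊢
            exact ⟨hAF hw'.1, obs_eq_imp hw'.2⟩
      _ ≤ N * F.card := h w hw
      _ ≤ N / b * A.card := by
          rw [div_mul_eq_mul_div, le_div_iff₀ hb]
          nlinarith)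
  rw [Real.log_div hN.ne' hb.ne'] at this
  unfold obsEnt
  linarith

lemma obsEnt_le_of_le_card (hA : A.Nonempty) (hAF : A ⊆ F) {T : ℝ} (hT : 0 < T)
    {X : Finset V9}
    (h : ∀ w ∈ A, T * F.card
      ≤ ((F.filter (fun w' => ∀ x ∈ X, |x ⬝ᵥ (ξ w' - ξ w)| ≤ 1)).card : ℝ)) :
    obsEnt A ξ X ≤ X.card * Real.log 5 - Real.log T := by
  have hF : (0 : ℝ) < F.card := by exact_mod_cast (hA.mono hAF).card_pos
  set I := A.image (obs ξ X) with hI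
  have hrep : ∀ y ∈ I, ∃ w ∈ A, obs ξ X w = y := fun y hy => Finset.mem_image.1 hy
  have : Nonempty Ω := ⟨hA.choose⟩
  choose! r hr hr' using hrep
  set box : Ω → Finset Ω := fun w => F.filter (fun w' => ∀ x ∈ X, |x ⬝ᵥ (ξ w' - ξ w)| ≤ 1)
  have h1 : ∑ y ∈ I, ((box (r y)).card : ℝ) ≤ 5 ^ X.card * F.card := by
    have e1 : ∑ y ∈ I, (box (r y)).card
        = ∑ w' ∈ F, (I.filter (fun y => w' ∈ box (r y))).card := by
      simp_rw [Finset.card_filter]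
      rw [Finset.sum_comm]
      apply Finset.sum_congr rfl
      intro y _
      rw [← Finset.card_filter]
      congr 1
      ext w'
      simp [box]
    have e2 : ∀ w' ∈ F, ((I.filter (fun y => w' ∈ box (r y))).card : ℝ) ≤ 5 ^ X.card := by
      intro w' _
      have e3 := card_image_obs_le (ξ := ξ) (S := A.filter (fun w => w' ∈ box w)) (Z := X)
        (w := w') (M := 1) zero_le_one (by
          intro w hw z hz
          have := (Finset.mem_filter.1 (Finset.mem_filter.1 hw).2).2 z hz
          rw [dotProduct_sub, abs_sub_comm, ← dotProduct_sub]
          exact this)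
      norm_num at e3
      refine le_trans ?_ e3
      exact_mod_cast Finset.card_le_card fun y hy => by
        obtain ⟨hy1, hy2⟩ := Finset.mem_filter.1 hy
        exact Finset.mem_image.2 ⟨r y, Finset.mem_filter.2 ⟨hr y hy1, hy2⟩, hr' y hy1⟩
    calc ∑ y ∈ I, ((box (r y)).card : ℝ)
        = ∑ w' ∈ F, ((I.filter (fun y => w' ∈ box (r y))).card : ℝ) := by exact_mod_cast e1
      _ ≤ ∑ w' ∈ F, (5 : ℝ) ^ X.card := Finset.sum_le_sum e2
      _ = _ := by simp [mul_comm]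
  have h2 : (I.card : ℝ) * (T * F.card) ≤ 5 ^ X.card * F.card := by
    refine le_trans ?_ h1
    rw [← nsmul_eq_mul]
    exact Finset.card_nsmul_le_sum _ _ _ fun y hy => h _ (hr y hy)
  have h3 : (I.card : ℝ) ≤ 5 ^ X.card / T := by
    rw [le_div_iff₀ hT]
    have : (I.card * T) * F.card ≤ 5 ^ X.card * (F.card : ℝ) := by linarith
    exact le_of_mul_le_mul_right this hF
  have h4 := ent_le_log_image (A := A) hA (f := obs ξ X) (K := 5 ^ X.card / T) (by positivity) h3
  rwa [Real.log_div (by positivity) hT.ne', Real.log_pow] at h4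

end counting

/-! ### Sublevel sets of polynomials in one variable -/

lemma volume_piece_le {f f' : ℝ → ℝ} {s : Set ℝ} (hs : MeasurableSet s)
    (hf' : ∀ x ∈ s, HasDerivWithinAt f (f' x) s x) (hf : Set.InjOn f s) {ρ τ : ℝ} (hτ : 0 < τ)
    (h1 : ∀ x ∈ s, |f x| ≤ ρ) (h2 : ∀ x ∈ s, τ ≤ |f' x|) :
    volume s ≤ ENNReal.ofReal (2 * ρ / τ) := by
  have h3 := lintegral_image_eq_lintegral_abs_deriv_mul hs hf' hf (fun _ => 1)
  simp only [mul_one, setLIntegral_one] at h3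
  have h4 : volume (f '' s) ≤ ENNReal.ofReal (2 * ρ) := by
    calc volume (f '' s) ≤ volume (Set.Icc (-ρ) ρ) := by
          apply measure_mono
          rintro _ ⟨x, hx, rfl⟩
          exact abs_le.1 (h1 x hx)
      _ = ENNReal.ofReal (2 * ρ) := by rw [Real.volume_Icc]; ring_nf
  have h5 : ENNReal.ofReal τ * volume s ≤ ∫⁻ x in s, ENNReal.ofReal |f' x| := by
    rw [← setLIntegral_const]
    exact setLIntegral_mono' hs fun x hx => ENNReal.ofReal_le_ofReal (h2 x hx)
  have h6 : ENNReal.ofReal τ * volume s ≤ ENNReal.ofReal (2 * ρ) := h5.trans (h3 ▸ h4)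
  rw [ENNReal.ofReal_div_of_pos hτ, ENNReal.le_div_iff_mul_le
    (Or.inl (by simpa using hτ)) (Or.inl ENNReal.ofReal_ne_top), mul_comm]
  exact h6

lemma volume_sublevel_le (p : Polynomial ℝ) {D : ℕ} (hD : p.natDegree ≤ D) {ρ τ : ℝ} (hτ : 0 < τ) :
    volume {t : ℝ | |p.eval t| ≤ ρ ∧ τ ≤ |p.derivative.eval t|}
      ≤ ENNReal.ofReal (2 * (D + 1) * (ρ / τ)) := by
  by_cases hρ : ρ < 0
  · have : {t : ℝ | |p.eval t| ≤ ρ ∧ τ ≤ |p.derivative.eval t|} = ∅ := by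
      ext t
      simp only [Set.mem_setOf_eq, Set.mem_empty_iff_false, iff_false, not_and]
      intro h
      linarith [abs_nonneg (p.eval t)]
    simp [this]
  push Not at hρ
  by_cases hp : p.derivative = 0
  · have : {t : ℝ | |p.eval t| ≤ ρ ∧ τ ≤ |p.derivative.eval t|} = ∅ := by
      ext t
      simp [hp, hτ]
    simp [this]
  set N : ℝ → ℕ := fun t => (p.derivative.roots.toFinset.filter (· < t)).card with hN
  have hNmono : Monotone N := fun a b hab => Finset.card_le_card fun x hx => by
    rw [Finset.mem_filter] at hx ⊢
    exact ⟨hx.1, hx.2.trans_le hab⟩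
  have hND : ∀ t, N t ∈ Finset.range (D + 1) := by
    intro t
    rw [Finset.mem_range, Nat.lt_succ_iff]
    calc N t ≤ p.derivative.roots.toFinset.card := Finset.card_filter_le _ _
      _ ≤ Multiset.card p.derivative.roots := Multiset.toFinset_card_le _
      _ ≤ p.derivative.natDegree := Polynomial.card_roots' _
      _ ≤ p.natDegree := (Polynomial.natDegree_derivative_le p).trans (Nat.sub_le _ _)
      _ ≤ D := hD
  set E := {t : ℝ | |p.eval t| ≤ ρ ∧ τ ≤ |p.derivative.eval t|} with hE
  have hEm : MeasurableSet E := by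
    have h1 : Continuous fun t => |p.eval t| := p.continuous.abs
    have h2 : Continuous fun t => |p.derivative.eval t| := p.derivative.continuous.abs
    exact (measurableSet_le h1.measurable measurable_const).inter
      (measurableSet_le measurable_const h2.measurable)
  have hcov : E ⊆ ⋃ k ∈ Finset.range (D + 1), E ∩ N ⁻¹' {k} := by
    intro t ht
    simp only [Set.mem_iUnion]
    exact ⟨N t, hND t, ht, rfl⟩
  have hpiece : ∀ k ∈ Finset.range (D + 1), volume (E ∩ N ⁻¹' {k})
      ≤ ENNReal.ofReal (2 * ρ / τ) := by
    intro k _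
    apply volume_piece_le (f := fun t => p.eval t) (f' := fun t => p.derivative.eval t)
      (hEm.inter (hNmono.measurable (measurableSet_singleton k))) _ _ hτ
    · exact fun x hx => hx.1.1
    · exact fun x hx => hx.1.2
    · exact fun x _ => (p.hasDerivAt x).hasDerivWithinAt
    · have key : ∀ x ∈ E ∩ N ⁻¹' {k}, ∀ y ∈ E ∩ N ⁻¹' {k}, x < y → p.eval x ≠ p.eval y := by
        intro x hx y hy hxy heq
        obtain ⟨c, hc, hc'⟩ := exists_hasDerivAt_eq_zero (f' := fun t => p.derivative.eval t) hxy
          (p.continuous.continuousOn) heq (fun t _ => p.hasDerivAt t)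
        have : N x < N y := by
          apply Finset.card_lt_card
          refine ⟨fun z hz => ?_, fun h => ?_⟩
          · rw [Finset.mem_filter] at hz ⊢
            exact ⟨hz.1, hz.2.trans hxy⟩
          · have h1 : c ∈ p.derivative.roots.toFinset.filter (· < y) := by
              rw [Finset.mem_filter, Multiset.mem_toFinset, Polynomial.mem_roots hp]
              exact ⟨hc', hc.2⟩
            exact absurd (Finset.mem_filter.1 (h h1)).2 (not_lt.2 hc.1.le)
        rw [hx.2, hy.2] at this
        exact lt_irrefl _ this
      intro x hx y hy heq
      rcases lt_trichotomy x y with h | h | h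
      · exact absurd heq (key x hx y hy h)
      · exact h
      · exact absurd heq.symm (key y hy x hx h)
  calc volume E ≤ volume (⋃ k ∈ Finset.range (D + 1), E ∩ N ⁻¹' {k}) := measure_mono hcov
    _ ≤ ∑ k ∈ Finset.range (D + 1), volume (E ∩ N ⁻¹' {k}) := measure_biUnion_finset_le _ _
    _ ≤ ∑ k ∈ Finset.range (D + 1), ENNReal.ofReal (2 * ρ / τ) := Finset.sum_le_sum hpiece
    _ = ENNReal.ofReal (2 * (D + 1) * (ρ / τ)) := by
        rw [Finset.sum_const, Finset.card_range, nsmul_eq_mul, ← ENNReal.ofReal_natCast,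
          ← ENNReal.ofReal_mul (by positivity)]
        congr 1
        push_cast
        ring

/-! ### Random parameters -/

/-- The indices of the 27 parameter pairs. -/
abbrev Idx : Type := Fin 9 × Fin 3

/-- Tuples of 27 parameter pairs. -/
abbrev Par : Type := Idx → ℝ × ℝ

/-- The coordinates of a tuple of parameters. -/
def val (x : Par) (κ : Idx × Fin 2) : ℝ := if κ.2 = 0 then (x κ.1).1 else (x κ.1).2

/-- The uniform probability measure on `[-1, 1]`. -/
noncomputable def nuI : Measure ℝ := (2⁻¹ : ENNReal) • volume.restrict (Set.Icc (-1) 1)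

instance : IsProbabilityMeasure nuI := ⟨by
  simp only [nuI, Measure.smul_apply, Measure.restrict_apply MeasurableSet.univ, Set.univ_inter,
    Real.volume_Icc, smul_eq_mul]
  norm_num
  exact ENNReal.inv_mul_cancel (by norm_num) (by norm_num)⟩

lemma nuI_le (S : Set ℝ) : nuI S ≤ volume S := by
  simp only [nuI, Measure.smul_apply, smul_eq_mul]
  calc (2⁻¹ : ENNReal) * volume.restrict (Set.Icc (-1) 1) S ≤ 1 * volume S := by
        exact mul_le_mul' (by norm_num) (Measure.restrict_apply_le _ _)
    _ = volume S := one_mul _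

/-- The uniform probability measure on the parameter square. -/
noncomputable def mPar : Measure (ℝ × ℝ) := nuI.prod nuI

instance : IsProbabilityMeasure mPar := by unfold mPar; infer_instance

/-- The law of 27 independent uniform parameters. -/
noncomputable def lawP : Measure Par := Measure.pi fun _ => mPar

instance : IsProbabilityMeasure lawP := by unfold lawP; infer_instance

/-- The parameter cube. -/
def cube : Set Par := {x | ∀ κ, |val x κ| ≤ 1}

lemma continuous_val : Continuous val := by
  apply continuous_pi
  rintro ⟨k, b⟩
  unfold val
  fin_cases b <;> simp <;> fun_prop

lemma continuous_eval_val (p : MvPolynomial (Idx × Fin 2) ℝ) :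
    Continuous fun x => MvPolynomial.eval (val x) p :=
  (MvPolynomial.continuous_eval p).comp continuous_val

/-- Substitution freezing all variables but `κ`. -/
noncomputable def freeze (κ : Idx × Fin 2) (x : Par) (κ' : Idx × Fin 2) : Polynomial ℝ :=
  if κ' = κ then Polynomial.X else Polynomial.C (val x κ')

lemma eval_freeze (κ : Idx × Fin 2) (x : Par) (t : ℝ) (p : MvPolynomial (Idx × Fin 2) ℝ) :
    (MvPolynomial.aeval (freeze κ x) p).eval t
      = MvPolynomial.eval (fun κ' => (freeze κ x κ').eval t) p := by
  induction p using MvPolynomial.induction_on with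
  | C a => simp
  | add p q hp hq => simp [hp, hq]
  | mul_X p n hp => simp [hp]

lemma derivative_freeze (κ : Idx × Fin 2) (x : Par) (p : MvPolynomial (Idx × Fin 2) ℝ) :
    Polynomial.derivative (MvPolynomial.aeval (freeze κ x) p)
      = MvPolynomial.aeval (freeze κ x) (MvPolynomial.pderiv κ p) := by
  induction p using MvPolynomial.induction_on with
  | C a => simp
  | add p q hp hq => simp [hp, hq]
  | mul_X p n hp =>
    simp only [map_mul, Polynomial.derivative_mul, hp, MvPolynomial.aeval_X, MvPolynomial.pderiv_mul,
      map_add]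
    congr 2
    by_cases h : n = κ
    · subst h; simp [freeze]
    · simp [freeze, h, MvPolynomial.pderiv_X_of_ne h]

lemma freeze_slice (κ : Idx × Fin 2) (x : Par) (p : MvPolynomial (Idx × Fin 2) ℝ) {D : ℕ}
    (hD : p.totalDegree ≤ D) {ρ τ : ℝ} (hτ : 0 < τ) :
    nuI {t | |MvPolynomial.eval (fun κ' => (freeze κ x κ').eval t) p| ≤ ρ ∧
        τ ≤ |MvPolynomial.eval (fun κ' => (freeze κ x κ').eval t) (MvPolynomial.pderiv κ p)|}
      ≤ ENNReal.ofReal (2 * (D + 1) * (ρ / τ)) := by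
  refine (nuI_le _).trans ?_
  have h := volume_sublevel_le (MvPolynomial.aeval (freeze κ x) p) (D := D) (ρ := ρ) (τ := τ) (by
    have := MvPolynomial.aeval_natDegree_le (m := D) (n := 1) p hD (freeze κ x) (fun i => by
      unfold freeze
      split_ifs <;> simp)
    simpa using this) hτ
  simpa only [derivative_freeze, eval_freeze] using h

lemma lawP_slice (κ : Idx × Fin 2) (p : MvPolynomial (Idx × Fin 2) ℝ) {D : ℕ}
    (hD : p.totalDegree ≤ D) {ρ τ : ℝ} (hτ : 0 < τ) :
    lawP {x | |MvPolynomial.eval (val x) p| ≤ ρ ∧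
        τ ≤ |MvPolynomial.eval (val x) (MvPolynomial.pderiv κ p)|}
      ≤ ENNReal.ofReal (2 * (D + 1) * (ρ / τ)) := by
  set E := {x : Par | |MvPolynomial.eval (val x) p| ≤ ρ ∧
        τ ≤ |MvPolynomial.eval (val x) (MvPolynomial.pderiv κ p)|} with hE
  have hEm : MeasurableSet E :=
    (measurableSet_le (continuous_eval_val p).abs.measurable measurable_const).inter
      (measurableSet_le measurable_const (continuous_eval_val _).abs.measurable)
  set c := ENNReal.ofReal (2 * (D + 1) * (ρ / τ))
  obtain ⟨k, b⟩ := κ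
  have key : ∀ x : Par, mPar {y | Function.update x k y ∈ E} ≤ c := by
    intro x
    have hm : MeasurableSet {y | Function.update x k y ∈ E} :=
      (measurable_update x) hEm
    fin_cases b
    · rw [mPar, Measure.prod_apply_symm hm]
      calc _ ≤ ∫⁻ y, c ∂nuI := by
            apply lintegral_mono
            intro y
            have := freeze_slice (k, 0) (Function.update x k (0, y)) p hD (ρ := ρ) hτ
            convert this using 2
            ext t
            have : val (Function.update x k (t, y))
              = fun κ' => (freeze (k, 0) (Function.update x k (0, y)) κ').eval t := by
              ext ⟨k', b'⟩
              by_cases hk : k' = k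
              · subst hk
                fin_cases b' <;> simp [val, freeze]
              · fin_cases b' <;> simp [val, freeze, hk]
            simp [hE, this]
        _ = c := by simp
    · rw [mPar, Measure.prod_apply hm]
      calc _ ≤ ∫⁻ y, c ∂nuI := by
            apply lintegral_mono
            intro y
            have := freeze_slice (k, 1) (Function.update x k (y, 0)) p hD (ρ := ρ) hτ
            convert this using 2
            ext t
            have : val (Function.update x k (y, t))
              = fun κ' => (freeze (k, 1) (Function.update x k (y, 0)) κ').eval t := by
              ext ⟨k', b'⟩
              by_cases hk : k' = k
              · subst hk
                fin_cases b' <;> simp [val, freeze]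
              · fin_cases b' <;> simp [val, freeze, hk]
            simp [hE, this]
        _ = c := by simp
  have h1 := lintegral_le_of_lmarginal_le (μ := fun _ : Idx => mPar) {k}
    (f := E.indicator 1) (g := fun _ => c) (measurable_one.indicator hEm) measurable_const (by
      intro x
      rw [lmarginal_singleton, lmarginal_singleton]
      simp only [lintegral_const, measure_univ, mul_one]
      have : ∀ y, E.indicator (1 : Par → ENNReal) (Function.update x k y)
          = {y | Function.update x k y ∈ E}.indicator 1 y := fun y => rfl
      simp only [this]
      rw [lintegral_indicator_one (show MeasurableSet {y | Function.update x k y ∈ E} from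
        measurable_update x hEm)]
      exact key x)
  rw [lintegral_indicator_one hEm] at h1
  simpa [lawP] using h1

lemma exists_pderiv_ne_zero {p : MvPolynomial (Idx × Fin 2) ℝ} (h : 0 < p.totalDegree) :
    ∃ κ, MvPolynomial.pderiv κ p ≠ 0 ∧ (MvPolynomial.pderiv κ p).totalDegree < p.totalDegree := by
  have hp : p ≠ 0 := by rintro rfl; simp at h
  have hlt : ∀ κ, (MvPolynomial.pderiv κ p).totalDegree < p.totalDegree := by
    intro κ
    rw [MvPolynomial.totalDegree, Finset.sup_lt_iff h]
    intro m hm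
    rw [MvPolynomial.mem_support_iff, MvPolynomial.coeff_pderiv] at hm
    have := MvPolynomial.le_totalDegree (MvPolynomial.mem_support_iff.2 (left_ne_zero_of_mul hm))
    rw [Finsupp.sum_add_index' (by simp) (by simp)] at this
    simp at this
    exact this
  obtain ⟨m, hm, hm'⟩ : ∃ m ∈ p.support, m ≠ 0 := by
    by_contra hcon
    push Not at hcon
    have : p.totalDegree = 0 := by
      rw [MvPolynomial.totalDegree_eq_zero_iff]
      intro m hm x
      simp [hcon m hm]
    omega
  obtain ⟨κ, hκ⟩ := Finsupp.ne_iff.1 hm'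
  refine ⟨κ, fun h0 => ?_, hlt κ⟩
  have h1 := MvPolynomial.coeff_pderiv (i := κ) p (m - Finsupp.single κ 1)
  rw [h0, tsub_add_cancel_of_le (by
    rw [Finsupp.single_le_iff]; exact Nat.one_le_iff_ne_zero.2 hκ)] at h1
  rw [MvPolynomial.coeff_zero] at h1
  have h2 := MvPolynomial.mem_support_iff.1 hm
  have h3 : ((m - Finsupp.single κ 1 : (Idx × Fin 2) →₀ ℕ) κ : ℝ) + 1 ≠ 0 := by positivity
  exact mul_ne_zero h2 h3 h1.symm

/-- Nonzero polynomials are rarely small. -/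
lemma lawP_sublevel (n : ℕ) : ∀ p : MvPolynomial (Idx × Fin 2) ℝ, p ≠ 0 → p.totalDegree ≤ n →
    ∃ C c : ℝ, 0 < c ∧ 0 ≤ C ∧ ∀ τ : ℝ, 0 < τ → τ ≤ 1 →
      lawP {x | |MvPolynomial.eval (val x) p| ≤ τ} ≤ ENNReal.ofReal (C * τ ^ c) := by
  induction n with
  | zero =>
    intro p hp hd
    rw [Nat.le_zero, MvPolynomial.totalDegree_eq_zero_iff_eq_C] at hd
    set a := p.coeff 0
    have ha : a ≠ 0 := fun h => hp (by rw [hd, h]; simp)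
    refine ⟨|a|⁻¹, 1, one_pos, by positivity, fun τ hτ _ => ?_⟩
    by_cases h : |a| ≤ τ
    · refine prob_le_one.trans ?_
      rw [Real.rpow_one, ENNReal.one_le_ofReal, inv_mul_eq_div, one_le_div (abs_pos.2 ha)]
      exact h
    · have : {x : Par | |MvPolynomial.eval (val x) p| ≤ τ} = ∅ := by
        ext x
        rw [hd]
        simpa using h
      simp [this]
  | succ n ih =>
    intro p hp hd
    by_cases h : p.totalDegree ≤ n
    · exact ih p hp h
    obtain ⟨κ, hκ, hκ'⟩ := exists_pderiv_ne_zero (p := p) (by omega)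
    obtain ⟨C, c, hc, hC, H⟩ := ih _ hκ (by omega)
    refine ⟨2 * (n + 1 + 1) + C, min (1/2) (c/2), by positivity, by positivity, fun τ hτ hτ1 => ?_⟩
    have hs : 0 < Real.sqrt τ := Real.sqrt_pos.2 hτ
    have hs1 : Real.sqrt τ ≤ 1 := Real.sqrt_le_one.2 hτ1
    have h1 := lawP_slice κ p hd (ρ := τ) hs
    have h2 := H _ hs hs1
    calc _ ≤ lawP ({x | |MvPolynomial.eval (val x) p| ≤ τ ∧
              √τ ≤ |MvPolynomial.eval (val x) (MvPolynomial.pderiv κ p)|} ∪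
              {x | |MvPolynomial.eval (val x) (MvPolynomial.pderiv κ p)| ≤ √τ}) := by
          apply measure_mono
          intro x hx
          rcases le_total (√τ) |MvPolynomial.eval (val x) (MvPolynomial.pderiv κ p)| with h | h
          · exact Or.inl ⟨hx, h⟩
          · exact Or.inr h
      _ ≤ _ := measure_union_le _ _
      _ ≤ ENNReal.ofReal (2 * (↑(n+1) + 1) * (τ / √τ)) + ENNReal.ofReal (C * √τ ^ c) :=
          add_le_add h1 h2
      _ ≤ _ := by
          rw [← ENNReal.ofReal_add (by positivity) (by positivity), Real.div_sqrt, Real.sqrt_eq_rpow,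
            ← Real.rpow_mul hτ.le, add_mul]
          apply ENNReal.ofReal_le_ofReal
          push_cast
          refine add_le_add (mul_le_mul_of_nonneg_left ?_ (by positivity))
            (mul_le_mul_of_nonneg_left ?_ hC)
          · exact Real.rpow_le_rpow_of_exponent_ge hτ hτ1 (min_le_left _ _)
          · exact Real.rpow_le_rpow_of_exponent_ge hτ hτ1 ((min_le_right _ _).trans (by linarith))

/-! ### Polynomial functions of the parameters -/

/-- Polynomial functions of the parameters. -/
def PolyFun (f : Par → ℝ) : Prop := ∃ p, ∀ x, f x = MvPolynomial.eval (val x) p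

namespace PolyFun

lemma const (a : ℝ) : PolyFun fun _ => a := ⟨MvPolynomial.C a, by simp⟩

lemma fst (k : Idx) : PolyFun fun x => (x k).1 := ⟨MvPolynomial.X (k, 0), by simp [val]⟩

lemma snd (k : Idx) : PolyFun fun x => (x k).2 := ⟨MvPolynomial.X (k, 1), by simp [val]⟩

variable {f g : Par → ℝ}

lemma add (hf : PolyFun f) (hg : PolyFun g) : PolyFun fun x => f x + g x := by
  obtain ⟨p, hp⟩ := hf
  obtain ⟨q, hq⟩ := hg
  exact ⟨p + q, by simp [hp, hq]⟩

lemma sub (hf : PolyFun f) (hg : PolyFun g) : PolyFun fun x => f x - g x := by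
  obtain ⟨p, hp⟩ := hf
  obtain ⟨q, hq⟩ := hg
  exact ⟨p - q, by simp [hp, hq]⟩

lemma mul (hf : PolyFun f) (hg : PolyFun g) : PolyFun fun x => f x * g x := by
  obtain ⟨p, hp⟩ := hf
  obtain ⟨q, hq⟩ := hg
  exact ⟨p * q, by simp [hp, hq]⟩

lemma neg (hf : PolyFun f) : PolyFun fun x => - f x := by
  obtain ⟨p, hp⟩ := hf
  exact ⟨-p, by simp [hp]⟩

lemma pow (hf : PolyFun f) (n : ℕ) : PolyFun fun x => f x ^ n := by
  obtain ⟨p, hp⟩ := hf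
  exact ⟨p ^ n, by simp [hp]⟩

lemma sum {ι : Type*} (s : Finset ι) {f : ι → Par → ℝ} (hf : ∀ i, PolyFun (f i)) :
    PolyFun fun x => ∑ i ∈ s, f i x := by
  choose p hp using hf
  exact ⟨∑ i ∈ s, p i, by simp [hp]⟩

lemma prod {ι : Type*} (s : Finset ι) {f : ι → Par → ℝ} (hf : ∀ i, PolyFun (f i)) :
    PolyFun fun x => ∏ i ∈ s, f i x := by
  choose p hp using hf
  exact ⟨∏ i ∈ s, p i, by simp [hp]⟩

lemma det {n : Type*} [Fintype n] [DecidableEq n] {A : Par → Matrix n n ℝ}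
    (hA : ∀ i j, PolyFun fun x => A x i j) : PolyFun fun x => (A x).det := by
  simp only [Matrix.det_apply']
  exact sum _ fun σ => (const _).mul (prod _ fun i => hA _ _)

lemma dotProduct {n : Type*} [Fintype n] {u v : Par → n → ℝ} (hu : ∀ i, PolyFun fun x => u x i)
    (hv : ∀ i, PolyFun fun x => v x i) : PolyFun fun x => u x ⬝ᵥ v x :=
  sum _ fun i => (hu i).mul (hv i)

lemma exists_bound (hf : PolyFun f) : ∃ B : ℝ, 1 ≤ B ∧ ∀ x ∈ cube, |f x| ≤ B := by
  obtain ⟨p, hp⟩ := hf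
  simp only [hp]
  clear hp
  induction p using MvPolynomial.induction_on with
  | C a => exact ⟨max 1 |a|, le_max_left _ _, fun x _ => by simp⟩
  | add p q hp hq =>
    obtain ⟨B, hB, h1⟩ := hp
    obtain ⟨B', hB', h2⟩ := hq
    refine ⟨B + B', by linarith, fun x hx => ?_⟩
    rw [map_add]
    exact (abs_add_le _ _).trans (add_le_add (h1 x hx) (h2 x hx))
  | mul_X p n hp =>
    obtain ⟨B, hB, h1⟩ := hp
    refine ⟨B, hB, fun x hx => ?_⟩
    rw [map_mul, abs_mul, MvPolynomial.eval_X]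
    calc _ ≤ B * 1 := mul_le_mul (h1 x hx) (hx n) (abs_nonneg _) (by linarith)
      _ = B := mul_one B

lemma continuous (hf : PolyFun f) : Continuous f := by
  obtain ⟨p, hp⟩ := hf
  rw [show f = fun x => MvPolynomial.eval (val x) p from funext hp]
  exact continuous_eval_val p

end PolyFun

/-! ### Quantitatively generic properties -/

/-- `P x M` holds for all parameters outside a set of measure polynomially small in `M⁻¹`. -/
def Gen (P : Par → ℝ → Prop) : Prop :=
  ∃ C c : ℝ, 0 < c ∧ 0 ≤ C ∧ ∀ M : ℝ, 1 ≤ M →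
    lawP {x | x ∈ cube ∧ ¬ P x M} ≤ ENNReal.ofReal (C * M ^ (-c))

namespace Gen

lemma of_ne {f : Par → ℝ} (hf : PolyFun f) (x₀ : Par) (h : f x₀ ≠ 0) :
    Gen fun x M => 1 ≤ M * |f x| := by
  obtain ⟨p, hp⟩ := hf
  have hp0 : p ≠ 0 := by rintro rfl; exact h (by simp [hp])
  obtain ⟨C, c, hc, hC, H⟩ := lawP_sublevel _ p hp0 le_rfl
  refine ⟨C, c, hc, hC, fun M hM => ?_⟩
  have hM0 : 0 < M := by linarith
  refine le_trans (measure_mono ?_) ((H M⁻¹ (by positivity) (inv_le_one_of_one_le₀ hM)).trans ?_)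
  · rintro x ⟨_, hx⟩
    rw [not_le, hp] at hx
    rw [Set.mem_ofPred_eq, inv_eq_one_div, le_div_iff₀' hM0]
    exact hx.le
  · rw [Real.inv_rpow hM0.le, Real.rpow_neg hM0.le]

lemma and {P Q : Par → ℝ → Prop} (hP : Gen P) (hQ : Gen Q) : Gen fun x M => P x M ∧ Q x M := by
  obtain ⟨C, c, hc, hC, H⟩ := hP
  obtain ⟨C', c', hc', hC', H'⟩ := hQ
  refine ⟨C + C', min c c', lt_min hc hc', by positivity, fun M hM => ?_⟩
  calc _ ≤ lawP ({x | x ∈ cube ∧ ¬ P x M} ∪ {x | x ∈ cube ∧ ¬ Q x M}) := by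
        apply measure_mono
        rintro x ⟨hx, h⟩
        rw [not_and_or] at h
        exact h.imp (fun h => ⟨hx, h⟩) fun h => ⟨hx, h⟩
    _ ≤ _ := measure_union_le _ _
    _ ≤ ENNReal.ofReal (C * M ^ (-c)) + ENNReal.ofReal (C' * M ^ (-c')) :=
        add_le_add (H M hM) (H' M hM)
    _ ≤ _ := by
        rw [← ENNReal.ofReal_add (by positivity) (by positivity), add_mul]
        apply ENNReal.ofReal_le_ofReal
        exact add_le_add
          (mul_le_mul_of_nonneg_left (Real.rpow_le_rpow_of_exponent_le hM
            (neg_le_neg (min_le_left _ _))) hC)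
          (mul_le_mul_of_nonneg_left (Real.rpow_le_rpow_of_exponent_le hM
            (neg_le_neg (min_le_right _ _))) hC')

lemma mono {P Q : Par → ℝ → Prop} (hP : Gen P)
    (h : ∃ (a : ℝ) (n : ℕ), 1 ≤ a ∧ ∀ x ∈ cube, ∀ M, 1 ≤ M → P x M → Q x (a * M ^ (n + 1))) :
    Gen Q := by
  obtain ⟨C, c, hc, hC, H⟩ := hP
  obtain ⟨a, n, ha, h⟩ := h
  have ha0 : 0 < a := by linarith
  refine ⟨max C 1 * a ^ (c / (n + 1)), c / (n + 1), by positivity, by positivity, fun M hM => ?_⟩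
  have hM0 : 0 < M := by linarith
  by_cases hMa : M < a
  · refine prob_le_one.trans ?_
    rw [ENNReal.one_le_ofReal, mul_assoc]
    have h1 : 1 ≤ a ^ (c / (n + 1)) * M ^ (-(c / (n + 1))) := by
      rw [Real.rpow_neg hM0.le, ← div_eq_mul_inv, ← Real.div_rpow ha0.le hM0.le]
      apply Real.one_le_rpow _ (by positivity)
      rw [one_le_div hM0]
      exact hMa.le
    calc (1:ℝ) = 1 * 1 := (one_mul 1).symm
      _ ≤ _ := mul_le_mul (le_max_right _ _) h1 zero_le_one (by positivity)
  push Not at hMa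
  set M' := (M / a) ^ ((1:ℝ) / (n + 1)) with hM'
  have hMa1 : 1 ≤ M / a := by rwa [one_le_div ha0]
  have hM'1 : 1 ≤ M' := Real.one_le_rpow hMa1 (by positivity)
  have hpow : a * M' ^ (n + 1) = M := by
    rw [hM', ← Real.rpow_natCast, ← Real.rpow_mul (by positivity)]
    push_cast
    rw [one_div_mul_cancel (by positivity), Real.rpow_one]
    field_simp
  refine le_trans (measure_mono ?_) ((H M' hM'1).trans ?_)
  · rintro x ⟨hx, hq⟩
    refine ⟨hx, fun hp => hq ?_⟩
    have := h x hx M' hM'1 hp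
    rwa [hpow] at this
  · apply ENNReal.ofReal_le_ofReal
    rw [hM', ← Real.rpow_mul (by positivity), Real.div_rpow hM0.le ha0.le, mul_assoc]
    have e : (1:ℝ) / (n + 1) * -c = -(c / (n + 1)) := by ring
    rw [e, Real.rpow_neg ha0.le, div_inv_eq_mul, mul_comm (M ^ _)]
    gcongr
    exact le_max_left _ _

lemma congr {P Q : Par → ℝ → Prop} (hP : Gen P) (h : ∀ x ∈ cube, ∀ M, 1 ≤ M → P x M → Q x M) :
    Gen Q := hP.mono ⟨1, 0, le_rfl, fun x hx M hM hp => by simpa using h x hx M hM hp⟩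

lemma triv {P : Par → ℝ → Prop} (h : ∀ x ∈ cube, ∀ M, 1 ≤ M → P x M) : Gen P :=
  ⟨0, 1, one_pos, le_rfl, fun M hM => by
    have : {x | x ∈ cube ∧ ¬ P x M} = ∅ := by
      ext x
      simp only [Set.mem_ofPred_eq, Set.mem_empty_iff_false, iff_false, not_and, not_not]
      exact fun hx => h x hx M hM
    simp [this]⟩

lemma all_finset {ι : Type*} (s : Finset ι) {P : ι → Par → ℝ → Prop} (h : ∀ i, Gen (P i)) :
    Gen fun x M => ∀ i ∈ s, P i x M := by
  induction s using Finset.induction_on with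
  | empty => exact triv (by simp)
  | insert a s ha ih =>
    refine ((h a).and ih).congr ?_
    intro x _ M _ hh i hi
    rcases Finset.mem_insert.1 hi with rfl | hi
    · exact hh.1
    · exact hh.2 i hi

lemma all {ι : Type*} [Fintype ι] {P : ι → Par → ℝ → Prop} (h : ∀ i, Gen (P i)) :
    Gen fun x M => ∀ i, P i x M :=
  (all_finset Finset.univ h).congr fun _ _ _ _ hh i => hh i (Finset.mem_univ i)

end Gen

/-- Vectors depending polynomially on the parameters. -/
def PolyVec {n : Type*} (R : Par → n → ℝ) : Prop := ∀ i, PolyFun fun x => R x i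

lemma exists_bound_family {ι : Type*} [Fintype ι] {f : ι → Par → ℝ} (hf : ∀ i, PolyFun (f i)) :
    ∃ B : ℝ, 1 ≤ B ∧ ∀ x ∈ cube, ∀ i, |f i x| ≤ B := by
  choose B hB h using fun i => (hf i).exists_bound
  refine ⟨1 + ∑ i, B i, ?_, fun x hx i => (h i x hx).trans ?_⟩
  · have := Finset.sum_nonneg fun i (_ : i ∈ Finset.univ) => zero_le_one.trans (hB i)
    linarith
  · have := Finset.single_le_sum (f := B) (fun i _ => zero_le_one.trans (hB i)) (Finset.mem_univ i)
    linarith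

lemma abs_dotProduct_le {n : Type*} [Fintype n] {u v : n → ℝ} {a b : ℝ} (hu : ∀ i, |u i| ≤ a)
    (hv : ∀ i, |v i| ≤ b) : |u ⬝ᵥ v| ≤ Fintype.card n * (a * b) := by
  calc |u ⬝ᵥ v| ≤ ∑ i, |u i * v i| := Finset.abs_sum_le_sum_abs _ _
    _ ≤ ∑ _i : n, a * b := Finset.sum_le_sum fun i _ => by
        rw [abs_mul]
        exact mul_le_mul (hu i) (hv i) (abs_nonneg _) ((abs_nonneg _).trans (hu i))
    _ = Fintype.card n * (a * b) := by simp

/-- Functionals that are jointly injective for one choice of the parameters are quantitatively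
injective for generic parameters. -/
lemma gen_inj {ι : Type*} [Fintype ι] (R : ι → Par → V9) (hR : ∀ i, PolyVec (R i)) (x₀ : Par)
    (h₀ : ∀ v : V9, (∀ i, R i x₀ ⬝ᵥ v = 0) → v = 0) :
    Gen fun x M => ∀ v : V9, (∀ i, |R i x ⬝ᵥ v| ≤ 1) → ∀ k, |v k| ≤ M := by
  set A : Par → Matrix ι (Fin 9) ℝ := fun x => Matrix.of fun i => R i x with hA
  have hAp : ∀ i j, PolyFun fun x => A x i j := fun i j => hR i j
  have hG : ∀ i j, PolyFun fun x => ((A x)ᵀ * A x) i j := fun i j => by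
    simp only [Matrix.mul_apply, Matrix.transpose_apply]
    exact PolyFun.sum _ fun k => (hAp _ _).mul (hAp _ _)
  have hadj : ∀ i j, PolyFun fun x => ((A x)ᵀ * A x).adjugate i j := fun i j => by
    simp only [Matrix.adjugate_apply]
    refine PolyFun.det fun k l => ?_
    by_cases hk : k = j
    · subst hk
      simpa using PolyFun.const _
    · simpa [Matrix.updateRow_ne hk] using hG k l
  have hW : ∀ q : Fin 9 × ι, PolyFun fun x => (((A x)ᵀ * A x).adjugate * (A x)ᵀ) q.1 q.2 := by
    rintro ⟨i, j⟩
    simp only [Matrix.mul_apply (N := (A _)ᵀ), Matrix.transpose_apply]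
    exact PolyFun.sum _ fun k => (hadj _ _).mul (hAp _ _)
  obtain ⟨B, hB, hB'⟩ := exists_bound_family hW
  have hdet : ((A x₀)ᵀ * A x₀).det ≠ 0 := by
    intro h
    obtain ⟨v, hv, hv0⟩ := Matrix.exists_mulVec_eq_zero_iff.2 h
    apply hv
    apply h₀
    have h1 : (A x₀ *ᵥ v) ⬝ᵥ (A x₀ *ᵥ v) = 0 := by
      have : v ⬝ᵥ (((A x₀)ᵀ * A x₀) *ᵥ v) = 0 := by rw [hv0, dotProduct_zero]
      rwa [← Matrix.mulVec_mulVec, Matrix.dotProduct_mulVec, Matrix.vecMul_transpose] at this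
    exact fun i => congrFun (dotProduct_self_eq_zero.1 h1) i
  refine (Gen.of_ne (PolyFun.det hG) x₀ hdet).mono
    ⟨Fintype.card ι * B + 1, 0, by
      have : 0 ≤ (Fintype.card ι : ℝ) * B := by positivity
      linarith, fun x hx M hM h v hv k => ?_⟩
  have h1 : ((((A x)ᵀ * A x).adjugate * (A x)ᵀ) *ᵥ (A x *ᵥ v)) k
      = ((A x)ᵀ * A x).det * v k := by
    rw [Matrix.mulVec_mulVec, Matrix.mul_assoc, Matrix.adjugate_mul, Matrix.smul_mulVec,
      Matrix.one_mulVec]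
    rfl
  have h2 := abs_dotProduct_le (u := (((A x)ᵀ * A x).adjugate * (A x)ᵀ) k) (v := A x *ᵥ v)
    (fun i => hB' x hx (k, i)) (b := 1) (fun i => hv i)
  have h3 : |((A x)ᵀ * A x).det| * |v k| ≤ Fintype.card ι * (B * 1) := by
    rw [← abs_mul, ← h1]
    exact h2
  rw [zero_add, pow_one]
  calc |v k| ≤ (M * |((A x)ᵀ * A x).det|) * |v k| := le_mul_of_one_le_left (abs_nonneg _) h
    _ = M * (|((A x)ᵀ * A x).det| * |v k|) := by ring
    _ ≤ M * (Fintype.card ι * (B * 1)) := by gcongr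
    _ ≤ _ := by nlinarith

lemma gen_controls_std {ι : Type*} [Fintype ι] (R : ι → Par → V9) (hR : ∀ i, PolyVec (R i))
    (x₀ : Par) (h₀ : ∀ v : V9, (∀ i, R i x₀ ⬝ᵥ v = 0) → v = 0) (X : Par → Finset V9)
    (hX : ∀ x i, R i x ∈ X x) : Gen fun x M => Controls (X x) stdSet M := by
  refine (gen_inj R hR x₀ h₀).congr fun x _ M _ h v hv z hz => ?_
  obtain ⟨k, -, rfl⟩ := Finset.mem_image.1 hz
  rw [single_one_dotProduct]
  exact h v (fun i => hv _ (hX x i)) k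

/-- Polynomial linear combinations are controlled. -/
lemma gen_controls_comb {ι : Type*} [Fintype ι] {R : ι → Par → V9} {a : ι → Par → ℝ}
    (ha : ∀ i, PolyFun (a i)) {f : Par → ℝ} (hf : PolyFun f) (x₀ : Par) (hx₀ : f x₀ ≠ 0)
    {p : Par → V9} (hp : ∀ x, f x • p x = ∑ i, a i x • R i x) {X : Par → Finset V9}
    (hX : ∀ x i, R i x ∈ X x) : Gen fun x M => Controls (X x) {p x} M := by
  obtain ⟨B, hB, hB'⟩ := exists_bound_family ha
  refine (Gen.of_ne hf x₀ hx₀).mono ⟨Fintype.card ι * B + 1, 0, by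
      have : 0 ≤ (Fintype.card ι : ℝ) * B := by positivity
      linarith, fun x hx M hM h v hv z hz => ?_⟩
  rw [Finset.mem_singleton] at hz
  subst hz
  have h1 : f x * (p x ⬝ᵥ v) = (fun i => a i x) ⬝ᵥ (fun i => R i x ⬝ᵥ v) := by
    rw [← smul_eq_mul, ← smul_dotProduct, hp, sum_dotProduct]
    simp only [smul_dotProduct, smul_eq_mul]
    rfl
  have h2 := abs_dotProduct_le (u := fun i => a i x) (v := fun i => R i x ⬝ᵥ v) (b := 1)
    (fun i => hB' x hx i) (fun i => hv _ (hX x i))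
  rw [← h1, abs_mul] at h2
  rw [zero_add, pow_one]
  calc |p x ⬝ᵥ v| ≤ (M * |f x|) * |p x ⬝ᵥ v| := le_mul_of_one_le_left (abs_nonneg _) h
    _ = M * (|f x| * |p x ⬝ᵥ v|) := by ring
    _ ≤ M * (Fintype.card ι * (B * 1)) := by gcongr
    _ ≤ _ := by nlinarith

lemma Gen.controls_union {X : Par → Finset V9} {ι : Type*} [Fintype ι] {p : ι → Par → V9}
    (h : ∀ i, Gen fun x M => Controls (X x) {p i x} M) {Z : Par → Finset V9}
    (hZ : ∀ x, ∀ z ∈ Z x, ∃ i, z = p i x) : Gen fun x M => Controls (X x) (Z x) M := by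
  refine (Gen.all h).congr fun x _ M _ hh v hv z hz => ?_
  obtain ⟨i, rfl⟩ := hZ x z hz
  exact hh i v hv _ (Finset.mem_singleton_self _)

lemma gen_std_controls {ι : Type*} [Fintype ι] {p : ι → Par → V9} (hp : ∀ i, PolyVec (p i))
    {Z : Par → Finset V9} (hZ : ∀ x, ∀ z ∈ Z x, ∃ i, z = p i x) :
    Gen fun x M => Controls stdSet (Z x) M := by
  refine Gen.controls_union (p := p) (fun i => ?_) hZ
  refine gen_controls_comb (R := fun k _ => Pi.single k (1 : ℝ)) (a := fun k x => p i x k)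
    (fun k => hp i k) (PolyFun.const 1) (fun _ => 0) one_ne_zero (fun x => ?_)
    (fun x k => Finset.mem_image_of_mem _ (Finset.mem_univ k))
  ext j
  simp [Finset.sum_apply, Pi.single_apply]

/-- The functionals (up to the factor `det`) dual to `h`. -/
noncomputable def dualOf (h : Fin 9 → V9) : Fin 9 → V9 :=
  fun s => (Matrix.of fun k t => h t k).adjugate s

/-- The determinant of nine vectors. -/
noncomputable def detOf (h : Fin 9 → V9) : ℝ := (Matrix.of fun k t => h t k).det

lemma dualOf_dotProduct (h : Fin 9 → V9) (s t : Fin 9) :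
    dualOf h s ⬝ᵥ h t = if s = t then detOf h else 0 := by
  have := congrFun (congrFun (Matrix.adjugate_mul (Matrix.of fun k t => h t k)) s) t
  rw [Matrix.mul_apply, Matrix.smul_apply, Matrix.one_apply] at this
  simpa [dualOf, detOf, dotProduct] using this

lemma polyFun_detOf {h : Fin 9 → Par → V9} (hh : ∀ t, PolyVec (h t)) :
    PolyFun fun x => detOf fun t => h t x := PolyFun.det fun i j => hh j i

lemma polyVec_dualOf {h : Fin 9 → Par → V9} (hh : ∀ t, PolyVec (h t)) (s : Fin 9) :
    PolyVec fun x => dualOf (fun t => h t x) s := by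
  intro k
  simp only [dualOf, Matrix.adjugate_apply]
  refine PolyFun.det fun i j => ?_
  by_cases hi : i = k
  · subst hi
    simpa using PolyFun.const _
  · simpa [Matrix.updateRow_ne hi] using hh j i

/-- Families of functionals vanishing on given generic lines are in general position. -/
lemma gen_hanData {ι : Type*} [Fintype ι] (R : Fin 9 → ι → Par → V9) (hR : ∀ t i, PolyVec (R t i))
    (h : Fin 9 → Par → V9) (hh : ∀ t, PolyVec (h t)) (hker : ∀ t i x, R t i x ⬝ᵥ h t x = 0)
    (hinj : ∀ t, ∃ x₀, ∀ v : V9, (∀ i, R t i x₀ ⬝ᵥ v = 0) → h t x₀ ⬝ᵥ v = 0 → v = 0)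
    (hind : ∃ x₀, (detOf fun t => h t x₀) ≠ 0) (X : Par → Fin 9 → Finset V9)
    (hX : ∀ x t i, R t i x ∈ X x t) :
    Gen fun x M => HanData (X x) (dualOf fun t => h t x) M := by
  obtain ⟨y, hy⟩ := hind
  have hg1 : ∀ t, Gen fun x M => ∀ v : V9, (∀ i, |R t i x ⬝ᵥ v| ≤ 1) → |h t x ⬝ᵥ v| ≤ 1 →
      ∀ k, |v k| ≤ M := by
    intro t
    obtain ⟨x₀, hx₀⟩ := hinj t
    have := gen_inj (fun o : Option ι => o.elim (h t) (R t)) (by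
      rintro (_ | i)
      · exact hh t
      · exact hR t i) x₀ (fun v hv => hx₀ v (fun i => hv (some i)) (hv none))
    refine this.congr fun x _ M _ H v hv hv' => H v ?_
    rintro (_ | i)
    · exact hv'
    · exact hv i
  obtain ⟨B₁, hB₁, hB₁'⟩ := exists_bound_family (f := fun (q : Fin 9 × Fin 9) x => h q.1 x q.2)
    fun q => hh q.1 q.2
  obtain ⟨B₂, hB₂, hB₂'⟩ := exists_bound_family
    (f := fun (q : Fin 9 × Fin 9) x => dualOf (fun t => h t x) q.1 q.2)
    fun q => polyVec_dualOf hh q.1 q.2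
  set B := max B₁ B₂
  have hB : 1 ≤ B := hB₁.trans (le_max_left _ _)
  refine ((Gen.all hg1).and (Gen.of_ne (polyFun_detOf hh) y hy)).mono
    ⟨891 * B ^ 6, 3, by
      have : 1 ≤ B ^ 6 := one_le_pow₀ hB
      linarith, fun x hx M hM ⟨H1, H2⟩ => ?_⟩
  have hM0 : 0 < M := by linarith
  have hhB : ∀ t k, |h t x k| ≤ B := fun t k => (hB₁' x hx (t, k)).trans (le_max_left _ _)
  set g := dualOf fun t => h t x with hg
  have hgB : ∀ s k, |g s k| ≤ B := fun s k => (hB₂' x hx (s, k)).trans (le_max_right _ _)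
  set D := detOf fun t => h t x
  have hgh : ∀ s t, g s ⬝ᵥ h t x = if s = t then D else 0 := fun s t => dualOf_dotProduct _ s t
  set N : Fin 9 → ℝ := fun t => h t x ⬝ᵥ h t x with hN
  have hN1 : ∀ t, |N t| ≤ 9 * B ^ 2 := fun t => by
    have := abs_dotProduct_le (hhB t) (hhB t)
    simpa [pow_two] using this
  have hN0 : ∀ t, 0 ≤ N t := fun t => Finset.sum_nonneg fun k _ => mul_self_nonneg _
  have hN2 : ∀ t, 1 ≤ 9 * B ^ 2 * M ^ 2 * N t := fun t => by
    have h1 : D ^ 2 ≤ (g t ⬝ᵥ g t) * N t := by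
      have h2 : g t ⬝ᵥ h t x = D := by simp [hgh]
      rw [← h2]
      have := Finset.sum_mul_sq_le_sq_mul_sq Finset.univ (g t) (h t x)
      simpa [dotProduct, pow_two, hN] using this
    have h3 : g t ⬝ᵥ g t ≤ 9 * B ^ 2 := by
      have := abs_dotProduct_le (hgB t) (hgB t)
      refine (le_abs_self _).trans ?_
      simpa [pow_two] using this
    have h4 : 1 ≤ (M * |D|) ^ 2 := one_le_pow₀ H2
    have h5 : (M * |D|) ^ 2 = M ^ 2 * D ^ 2 := by rw [mul_pow, sq_abs]
    calc (1:ℝ) ≤ M ^ 2 * D ^ 2 := h5 ▸ h4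
      _ ≤ M ^ 2 * ((9 * B ^ 2) * N t) := by
          gcongr
          exact h1.trans (mul_le_mul_of_nonneg_right h3 (hN0 t))
      _ = _ := by ring
  have hpow : ∀ a b : ℕ, a ≤ b → M ^ a ≤ M ^ b := fun a b hab => pow_le_pow_right₀ hM hab
  have hpowB : ∀ a b : ℕ, a ≤ b → B ^ a ≤ B ^ b := fun a b hab => pow_le_pow_right₀ hB hab
  have main : ∀ t, ∀ v : V9, (∀ i, |R t i x ⬝ᵥ v| ≤ 1) →
      ∃ v' : V9, (∀ k, |v' k| ≤ 9 * B ^ 2 * M) ∧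
        N t • v = v' + (h t x ⬝ᵥ v) • h t x := by
    intro t v hv
    refine ⟨N t • v - (h t x ⬝ᵥ v) • h t x, fun k => ?_, by abel⟩
    have hb : 0 < 9 * B ^ 2 := by positivity
    have := H1 t ((9 * B ^ 2)⁻¹ • (N t • v - (h t x ⬝ᵥ v) • h t x)) (fun i => ?_) ?_ k
    · rw [Pi.smul_apply, smul_eq_mul, abs_mul, abs_inv, abs_of_pos hb,
        inv_mul_le_iff₀ hb] at this
      exact this
    · rw [dotProduct_smul, dotProduct_sub, dotProduct_smul, dotProduct_smul, hker, smul_zero,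
        sub_zero, smul_eq_mul, smul_eq_mul, abs_mul, abs_inv, abs_of_pos hb, inv_mul_le_iff₀ hb,
        abs_mul]
      exact mul_le_mul (hN1 t) (hv i) (abs_nonneg _) hb.le
    · rw [dotProduct_smul, dotProduct_sub, dotProduct_smul, dotProduct_smul, smul_eq_mul,
        smul_eq_mul, smul_eq_mul, mul_comm (N t), sub_self, mul_zero, abs_zero]
      exact zero_le_one
  refine ⟨fun t s hst v hv z hz => ?_, fun t v hv z hz => ?_⟩
  · rw [Finset.mem_singleton] at hz
    subst hz
    obtain ⟨v', hv', e⟩ := main t v fun i => hv _ (hX x t i)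
    have e1 := congrArg (g s ⬝ᵥ ·) e
    simp only [dotProduct_smul, dotProduct_add, hgh, hst, if_false, smul_eq_mul, mul_zero,
      add_zero] at e1
    have e2 : N t * |g s ⬝ᵥ v| ≤ 81 * B ^ 3 * M := by
      rw [← abs_of_nonneg (hN0 t), ← abs_mul, e1]
      refine (abs_dotProduct_le (hgB s) hv').trans (le_of_eq ?_)
      simp only [Fintype.card_fin]
      push_cast
      ring
    calc |g s ⬝ᵥ v| ≤ (9 * B ^ 2 * M ^ 2 * N t) * |g s ⬝ᵥ v| :=
          le_mul_of_one_le_left (abs_nonneg _) (hN2 t)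
      _ = 9 * B ^ 2 * M ^ 2 * (N t * |g s ⬝ᵥ v|) := by ring
      _ ≤ 9 * B ^ 2 * M ^ 2 * (81 * B ^ 3 * M) := by gcongr
      _ = 729 * (B ^ 5 * M ^ 3) := by ring
      _ ≤ 891 * (B ^ 6 * M ^ (3 + 1)) := by
          refine mul_le_mul (by norm_num) (mul_le_mul (hpowB _ _ (by norm_num))
            (hpow _ _ (by norm_num)) (by positivity) (by positivity)) (by positivity) (by norm_num)
      _ = _ := by ring
  · obtain ⟨k, -, rfl⟩ := Finset.mem_image.1 hz
    rw [single_one_dotProduct]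
    obtain ⟨v', hv', e⟩ := main t v fun i => hv _ (Finset.mem_union_left _ (hX x t i))
    have hgv : |g t ⬝ᵥ v| ≤ 1 := hv _ (Finset.mem_union_right _ (Finset.mem_singleton_self _))
    have e1 := congrArg (g t ⬝ᵥ ·) e
    simp only [dotProduct_smul, dotProduct_add, hgh, if_true, smul_eq_mul] at e1
    have e2 : |h t x ⬝ᵥ v| * |D| ≤ 9 * B ^ 2 + 81 * B ^ 3 * M := by
      rw [← abs_mul]
      have : (h t x ⬝ᵥ v) * D = N t * (g t ⬝ᵥ v) - g t ⬝ᵥ v' := by rw [e1]; ring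
      rw [this]
      refine (abs_sub _ _).trans (add_le_add ?_ ?_)
      · rw [abs_mul]
        calc |N t| * |g t ⬝ᵥ v| ≤ 9 * B ^ 2 * 1 :=
              mul_le_mul (hN1 t) hgv (abs_nonneg _) (by positivity)
          _ = _ := mul_one _
      · refine (abs_dotProduct_le (hgB t) hv').trans (le_of_eq ?_)
        simp only [Fintype.card_fin]
        push_cast
        ring
    have e3 : |h t x ⬝ᵥ v| ≤ 90 * (B ^ 3 * M ^ 2) := by
      calc |h t x ⬝ᵥ v| ≤ (M * |D|) * |h t x ⬝ᵥ v| := le_mul_of_one_le_left (abs_nonneg _) H2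
        _ = M * (|h t x ⬝ᵥ v| * |D|) := by ring
        _ ≤ M * (9 * B ^ 2 + 81 * B ^ 3 * M) := by gcongr
        _ = 9 * (B ^ 2 * M ^ 1) + 81 * (B ^ 3 * M ^ 2) := by ring
        _ ≤ 9 * (B ^ 3 * M ^ 2) + 81 * (B ^ 3 * M ^ 2) := by
            gcongr 9 * (?_ * ?_) + _
            · exact hpowB _ _ (by norm_num)
            · exact hpow _ _ (by norm_num)
        _ = _ := by ring
    have e4 : N t * |v k| ≤ 99 * (B ^ 4 * M ^ 2) := by
      have e5 := congrFun e k
      simp only [Pi.smul_apply, Pi.add_apply, smul_eq_mul] at e5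
      rw [← abs_of_nonneg (hN0 t), ← abs_mul, e5]
      calc _ ≤ |v' k| + |h t x ⬝ᵥ v| * |h t x k| := (abs_add_le _ _).trans_eq (by rw [abs_mul])
        _ ≤ 9 * B ^ 2 * M + 90 * (B ^ 3 * M ^ 2) * B :=
            add_le_add (hv' k) (mul_le_mul e3 (hhB t k) (abs_nonneg _) (by positivity))
        _ = 9 * (B ^ 2 * M ^ 1) + 90 * (B ^ 4 * M ^ 2) := by ring
        _ ≤ 9 * (B ^ 4 * M ^ 2) + 90 * (B ^ 4 * M ^ 2) := by
            gcongr 9 * (?_ * ?_) + _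
            · exact hpowB _ _ (by norm_num)
            · exact hpow _ _ (by norm_num)
        _ = _ := by ring
    calc |v k| ≤ (9 * B ^ 2 * M ^ 2 * N t) * |v k| :=
          le_mul_of_one_le_left (abs_nonneg _) (hN2 t)
      _ = 9 * B ^ 2 * M ^ 2 * (N t * |v k|) := by ring
      _ ≤ 9 * B ^ 2 * M ^ 2 * (99 * (B ^ 4 * M ^ 2)) := by gcongr
      _ = _ := by ring

/-! ### The quadratic geometry -/

/-- The two admissible choices of the coefficients of the quadratic form. -/
def FormCoeff (p q : ℝ) : Prop := (p = 0 ∧ q = 1) ∨ (p = 1 ∧ q = 0)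

/-- The symmetric bilinear form. -/
noncomputable def bform (p q : ℝ) (x y : Fin 4 → ℝ) : ℝ :=
  p * (x 1 * y 1 + x 2 * y 2) + q * (x 1 * y 2 + x 2 * y 1) - x 0 * y 3 - x 3 * y 0

/-- The functional `S ↦ xᵀ S y` on symmetric trace-free matrices, in coordinates. -/
noncomputable def bilv (p q : ℝ) (x y : Fin 4 → ℝ) : V9 :=
  ![x 0 * y 0, x 0 * y 1 + x 1 * y 0, x 0 * y 2 + x 2 * y 0,
    x 1 * y 1 + p / 2 * (x 0 * y 3 + x 3 * y 0), x 1 * y 2 + x 2 * y 1 + q * (x 0 * y 3 + x 3 * y 0),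
    x 2 * y 2 + p / 2 * (x 0 * y 3 + x 3 * y 0), x 1 * y 3 + x 3 * y 1, x 2 * y 3 + x 3 * y 2,
    x 3 * y 3]

/-- The trace-free part of the symmetric product of two covectors, in coordinates. -/
noncomputable def outerT (p q : ℝ) (x y : Fin 4 → ℝ) : V9 :=
  ![2 * (x 0 * y 0), x 0 * y 1 + x 1 * y 0, x 0 * y 2 + x 2 * y 0,
    2 * (x 1 * y 1) - bform p q x y / 2 * p, x 1 * y 2 + x 2 * y 1 - bform p q x y / 2 * q,
    2 * (x 2 * y 2) - bform p q x y / 2 * p, x 1 * y 3 + x 3 * y 1, x 2 * y 3 + x 3 * y 2,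
    2 * (x 3 * y 3)]

/-- The covector dual to a vector. -/
noncomputable def flatv (p q : ℝ) (x : Fin 4 → ℝ) : Fin 4 → ℝ :=
  ![-x 3, p * x 1 + q * x 2, q * x 1 + p * x 2, -x 0]

/-- The first row of the unipotent matrix. -/
noncomputable def nv (p q : ℝ) (u : ℝ × ℝ) : Fin 4 → ℝ :=
  ![1, u.1, u.2, p / 2 * (u.1 * u.1 + u.2 * u.2) + q * (u.1 * u.2)]

/-- The second row of the unipotent matrix. -/
noncomputable def nr (p q : ℝ) (u : ℝ × ℝ) : Fin 4 → ℝ := ![0, 1, 0, p * u.1 + q * u.2]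

/-- The third row of the unipotent matrix. -/
noncomputable def ns (p q : ℝ) (u : ℝ × ℝ) : Fin 4 → ℝ := ![0, 0, 1, q * u.1 + p * u.2]

/-- The last row of the unipotent matrix. -/
def e4 : Fin 4 → ℝ := ![0, 0, 0, 1]

/-- The vector product of three vectors in four dimensions. -/
def cross4 (a b c : Fin 4 → ℝ) : Fin 4 → ℝ :=
  ![a 1 * (b 2 * c 3 - b 3 * c 2) - a 2 * (b 1 * c 3 - b 3 * c 1) + a 3 * (b 1 * c 2 - b 2 * c 1),
    -(a 0 * (b 2 * c 3 - b 3 * c 2) - a 2 * (b 0 * c 3 - b 3 * c 0) + a 3 * (b 0 * c 2 - b 2 * c 0)),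
    a 0 * (b 1 * c 3 - b 3 * c 1) - a 1 * (b 0 * c 3 - b 3 * c 0) + a 3 * (b 0 * c 1 - b 1 * c 0),
    -(a 0 * (b 1 * c 2 - b 2 * c 1) - a 1 * (b 0 * c 2 - b 2 * c 0) + a 2 * (b 0 * c 1 - b 1 * c 0))]

/-- The nine functionals expanded at different rates by the flow. -/
noncomputable def cvec (p q : ℝ) (u : ℝ × ℝ) : Fin 9 → V9 :=
  ![bilv p q (nv p q u) (nv p q u), bilv p q (nv p q u) (nr p q u), bilv p q (nv p q u) (ns p q u),
    bilv p q (nr p q u) (nr p q u), bilv p q (nr p q u) (ns p q u), bilv p q (ns p q u) (ns p q u),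
    bilv p q (nr p q u) e4, bilv p q (ns p q u) e4, bilv p q e4 e4]

lemma dot9 (u v : V9) : u ⬝ᵥ v = u 0 * v 0 + u 1 * v 1 + u 2 * v 2 + u 3 * v 3 + u 4 * v 4
    + u 5 * v 5 + u 6 * v 6 + u 7 * v 7 + u 8 * v 8 := by
  simp only [dotProduct, Fin.sum_univ_succ, Fin.sum_univ_zero]
  simp only [Fin.succ_zero_eq_one, Fin.succ_one_eq_two, Fin.isValue, Finset.univ_eq_empty,
    Finset.sum_empty, add_zero]
  simp only [show Fin.succ (2 : Fin 3) = 3 from rfl, show Fin.succ (2 : Fin 8) = 3 from rfl]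
  simp only [Fin.reduceSucc]
  ring

lemma bilv_dot (p q : ℝ) (x y : Fin 4 → ℝ) (v : V9) : bilv p q x y ⬝ᵥ v =
    x 0 * y 0 * v 0 + (x 0 * y 1 + x 1 * y 0) * v 1 + (x 0 * y 2 + x 2 * y 0) * v 2
    + (x 1 * y 1 + p / 2 * (x 0 * y 3 + x 3 * y 0)) * v 3
    + (x 1 * y 2 + x 2 * y 1 + q * (x 0 * y 3 + x 3 * y 0)) * v 4
    + (x 2 * y 2 + p / 2 * (x 0 * y 3 + x 3 * y 0)) * v 5 + (x 1 * y 3 + x 3 * y 1) * v 6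
    + (x 2 * y 3 + x 3 * y 2) * v 7 + x 3 * y 3 * v 8 := dot9 _ _

lemma outerT_dot (p q : ℝ) (x y : Fin 4 → ℝ) (v : V9) : outerT p q x y ⬝ᵥ v =
    2 * (x 0 * y 0) * v 0 + (x 0 * y 1 + x 1 * y 0) * v 1 + (x 0 * y 2 + x 2 * y 0) * v 2
    + (2 * (x 1 * y 1) - bform p q x y / 2 * p) * v 3
    + (x 1 * y 2 + x 2 * y 1 - bform p q x y / 2 * q) * v 4
    + (2 * (x 2 * y 2) - bform p q x y / 2 * p) * v 5 + (x 1 * y 3 + x 3 * y 1) * v 6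
    + (x 2 * y 3 + x 3 * y 2) * v 7 + 2 * (x 3 * y 3) * v 8 := dot9 _ _

lemma dot4 (u v : Fin 4 → ℝ) : u ⬝ᵥ v = u 0 * v 0 + u 1 * v 1 + u 2 * v 2 + u 3 * v 3 := by
  simp [dotProduct, Fin.sum_univ_four]

/-- Pairing of the two kinds of symmetric products. -/
lemma bilv_dot_outerT {p q : ℝ} (hpq : FormCoeff p q) (x y N N' : Fin 4 → ℝ) :
    bilv p q x y ⬝ᵥ outerT p q N N' = (N ⬝ᵥ x) * (N' ⬝ᵥ y) + (N' ⬝ᵥ x) * (N ⬝ᵥ y)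
      - bform p q N N' / 2 * bform p q x y := by
  rw [bilv_dot, dot4, dot4, dot4, dot4]
  simp only [outerT, bform, Matrix.cons_val]
  rcases hpq with ⟨rfl, rfl⟩ | ⟨rfl, rfl⟩ <;> ring

lemma flatv_dot (p q : ℝ) (x y : Fin 4 → ℝ) : flatv p q x ⬝ᵥ y = bform p q x y := by
  rw [dot4]
  simp only [flatv, bform, Matrix.cons_val]
  ring

lemma bform_flatv {p q : ℝ} (hpq : FormCoeff p q) (N y : Fin 4 → ℝ) :
    bform p q (flatv p q N) y = N ⬝ᵥ y := by
  rw [dot4]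
  simp only [flatv, bform, Matrix.cons_val]
  rcases hpq with ⟨rfl, rfl⟩ | ⟨rfl, rfl⟩ <;> ring

lemma bform_comm (p q : ℝ) (x y : Fin 4 → ℝ) : bform p q x y = bform p q y x := by
  simp only [bform]
  ring

lemma bilv_comm (p q : ℝ) (x y : Fin 4 → ℝ) : bilv p q x y = bilv p q y x := by
  simp only [bilv]
  congr 1
  · ring
  congr 1
  · ring
  congr 1
  · ring
  congr 1
  · ring
  congr 1
  · ring
  congr 1
  · ring
  congr 1
  · ring
  congr 1
  · ring
  congr 1
  ring

lemma cross4_dot_left (a b c : Fin 4 → ℝ) : cross4 a b c ⬝ᵥ a = 0 := by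
  rw [dot4]; simp only [cross4, Matrix.cons_val]; ring

lemma cross4_dot_mid (a b c : Fin 4 → ℝ) : cross4 a b c ⬝ᵥ b = 0 := by
  rw [dot4]; simp only [cross4, Matrix.cons_val]; ring

lemma cross4_dot_right (a b c : Fin 4 → ℝ) : cross4 a b c ⬝ᵥ c = 0 := by
  rw [dot4]; simp only [cross4, Matrix.cons_val]; ring

lemma bilv_add_left (p q : ℝ) (x x' y : Fin 4 → ℝ) :
    bilv p q (x + x') y = bilv p q x y + bilv p q x' y := by
  ext k
  fin_cases k <;> simp [bilv] <;> ring

lemma bilv_smul_left (p q a : ℝ) (x y : Fin 4 → ℝ) :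
    bilv p q (a • x) y = a • bilv p q x y := by
  ext k
  fin_cases k <;> simp [bilv] <;> ring

lemma bilv_add_right (p q : ℝ) (x y y' : Fin 4 → ℝ) :
    bilv p q x (y + y') = bilv p q x y + bilv p q x y' := by
  rw [bilv_comm, bilv_add_left, bilv_comm, bilv_comm p q y']

lemma bilv_smul_right (p q a : ℝ) (x y : Fin 4 → ℝ) :
    bilv p q x (a • y) = a • bilv p q x y := by
  rw [bilv_comm, bilv_smul_left, bilv_comm]

lemma bform_sub_smul (p q a b : ℝ) (x y z : Fin 4 → ℝ) :
    bform p q x (a • y - b • z) = a * bform p q x y - b * bform p q x z := by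
  simp only [bform, Pi.sub_apply, Pi.smul_apply, smul_eq_mul]
  ring

lemma bform_nv_nv (p q : ℝ) (u : ℝ × ℝ) : bform p q (nv p q u) (nv p q u) = 0 := by
  simp only [nv, bform, Matrix.cons_val]; ring

lemma bform_nv_nr (p q : ℝ) (u : ℝ × ℝ) : bform p q (nv p q u) (nr p q u) = 0 := by
  simp only [nv, nr, bform, Matrix.cons_val]; ring

lemma bform_nv_ns (p q : ℝ) (u : ℝ × ℝ) : bform p q (nv p q u) (ns p q u) = 0 := by
  simp only [nv, ns, bform, Matrix.cons_val]; ring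

/-- Expansion of a vector orthogonal to `nv`. -/
lemma eq_comb_of_bform_nv {p q : ℝ} {u : ℝ × ℝ} {z : Fin 4 → ℝ} (h : bform p q (nv p q u) z = 0) :
    z = z 0 • nv p q u + (z 1 - u.1 * z 0) • nr p q u + (z 2 - u.2 * z 0) • ns p q u := by
  simp only [nv, bform, Matrix.cons_val] at h
  ext k
  fin_cases k
  · simp [nv, nr, ns]
  · simp [nv, nr, ns]; ring
  · simp [nv, nr, ns]; ring
  · simp [nv, nr, ns]
    linear_combination -h

/-! ### Explicit nondegenerate configurations -/

lemma detOf_ne_zero {h : Fin 9 → V9} (H : ∀ v : V9, (∀ t, h t ⬝ᵥ v = 0) → v = 0) : detOf h ≠ 0 := by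
  intro h0
  rw [detOf, ← Matrix.det_transpose] at h0
  obtain ⟨v, hv, hv0⟩ := Matrix.exists_mulVec_eq_zero_iff.2 h0
  exact hv (H v fun t => congrFun hv0 t)

lemma forall_fin_nine {P : Fin 9 → Prop} :
    (∀ t, P t) ↔ P 0 ∧ P 1 ∧ P 2 ∧ P 3 ∧ P 4 ∧ P 5 ∧ P 6 ∧ P 7 ∧ P 8 :=
  ⟨fun h => ⟨h 0, h 1, h 2, h 3, h 4, h 5, h 6, h 7, h 8⟩, fun h t => by
    obtain ⟨h0, h1, h2, h3, h4, h5, h6, h7, h8⟩ := h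
    fin_cases t <;> assumption⟩

lemma eq_zero_of_coords {v : V9} (h : v 0 = 0 ∧ v 1 = 0 ∧ v 2 = 0 ∧ v 3 = 0 ∧ v 4 = 0 ∧ v 5 = 0 ∧
    v 6 = 0 ∧ v 7 = 0 ∧ v 8 = 0) : v = 0 :=
  funext (forall_fin_nine.2 h)

/-- Nine points of the parameter plane. -/
def gridPt : Fin 9 → ℝ × ℝ :=
  ![(-1, -1), (-1, 0), (-1, 1), (0, -1), (0, 0), (0, 1), (1, -1), (1, 0), (1, 1)]

lemma grid_nv {p q : ℝ} (hpq : FormCoeff p q) (v : V9)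
    (h : ∀ t, bilv p q (nv p q (gridPt t)) (nv p q (gridPt t)) ⬝ᵥ v = 0) : v = 0 := by
  rw [forall_fin_nine] at h
  simp only [bilv_dot, nv, gridPt, Matrix.cons_val] at h
  apply eq_zero_of_coords
  rcases hpq with ⟨rfl, rfl⟩ | ⟨rfl, rfl⟩ <;> norm_num at h <;>
    obtain ⟨h0, h1, h2, h3, h4, h5, h6, h7, h8⟩ := h <;>
    refine ⟨?_, ?_, ?_, ?_, ?_, ?_, ?_, ?_, ?_⟩ <;> linarith

lemma grid_normal {p q : ℝ} (hpq : FormCoeff p q) (v : V9)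
    (h : ∀ t, outerT p q (flatv p q (nv p q (gridPt t))) (flatv p q (nv p q (gridPt t))) ⬝ᵥ v = 0) :
    v = 0 := by
  rw [forall_fin_nine] at h
  simp only [outerT_dot, bform, flatv, nv, gridPt, Matrix.cons_val] at h
  apply eq_zero_of_coords
  rcases hpq with ⟨rfl, rfl⟩ | ⟨rfl, rfl⟩ <;> norm_num at h <;>
    obtain ⟨h0, h1, h2, h3, h4, h5, h6, h7, h8⟩ := h <;>
    refine ⟨?_, ?_, ?_, ?_, ?_, ?_, ?_, ?_, ?_⟩ <;> linarith

/-- The combination of the first two directions orthogonal to the third one. -/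
noncomputable def mv (p q : ℝ) (w : Fin 3 → ℝ × ℝ) : Fin 4 → ℝ :=
  bform p q (nv p q (w 1)) (nv p q (w 2)) • nv p q (w 0)
    - bform p q (nv p q (w 0)) (nv p q (w 2)) • nv p q (w 1)

/-- The functional common to the three-dimensional spaces attached to three points. -/
noncomputable def lineF (p q : ℝ) (w : Fin 3 → ℝ × ℝ) : V9 :=
  bform p q (nv p q (w 0)) (nv p q (w 1)) • bilv p q (nv p q (w 2)) (mv p q w)

/-- The vector orthogonal to three directions. -/
noncomputable def yv (p q : ℝ) (w : Fin 3 → ℝ × ℝ) : Fin 4 → ℝ :=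
  flatv p q (cross4 (nv p q (w 0)) (nv p q (w 1)) (nv p q (w 2)))

/-- A second vector orthogonal to the first two directions. -/
noncomputable def yv' (p q : ℝ) (w : Fin 3 → ℝ × ℝ) : Fin 4 → ℝ :=
  flatv p q (cross4 (nv p q (w 0)) (nv p q (w 1)) e4)

/-- The functional common to the six-dimensional spaces attached to three points. -/
noncomputable def planeF (p q : ℝ) (w : Fin 3 → ℝ × ℝ) : V9 := bilv p q (yv p q w) (yv p q w)

/-- The vector annihilated by the three-dimensional spaces attached to three points. -/
noncomputable def lineH (p q : ℝ) (w : Fin 3 → ℝ × ℝ) : V9 :=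
  outerT p q (cross4 (nv p q (w 0)) (nv p q (w 1)) (nv p q (w 2)))
    (cross4 (nv p q (w 0)) (nv p q (w 1)) (nv p q (w 2)))

/-- The vector annihilated by the functionals complementary to `planeF`. -/
noncomputable def planeH (p q : ℝ) (w : Fin 3 → ℝ × ℝ) : V9 :=
  outerT p q (flatv p q (nv p q (w 2))) (flatv p q (mv p q w))

set_option maxHeartbeats 4000000 in
lemma lineF_span {p q : ℝ} (hpq : FormCoeff p q) : ∃ w : Fin 9 → Fin 3 → ℝ × ℝ, ∀ v : V9,
    (∀ t, lineF p q (w t) ⬝ᵥ v = 0) → v = 0 := by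
  refine ⟨![![(1,-1),(0,1),(-1,0)], ![(0,-1),(2,0),(1,-1)], ![(2,1),(1,2),(-1,1)],
    ![(2,0),(1,-1),(1,1)], ![(0,1),(1,2),(2,-1)], ![(1,1),(2,2),(-1,2)], ![(2,2),(1,1),(-1,0)],
    ![(2,2),(1,0),(-1,-1)], ![(0,-1),(2,0),(1,1)]], fun v h => ?_⟩
  rw [forall_fin_nine] at h
  simp only [lineF, mv, smul_dotProduct, smul_eq_mul, bilv_dot, bform, nv, Matrix.cons_val,
    Pi.sub_apply, Pi.smul_apply] at h
  apply eq_zero_of_coords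
  rcases hpq with ⟨rfl, rfl⟩ | ⟨rfl, rfl⟩ <;> norm_num at h <;>
    obtain ⟨h0, h1, h2, h3, h4, h5, h6, h7, h8⟩ := h <;>
    refine ⟨?_, ?_, ?_, ?_, ?_, ?_, ?_, ?_, ?_⟩ <;> linarith

set_option maxHeartbeats 4000000 in
lemma planeF_span {p q : ℝ} (hpq : FormCoeff p q) : ∃ w : Fin 9 → Fin 3 → ℝ × ℝ, ∀ v : V9,
    (∀ t, planeF p q (w t) ⬝ᵥ v = 0) → v = 0 := by
  refine ⟨![![(-1,0),(1,-1),(-1,1)], ![(0,-1),(-1,0),(0,1)], ![(-1,1),(0,0),(1,1)],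
    ![(1,0),(0,0),(-1,-1)], ![(-1,-1),(0,1),(1,1)], ![(1,1),(1,0),(-1,-1)], ![(-1,1),(1,-1),(0,0)],
    ![(1,0),(0,0),(1,-1)], ![(-1,-1),(0,-1),(0,0)]], fun v h => ?_⟩
  rw [forall_fin_nine] at h
  simp only [planeF, yv, bilv_dot, flatv, cross4, nv, Matrix.cons_val] at h
  apply eq_zero_of_coords
  rcases hpq with ⟨rfl, rfl⟩ | ⟨rfl, rfl⟩ <;> norm_num at h <;>
    obtain ⟨h0, h1, h2, h3, h4, h5, h6, h7, h8⟩ := h <;>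
    refine ⟨?_, ?_, ?_, ?_, ?_, ?_, ?_, ?_, ?_⟩ <;> linarith

set_option maxHeartbeats 4000000 in
lemma lineH_span {p q : ℝ} (hpq : FormCoeff p q) : ∃ w : Fin 9 → Fin 3 → ℝ × ℝ, ∀ v : V9,
    (∀ t, lineH p q (w t) ⬝ᵥ v = 0) → v = 0 := by
  refine ⟨![![(0,-1),(0,0),(-1,0)], ![(0,1),(-1,1),(-1,-1)], ![(1,1),(0,-1),(1,0)],
    ![(1,0),(1,-1),(-1,1)], ![(-1,-1),(-1,1),(0,0)], ![(-1,0),(1,-1),(0,1)], ![(1,-1),(0,1),(0,0)],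
    ![(0,0),(1,1),(-1,1)], ![(0,-1),(1,0),(-1,1)]], fun v h => ?_⟩
  rw [forall_fin_nine] at h
  simp only [lineH, outerT_dot, bform, cross4, nv, Matrix.cons_val] at h
  apply eq_zero_of_coords
  rcases hpq with ⟨rfl, rfl⟩ | ⟨rfl, rfl⟩ <;> norm_num at h <;>
    obtain ⟨h0, h1, h2, h3, h4, h5, h6, h7, h8⟩ := h <;>
    refine ⟨?_, ?_, ?_, ?_, ?_, ?_, ?_, ?_, ?_⟩ <;> linarith

set_option maxHeartbeats 4000000 in
lemma planeH_span {p q : ℝ} (hpq : FormCoeff p q) : ∃ w : Fin 9 → Fin 3 → ℝ × ℝ, ∀ v : V9,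
    (∀ t, planeH p q (w t) ⬝ᵥ v = 0) → v = 0 := by
  refine ⟨![![(0,-1),(1,0),(-1,1)], ![(-1,0),(1,1),(0,0)], ![(1,-1),(1,0),(-1,-1)],
    ![(1,0),(0,0),(1,1)], ![(1,0),(0,1),(0,-1)], ![(0,-1),(0,0),(1,-1)], ![(0,-1),(1,-1),(-1,1)],
    ![(-1,0),(0,0),(0,1)], ![(0,-1),(1,0),(-1,0)]], fun v h => ?_⟩
  rw [forall_fin_nine] at h
  simp only [planeH, mv, outerT_dot, bform, flatv, nv, Matrix.cons_val, Pi.sub_apply,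
    Pi.smul_apply, smul_eq_mul] at h
  apply eq_zero_of_coords
  rcases hpq with ⟨rfl, rfl⟩ | ⟨rfl, rfl⟩ <;> norm_num at h <;>
    obtain ⟨h0, h1, h2, h3, h4, h5, h6, h7, h8⟩ := h <;>
    refine ⟨?_, ?_, ?_, ?_, ?_, ?_, ?_, ?_, ?_⟩ <;> linarith

/-- Three points in general position. -/
def triPt : Fin 3 → ℝ × ℝ := ![(-1, -1), (0, 0), (-1, 1)]

lemma tri_line {p q : ℝ} (hpq : FormCoeff p q) (v : V9)
    (h : ∀ j, ∀ k : Fin 3, cvec p q (triPt j) (k.castLE (by norm_num)) ⬝ᵥ v = 0)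
    (h' : lineH p q triPt ⬝ᵥ v = 0) : v = 0 := by
  simp only [Fin.forall_fin_succ, Fin.forall_fin_zero_pi, cvec, triPt, Fin.isValue] at h
  simp [bilv_dot, nv, nr, ns] at h
  simp only [lineH, triPt, outerT_dot, bform, cross4, nv, Matrix.cons_val] at h'
  apply eq_zero_of_coords
  rcases hpq with ⟨rfl, rfl⟩ | ⟨rfl, rfl⟩ <;> norm_num at h h' <;> casesm* _ ∧ _ <;>
    refine ⟨?_, ?_, ?_, ?_, ?_, ?_, ?_, ?_, ?_⟩ <;> linarith

lemma tri_six {p q : ℝ} (hpq : FormCoeff p q) (v : V9)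
    (h : ∀ k : Fin 6, cvec p q (triPt 0) (k.castLE (by norm_num)) ⬝ᵥ v = 0)
    (h' : ∀ k : Fin 6, cvec p q (triPt 1) (k.castLE (by norm_num)) ⬝ᵥ v = 0) : v = 0 := by
  simp only [Fin.forall_fin_succ, cvec, triPt, Fin.isValue] at h h'
  simp [bilv_dot, nv, nr, ns] at h h'
  apply eq_zero_of_coords
  rcases hpq with ⟨rfl, rfl⟩ | ⟨rfl, rfl⟩ <;> norm_num at h h' <;> casesm* _ ∧ _ <;>
    refine ⟨?_, ?_, ?_, ?_, ?_, ?_, ?_, ?_, ?_⟩ <;> linarith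

lemma tri_plane {p q : ℝ} (hpq : FormCoeff p q) (v : V9)
    (h1 : bilv p q (yv p q triPt) (yv p q triPt) ⬝ᵥ v = 0)
    (h2 : bilv p q (yv p q triPt) (yv' p q triPt) ⬝ᵥ v = 0)
    (h3 : bilv p q (yv' p q triPt) (yv' p q triPt) ⬝ᵥ v = 0)
    (h : ∀ k : Fin 6, cvec p q (triPt 2) (k.castLE (by norm_num)) ⬝ᵥ v = 0)
    (h' : planeH p q triPt ⬝ᵥ v = 0) : v = 0 := by
  simp only [Fin.forall_fin_succ, cvec, triPt, Fin.isValue] at h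
  simp [bilv_dot, nv, nr, ns] at h
  simp only [yv, yv', triPt, bilv_dot, flatv, cross4, nv, e4, Matrix.cons_val] at h1 h2 h3
  simp only [planeH, triPt, mv, outerT_dot, bform, flatv, nv, Matrix.cons_val, Pi.sub_apply,
    Pi.smul_apply, smul_eq_mul] at h'
  apply eq_zero_of_coords
  rcases hpq with ⟨rfl, rfl⟩ | ⟨rfl, rfl⟩ <;> norm_num at h h' h1 h2 h3 <;> casesm* _ ∧ _ <;>
    refine ⟨?_, ?_, ?_, ?_, ?_, ?_, ?_, ?_, ?_⟩ <;> linarith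

lemma origin_full {p q : ℝ} (hpq : FormCoeff p q) (v : V9)
    (h : ∀ k, cvec p q (0, 0) k ⬝ᵥ v = 0) : v = 0 := by
  rw [forall_fin_nine] at h
  simp only [cvec, bilv_dot, nv, nr, ns, e4, Matrix.cons_val] at h
  apply eq_zero_of_coords
  rcases hpq with ⟨rfl, rfl⟩ | ⟨rfl, rfl⟩ <;> norm_num at h <;>
    obtain ⟨h0, h1, h2, h3, h4, h5, h6, h7, h8⟩ := h <;>
    refine ⟨?_, ?_, ?_, ?_, ?_, ?_, ?_, ?_, ?_⟩ <;> linarith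

lemma origin_eight {p q : ℝ} (hpq : FormCoeff p q) (v : V9)
    (h : ∀ k : Fin 8, cvec p q (0, 0) (k.castLE (by norm_num)) ⬝ᵥ v = 0)
    (h' : outerT p q (flatv p q (nv p q (0, 0))) (flatv p q (nv p q (0, 0))) ⬝ᵥ v = 0) : v = 0 := by
  simp only [Fin.forall_fin_succ, cvec, Fin.isValue] at h
  simp [bilv_dot, nv, nr, ns, e4] at h
  simp only [outerT_dot, bform, flatv, nv, Matrix.cons_val] at h'
  apply eq_zero_of_coords
  rcases hpq with ⟨rfl, rfl⟩ | ⟨rfl, rfl⟩ <;> norm_num at h h' <;> casesm* _ ∧ _ <;>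
    refine ⟨?_, ?_, ?_, ?_, ?_, ?_, ?_, ?_, ?_⟩ <;> linarith

/-! ### Polynomial dependence -/

namespace PolyVec

variable {X Y Z : Par → Fin 4 → ℝ}

lemma of_four {f₀ f₁ f₂ f₃ : Par → ℝ} (h₀ : PolyFun f₀) (h₁ : PolyFun f₁) (h₂ : PolyFun f₂)
    (h₃ : PolyFun f₃) : PolyVec fun x => ![f₀ x, f₁ x, f₂ x, f₃ x] := by
  intro k
  fin_cases k <;> assumption

lemma nv (p q : ℝ) (κ : Idx) : PolyVec fun x => nv p q (x κ) :=
  of_four (.const 1) (.fst κ) (.snd κ)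
    (((PolyFun.const _).mul (((PolyFun.fst κ).mul (.fst κ)).add ((PolyFun.snd κ).mul (.snd κ)))).add
      ((PolyFun.const _).mul ((PolyFun.fst κ).mul (.snd κ))))

lemma nr (p q : ℝ) (κ : Idx) : PolyVec fun x => nr p q (x κ) :=
  of_four (.const 0) (.const 1) (.const 0)
    (((PolyFun.const _).mul (.fst κ)).add ((PolyFun.const _).mul (.snd κ)))

lemma ns (p q : ℝ) (κ : Idx) : PolyVec fun x => ns p q (x κ) :=
  of_four (.const 0) (.const 0) (.const 1)
    (((PolyFun.const _).mul (.fst κ)).add ((PolyFun.const _).mul (.snd κ)))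

lemma e4 : PolyVec fun _ => e4 := fun _ => .const _

lemma flatv (p q : ℝ) (hX : PolyVec X) : PolyVec fun x => flatv p q (X x) :=
  of_four (hX 3).neg (((PolyFun.const _).mul (hX 1)).add ((PolyFun.const _).mul (hX 2)))
    (((PolyFun.const _).mul (hX 1)).add ((PolyFun.const _).mul (hX 2))) (hX 0).neg

lemma cross4 (hX : PolyVec X) (hY : PolyVec Y) (hZ : PolyVec Z) :
    PolyVec fun x => cross4 (X x) (Y x) (Z x) := by
  have h2 : ∀ i j, PolyFun fun x => Y x i * Z x j - Y x j * Z x i := fun i j =>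
    ((hY i).mul (hZ j)).sub ((hY j).mul (hZ i))
  have h3 : ∀ i j k l m n a b c, PolyFun fun x => X x a * (Y x i * Z x j - Y x j * Z x i)
      - X x b * (Y x k * Z x l - Y x l * Z x k) + X x c * (Y x m * Z x n - Y x n * Z x m) :=
    fun i j k l m n a b c => (((hX a).mul (h2 i j)).sub ((hX b).mul (h2 k l))).add
      ((hX c).mul (h2 m n))
  exact of_four (h3 _ _ _ _ _ _ _ _ _) (h3 _ _ _ _ _ _ _ _ _).neg (h3 _ _ _ _ _ _ _ _ _)
    (h3 _ _ _ _ _ _ _ _ _).neg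

lemma polyFun_bform (p q : ℝ) (hX : PolyVec X) (hY : PolyVec Y) :
    PolyFun fun x => bform p q (X x) (Y x) :=
  ((((PolyFun.const p).mul (((hX 1).mul (hY 1)).add ((hX 2).mul (hY 2)))).add
    ((PolyFun.const q).mul (((hX 1).mul (hY 2)).add ((hX 2).mul (hY 1))))).sub
    ((hX 0).mul (hY 3))).sub ((hX 3).mul (hY 0))

lemma smul {n : Type*} {f : Par → ℝ} {R : Par → n → ℝ} (hf : PolyFun f) (hR : PolyVec R) :
    PolyVec fun x => f x • R x := fun k => hf.mul (hR k)

lemma sub {n : Type*} {R S : Par → n → ℝ} (hR : PolyVec R) (hS : PolyVec S) :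
    PolyVec fun x => R x - S x := fun k => (hR k).sub (hS k)

lemma bilv (p q : ℝ) (hX : PolyVec X) (hY : PolyVec Y) :
    PolyVec fun x => bilv p q (X x) (Y x) := by
  have h1 : ∀ i j, PolyFun fun x => X x i * Y x j := fun i j => (hX i).mul (hY j)
  have h2 : ∀ i j, PolyFun fun x => X x i * Y x j + X x j * Y x i := fun i j =>
    (h1 i j).add (h1 j i)
  have h3 : ∀ a : ℝ, PolyFun fun x => a * (X x 0 * Y x 3 + X x 3 * Y x 0) := fun a =>
    (PolyFun.const a).mul (h2 0 3)
  exact forall_fin_nine.2 ⟨h1 _ _, h2 _ _, h2 _ _, (h1 _ _).add (h3 _), (h2 _ _).add (h3 _),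
    (h1 _ _).add (h3 _), h2 _ _, h2 _ _, h1 _ _⟩

lemma outerT (p q : ℝ) (hX : PolyVec X) (hY : PolyVec Y) :
    PolyVec fun x => outerT p q (X x) (Y x) := by
  have h1 : ∀ i j, PolyFun fun x => 2 * (X x i * Y x j) := fun i j =>
    (PolyFun.const 2).mul ((hX i).mul (hY j))
  have h2 : ∀ i j, PolyFun fun x => X x i * Y x j + X x j * Y x i := fun i j =>
    ((hX i).mul (hY j)).add ((hX j).mul (hY i))
  have h3 : ∀ a : ℝ, PolyFun fun x => bform p q (X x) (Y x) / 2 * a := fun a => by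
    simp only [div_eq_mul_inv]
    exact ((polyFun_bform p q hX hY).mul (.const _)).mul (.const a)
  exact forall_fin_nine.2 ⟨h1 _ _, h2 _ _, h2 _ _, (h1 _ _).sub (h3 _), (h2 _ _).sub (h3 _),
    (h1 _ _).sub (h3 _), h2 _ _, h2 _ _, h1 _ _⟩

lemma cvec (p q : ℝ) (κ : Idx) (k : Fin 9) : PolyVec fun x => cvec p q (x κ) k := by
  have n := nv p q κ
  have r := nr p q κ
  have s := ns p q κ
  revert k
  exact forall_fin_nine.2 ⟨bilv p q n n, bilv p q n r, bilv p q n s, bilv p q r r, bilv p q r s,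
    bilv p q s s, bilv p q r e4, bilv p q s e4, bilv p q e4 e4⟩

end PolyVec

/-- The three points of a parameter attached to the index `t`. -/
def tri (x : Par) (t : Fin 9) : Fin 3 → ℝ × ℝ := fun j => x (t, j)

/-- The vector annihilated by the first eight functionals at a point. -/
noncomputable def ptH (p q : ℝ) (u : ℝ × ℝ) : V9 :=
  outerT p q (flatv p q (nv p q u)) (flatv p q (nv p q u))

namespace PolyVec

lemma ptH (p q : ℝ) (κ : Idx) : PolyVec fun x => ptH p q (x κ) :=
  outerT p q (flatv p q (nv p q κ)) (flatv p q (nv p q κ))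

lemma mv (p q : ℝ) (σ : Fin 3 → Idx) : PolyVec fun x => mv p q fun j => x (σ j) :=
  sub (smul (polyFun_bform p q (nv p q _) (nv p q _)) (nv p q _))
    (smul (polyFun_bform p q (nv p q _) (nv p q _)) (nv p q _))

lemma yv (p q : ℝ) (t : Fin 9) : PolyVec fun x => yv p q (tri x t) :=
  flatv p q (cross4 (nv p q (t, 0)) (nv p q (t, 1)) (nv p q (t, 2)))

lemma yv' (p q : ℝ) (t : Fin 9) : PolyVec fun x => yv' p q (tri x t) :=
  flatv p q (cross4 (nv p q (t, 0)) (nv p q (t, 1)) e4)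

lemma lineF (p q : ℝ) (t : Fin 9) : PolyVec fun x => lineF p q (tri x t) :=
  smul (polyFun_bform p q (nv p q (t, 0)) (nv p q (t, 1)))
    (bilv p q (nv p q (t, 2)) (mv p q fun j => (t, j)))

lemma planeF (p q : ℝ) (t : Fin 9) : PolyVec fun x => planeF p q (tri x t) :=
  bilv p q (yv p q t) (yv p q t)

lemma lineH (p q : ℝ) (t : Fin 9) : PolyVec fun x => lineH p q (tri x t) :=
  outerT p q (cross4 (nv p q (t, 0)) (nv p q (t, 1)) (nv p q (t, 2)))
    (cross4 (nv p q (t, 0)) (nv p q (t, 1)) (nv p q (t, 2)))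

lemma planeH (p q : ℝ) (t : Fin 9) : PolyVec fun x => planeH p q (tri x t) :=
  outerT p q (flatv p q (nv p q (t, 2))) (flatv p q (mv p q fun j => (t, j)))

end PolyVec

/-! ### Linear relations -/

/-- Coordinates of a vector orthogonal to `nv` in the basis `nv, nr, ns`. -/
def coo (u : ℝ × ℝ) (z : Fin 4 → ℝ) : Fin 3 → ℝ := ![z 0, z 1 - u.1 * z 0, z 2 - u.2 * z 0]

/-- Coordinates of a symmetric product of two vectors orthogonal to `nv`. -/
def coo₂ (u : ℝ × ℝ) (y z : Fin 4 → ℝ) : Fin 6 → ℝ :=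
  ![coo u y 0 * coo u z 0, coo u y 0 * coo u z 1 + coo u y 1 * coo u z 0,
    coo u y 0 * coo u z 2 + coo u y 2 * coo u z 0, coo u y 1 * coo u z 1,
    coo u y 1 * coo u z 2 + coo u y 2 * coo u z 1, coo u y 2 * coo u z 2]

lemma polyVec_coo (κ : Idx) {Z : Par → Fin 4 → ℝ} (hZ : PolyVec Z) :
    PolyVec fun x => coo (x κ) (Z x) := by
  intro k
  fin_cases k
  · exact hZ 0
  · exact (hZ 1).sub ((PolyFun.fst κ).mul (hZ 0))
  · exact (hZ 2).sub ((PolyFun.snd κ).mul (hZ 0))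

lemma polyVec_coo₂ (κ : Idx) {Y Z : Par → Fin 4 → ℝ} (hY : PolyVec Y) (hZ : PolyVec Z) :
    PolyVec fun x => coo₂ (x κ) (Y x) (Z x) := by
  have h1 : ∀ i j, PolyFun fun x => coo (x κ) (Y x) i * coo (x κ) (Z x) j := fun i j =>
    (polyVec_coo κ hY i).mul (polyVec_coo κ hZ j)
  intro k
  fin_cases k
  · exact h1 0 0
  · exact (h1 0 1).add (h1 1 0)
  · exact (h1 0 2).add (h1 2 0)
  · exact h1 1 1
  · exact (h1 1 2).add (h1 2 1)
  · exact h1 2 2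

/-- The functional number `k`, for `k` among the first `n`. -/
noncomputable def cfl (p q : ℝ) {n : ℕ} (hn : n ≤ 9) (u : ℝ × ℝ) (k : Fin n) : V9 :=
  cvec p q u (k.castLE hn)

lemma cfl_mem (p q : ℝ) {n : ℕ} (hn : n ≤ 9) (u : ℝ × ℝ) (k : Fin n) :
    cfl p q hn u k ∈ flag (cvec p q u) n :=
  Finset.mem_image_of_mem _ (Finset.mem_filter.2 ⟨Finset.mem_univ _, k.2⟩)

lemma bilv_nv_comb {p q : ℝ} {u : ℝ × ℝ} {z : Fin 4 → ℝ} (h : bform p q (nv p q u) z = 0) :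
    bilv p q (nv p q u) z = ∑ k : Fin 3, coo u z k • cfl p q (by norm_num) u k := by
  conv_lhs => rw [eq_comb_of_bform_nv h]
  simp only [bilv_add_right, bilv_smul_right, Fin.sum_univ_three]
  rfl

lemma bilv_comb {p q : ℝ} {u : ℝ × ℝ} {y z : Fin 4 → ℝ} (hy : bform p q (nv p q u) y = 0)
    (hz : bform p q (nv p q u) z = 0) :
    bilv p q y z = ∑ k : Fin 6, coo₂ u y z k • cfl p q (by norm_num) u k := by
  conv_lhs => rw [eq_comb_of_bform_nv hy, eq_comb_of_bform_nv hz]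
  simp only [bilv_add_right, bilv_smul_right, bilv_add_left, bilv_smul_left]
  rw [bilv_comm p q (nr p q u) (nv p q u), bilv_comm p q (ns p q u) (nv p q u),
    bilv_comm p q (ns p q u) (nr p q u)]
  rw [Fin.sum_univ_six]
  change _ = _ • bilv p q (nv p q u) (nv p q u) + _ • bilv p q (nv p q u) (nr p q u)
    + _ • bilv p q (nv p q u) (ns p q u) + _ • bilv p q (nr p q u) (nr p q u)
    + _ • bilv p q (nr p q u) (ns p q u) + _ • bilv p q (ns p q u) (ns p q u)
  simp only [coo₂, coo, Matrix.cons_val]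
  module

lemma bform_mv (p q : ℝ) (w : Fin 3 → ℝ × ℝ) : bform p q (nv p q (w 2)) (mv p q w) = 0 := by
  rw [mv, bform_sub_smul, bform_comm p q (nv p q (w 2)), bform_comm p q (nv p q (w 2))]
  ring

lemma lineF_eq (p q : ℝ) (w : Fin 3 → ℝ × ℝ) : lineF p q w =
    (-bform p q (nv p q (w 1)) (nv p q (w 2))) • bilv p q (nv p q (w 0)) (mv p q ![w 1, w 2, w 0])
    + (-bform p q (nv p q (w 0)) (nv p q (w 2))) •
      bilv p q (nv p q (w 1)) (mv p q ![w 2, w 0, w 1]) := by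
  simp only [lineF, mv, Matrix.cons_val, sub_eq_add_neg, ← neg_smul, bilv_add_right,
    bilv_smul_right]
  rw [bilv_comm p q (nv p q (w 2)) (nv p q (w 0)), bilv_comm p q (nv p q (w 2)) (nv p q (w 1)),
    bilv_comm p q (nv p q (w 1)) (nv p q (w 0)), bform_comm p q (nv p q (w 2)) (nv p q (w 0)),
    bform_comm p q (nv p q (w 2)) (nv p q (w 1)), bform_comm p q (nv p q (w 1)) (nv p q (w 0))]
  module

lemma bform_yv {p q : ℝ} (hpq : FormCoeff p q) (w : Fin 3 → ℝ × ℝ) (j : Fin 3) :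
    bform p q (nv p q (w j)) (yv p q w) = 0 := by
  rw [bform_comm, yv, bform_flatv hpq]
  fin_cases j
  · exact cross4_dot_left _ _ _
  · exact cross4_dot_mid _ _ _
  · exact cross4_dot_right _ _ _

lemma bform_yv'_zero {p q : ℝ} (hpq : FormCoeff p q) (w : Fin 3 → ℝ × ℝ) :
    bform p q (nv p q (w 0)) (yv' p q w) = 0 := by
  rw [bform_comm, yv', bform_flatv hpq]
  exact cross4_dot_left _ _ _

lemma bform_yv'_one {p q : ℝ} (hpq : FormCoeff p q) (w : Fin 3 → ℝ × ℝ) :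
    bform p q (nv p q (w 1)) (yv' p q w) = 0 := by
  rw [bform_comm, yv', bform_flatv hpq]
  exact cross4_dot_mid _ _ _

lemma bform_flatv_flatv {p q : ℝ} (hpq : FormCoeff p q) (x y : Fin 4 → ℝ) :
    bform p q (flatv p q x) (flatv p q y) = bform p q x y := by
  rw [bform_flatv hpq, dotProduct_comm, flatv_dot, bform_comm]

/-- Functionals built from a vector orthogonal to `n` annihilate the square of `n`. -/
lemma bilv_dot_ptH {p q : ℝ} (hpq : FormCoeff p q) {u : ℝ × ℝ} {x y : Fin 4 → ℝ}
    (h : bform p q (nv p q u) x = 0) : bilv p q x y ⬝ᵥ ptH p q u = 0 := by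
  rw [ptH, bilv_dot_outerT hpq, flatv_dot, flatv_dot, bform_flatv_flatv hpq, bform_nv_nv, h]
  ring

lemma cfl_eight_dot_ptH {p q : ℝ} (hpq : FormCoeff p q) (u : ℝ × ℝ) (k : Fin 8) :
    cfl p q (by norm_num) u k ⬝ᵥ ptH p q u = 0 := by
  have hn := bform_nv_nv p q u
  have hr := bform_nv_nr p q u
  have hs := bform_nv_ns p q u
  fin_cases k
  · exact bilv_dot_ptH hpq hn
  · exact bilv_dot_ptH hpq hn
  · exact bilv_dot_ptH hpq hn
  · exact bilv_dot_ptH hpq hr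
  · exact bilv_dot_ptH hpq hr
  · exact bilv_dot_ptH hpq hs
  · exact bilv_dot_ptH hpq hr
  · exact bilv_dot_ptH hpq hs

lemma cfl_three_dot_lineH {p q : ℝ} (hpq : FormCoeff p q) (w : Fin 3 → ℝ × ℝ) (j k : Fin 3) :
    cfl p q (by norm_num) (w j) k ⬝ᵥ lineH p q w = 0 := by
  have h0 : cross4 (nv p q (w 0)) (nv p q (w 1)) (nv p q (w 2)) ⬝ᵥ nv p q (w j) = 0 := by
    fin_cases j
    · exact cross4_dot_left _ _ _
    · exact cross4_dot_mid _ _ _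
    · exact cross4_dot_right _ _ _
  have key : ∀ z, bform p q (nv p q (w j)) z = 0 →
      bilv p q (nv p q (w j)) z ⬝ᵥ lineH p q w = 0 := by
    intro z hz
    rw [lineH, bilv_dot_outerT hpq, h0, hz]
    ring
  fin_cases k
  · exact key _ (bform_nv_nv p q _)
  · exact key _ (bform_nv_nr p q _)
  · exact key _ (bform_nv_ns p q _)

lemma cfl_six_dot_planeH {p q : ℝ} (hpq : FormCoeff p q) (w : Fin 3 → ℝ × ℝ) (k : Fin 6) :
    cfl p q (by norm_num) (w 2) k ⬝ᵥ planeH p q w = 0 := by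
  have key : ∀ x z, bform p q (nv p q (w 2)) x = 0 → bform p q (nv p q (w 2)) z = 0 →
      bilv p q x z ⬝ᵥ planeH p q w = 0 := by
    intro x z hx hz
    rw [planeH, bilv_dot_outerT hpq, bform_flatv_flatv hpq, bform_mv, flatv_dot, flatv_dot,
      flatv_dot, flatv_dot, hx, hz]
    ring
  have hn := bform_nv_nv p q (w 2)
  have hr := bform_nv_nr p q (w 2)
  have hs := bform_nv_ns p q (w 2)
  fin_cases k
  · exact key _ _ hn hn
  · exact key _ _ hn hr
  · exact key _ _ hn hs
  · exact key _ _ hr hr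
  · exact key _ _ hr hs
  · exact key _ _ hs hs

lemma bilv_dot_planeH {p q : ℝ} (hpq : FormCoeff p q) (w : Fin 3 → ℝ × ℝ) {x z : Fin 4 → ℝ}
    (hx : ∀ j : Fin 2, bform p q (nv p q (w (j.castLE (by norm_num)))) x = 0)
    (hz : ∀ j : Fin 2, bform p q (nv p q (w (j.castLE (by norm_num)))) z = 0) :
    bilv p q x z ⬝ᵥ planeH p q w = 0 := by
  have key : ∀ y, (∀ j : Fin 2, bform p q (nv p q (w (j.castLE (by norm_num)))) y = 0) →
      bform p q (mv p q w) y = 0 := by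
    intro y hy
    have h0 : bform p q y (nv p q (w 0)) = 0 := by rw [bform_comm]; exact hy 0
    have h1 : bform p q y (nv p q (w 1)) = 0 := by rw [bform_comm]; exact hy 1
    rw [bform_comm, mv, bform_sub_smul, h0, h1]
    ring
  rw [planeH, bilv_dot_outerT hpq, bform_flatv_flatv hpq, bform_mv, flatv_dot, flatv_dot,
    flatv_dot, flatv_dot, key x hx, key z hz]
  ring

/-! ### General position holds generically -/

lemma PolyVec.cfl (p q : ℝ) {n : ℕ} (hn : n ≤ 9) (κ : Idx) (k : Fin n) :
    PolyVec fun x => cfl p q hn (x κ) k := .cvec p q κ (k.castLE hn)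

lemma gen_line (p q : ℝ) (hpq : FormCoeff p q) (j : Fin 3) : Gen fun x M =>
    Controls (Finset.univ.biUnion fun t => flag (cvec p q (x (t, j))) 1) stdSet M :=
  gen_controls_std (fun t x => cvec p q (x (t, j)) 0) (fun t => .cvec p q (t, j) 0)
    (fun κ => gridPt κ.1) (grid_nv hpq) _ fun _ t => Finset.mem_biUnion.2
      ⟨t, Finset.mem_univ _, Finset.mem_image_of_mem _ (by simp)⟩

lemma gen_lineF_left (p q : ℝ) (t : Fin 9) : Gen fun x M =>
    Controls (flag (cvec p q (x (t, 0))) 3 ∪ flag (cvec p q (x (t, 1))) 3)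
      {lineF p q (tri x t)} M := by
  refine gen_controls_comb (ι := Fin 3 ⊕ Fin 3)
    (R := Sum.elim (fun k x => cfl p q (by norm_num) (x (t, 0)) k)
      (fun k x => cfl p q (by norm_num) (x (t, 1)) k))
    (a := Sum.elim
      (fun k x => (-bform p q (nv p q (x (t, 1))) (nv p q (x (t, 2)))) *
        coo (x (t, 0)) (mv p q fun j => x (![(t, 1), (t, 2), (t, 0)] j)) k)
      (fun k x => (-bform p q (nv p q (x (t, 0))) (nv p q (x (t, 2)))) *
        coo (x (t, 1)) (mv p q fun j => x (![(t, 2), (t, 0), (t, 1)] j)) k))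
    ?_ (PolyFun.const 1) (fun _ => 0) one_ne_zero (fun x => ?_) ?_
  · rintro (k | k)
    · exact (PolyVec.polyFun_bform p q (.nv p q _) (.nv p q _)).neg.mul
        (polyVec_coo _ (.mv p q ![(t, 1), (t, 2), (t, 0)]) k)
    · exact (PolyVec.polyFun_bform p q (.nv p q _) (.nv p q _)).neg.mul
        (polyVec_coo _ (.mv p q ![(t, 2), (t, 0), (t, 1)]) k)
  · have e1 : (fun j => x (![(t, 1), (t, 2), (t, 0)] j)) = ![x (t, 1), x (t, 2), x (t, 0)] := by
      ext j : 1
      fin_cases j <;> rfl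
    have e2 : (fun j => x (![(t, 2), (t, 0), (t, 1)] j)) = ![x (t, 2), x (t, 0), x (t, 1)] := by
      ext j : 1
      fin_cases j <;> rfl
    have f1 := bilv_nv_comb (u := tri x t 0) (bform_mv p q ![tri x t 1, tri x t 2, tri x t 0])
    have f2 := bilv_nv_comb (u := tri x t 1) (bform_mv p q ![tri x t 2, tri x t 0, tri x t 1])
    rw [one_smul, lineF_eq, f1, f2]
    simp only [Fintype.sum_sum_type, Sum.elim_inl, Sum.elim_inr, e1, e2, mul_smul,
      ← Finset.smul_sum]
    rfl
  · rintro x (k | k)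
    · exact Finset.mem_union_left _ (cfl_mem _ _ _ _ _)
    · exact Finset.mem_union_right _ (cfl_mem _ _ _ _ _)

lemma gen_lineF_right (p q : ℝ) (t : Fin 9) : Gen fun x M =>
    Controls (flag (cvec p q (x (t, 2))) 3) {lineF p q (tri x t)} M := by
  refine gen_controls_comb (ι := Fin 3) (R := fun k x => cfl p q (by norm_num) (x (t, 2)) k)
    (a := fun k x => bform p q (nv p q (x (t, 0))) (nv p q (x (t, 1))) *
        coo (x (t, 2)) (mv p q fun j => x (t, j)) k)
    (fun k => (PolyVec.polyFun_bform p q (.nv p q _) (.nv p q _)).mul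
        (polyVec_coo _ (.mv p q fun j => (t, j)) k))
    (PolyFun.const 1) (fun _ => 0) one_ne_zero (fun x => ?_) fun x k => cfl_mem _ _ _ _ _
  rw [one_smul, lineF, bilv_nv_comb (bform_mv p q (tri x t))]
  simp only [mul_smul, ← Finset.smul_sum]
  rfl

lemma gen_lineF_span (p q : ℝ) (hpq : FormCoeff p q) : Gen fun x M =>
    Controls (Finset.univ.biUnion fun t => {lineF p q (tri x t)}) stdSet M := by
  obtain ⟨w, hw⟩ := lineF_span hpq
  exact gen_controls_std (fun t x => lineF p q (tri x t)) (fun t => .lineF p q t)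
    (fun κ => w κ.1 κ.2) hw _ fun _ t => Finset.mem_biUnion.2
      ⟨t, Finset.mem_univ _, Finset.mem_singleton_self _⟩

lemma gen_lineH (p q : ℝ) (hpq : FormCoeff p q) : Gen fun x M =>
    HanData (fun t => flag (cvec p q (x (t, 0))) 3 ∪ flag (cvec p q (x (t, 1))) 3 ∪
      flag (cvec p q (x (t, 2))) 3) (dualOf fun t => lineH p q (tri x t)) M := by
  obtain ⟨w, hw⟩ := lineH_span hpq
  refine gen_hanData (ι := Fin 3 × Fin 3)
    (fun t jk x => cfl p q (by norm_num) (x (t, jk.1)) jk.2) (fun t jk => .cfl p q (by norm_num) (t, jk.1) jk.2)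
    (fun t x => lineH p q (tri x t)) (fun t => .lineH p q t)
    (fun t jk x => cfl_three_dot_lineH hpq (tri x t) jk.1 jk.2)
    (fun t => ⟨fun κ => triPt κ.2, fun v hv => tri_line hpq v fun j k => hv (j, k)⟩)
    ⟨fun κ => w κ.1 κ.2, detOf_ne_zero hw⟩
    (fun x t => flag (cvec p q (x (t, 0))) 3 ∪ flag (cvec p q (x (t, 1))) 3 ∪
      flag (cvec p q (x (t, 2))) 3) ?_
  rintro x t ⟨j, k⟩
  have h := cfl_mem p q (by norm_num) (x (t, j)) k
  fin_cases j
  · exact Finset.mem_union_left _ (Finset.mem_union_left _ h)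
  · exact Finset.mem_union_left _ (Finset.mem_union_right _ h)
  · exact Finset.mem_union_right _ h

/-- The two vectors spanning the common orthogonal complement of two directions. -/
noncomputable def ypair (p q : ℝ) (w : Fin 3 → ℝ × ℝ) : Bool → Fin 4 → ℝ
  | false => yv p q w
  | true => yv' p q w

/-- The functionals common to two six-dimensional spaces. -/
noncomputable def zset (p q : ℝ) (w : Fin 3 → ℝ × ℝ) : Finset V9 :=
  Finset.univ.image fun b : Bool × Bool => bilv p q (ypair p q w b.1) (ypair p q w b.2)

lemma polyVec_ypair (p q : ℝ) (t : Fin 9) (b : Bool) : PolyVec fun x => ypair p q (tri x t) b := by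
  cases b
  · exact .yv p q t
  · exact .yv' p q t

lemma card_zset_le (p q : ℝ) (w : Fin 3 → ℝ × ℝ) : (zset p q w).card ≤ 36 :=
  Finset.card_image_le.trans (by simp)

lemma bform_ypair {p q : ℝ} (hpq : FormCoeff p q) (w : Fin 3 → ℝ × ℝ) (j : Fin 2) (b : Bool) :
    bform p q (nv p q (w (j.castLE (by norm_num)))) (ypair p q w b) = 0 := by
  cases b
  · exact bform_yv hpq w _
  · fin_cases j
    · exact bform_yv'_zero hpq w
    · exact bform_yv'_one hpq w

lemma gen_zset (p q : ℝ) {j : Fin 3}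
    (hj : ∀ w b, bform p q (nv p q (w j)) (ypair p q w b) = 0) (t : Fin 9) : Gen fun x M =>
    Controls (flag (cvec p q (x (t, j))) 6) (zset p q (tri x t)) M := by
  refine Gen.controls_union (ι := Bool × Bool)
    (p := fun b x => bilv p q (ypair p q (tri x t) b.1) (ypair p q (tri x t) b.2)) ?_ ?_
  · intro b
    refine gen_controls_comb (ι := Fin 6)
      (R := fun k x => cfl p q (by norm_num) (x (t, j)) k)
      (a := fun k x => coo₂ (x (t, j)) (ypair p q (tri x t) b.1)
        (ypair p q (tri x t) b.2) k)
      (fun k => polyVec_coo₂ _ (polyVec_ypair p q t _) (polyVec_ypair p q t _) k)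
      (PolyFun.const 1) (fun _ => 0) one_ne_zero (fun x => ?_) fun x k => cfl_mem _ _ _ _ _
    rw [one_smul]
    exact bilv_comb (hj (tri x t) b.1) (hj (tri x t) b.2)
  · intro x z hz
    obtain ⟨b, -, rfl⟩ := Finset.mem_image.1 hz
    exact ⟨b, rfl⟩

lemma gen_six_span (p q : ℝ) (hpq : FormCoeff p q) (t : Fin 9) : Gen fun x M =>
    Controls (flag (cvec p q (x (t, 0))) 6 ∪ flag (cvec p q (x (t, 1))) 6) stdSet M := by
  refine gen_controls_std (ι := Fin 6 ⊕ Fin 6)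
    (Sum.elim (fun k x => cfl p q (by norm_num) (x (t, 0)) k)
      (fun k x => cfl p q (by norm_num) (x (t, 1)) k)) ?_ (fun κ => triPt κ.2)
    (fun v hv => tri_six hpq v (fun k => hv (.inl k)) fun k => hv (.inr k)) _ ?_
  · rintro (k | k)
    · exact .cfl p q _ (t, 0) k
    · exact .cfl p q _ (t, 1) k
  · rintro x (k | k)
    · exact Finset.mem_union_left _ (cfl_mem _ _ _ _ _)
    · exact Finset.mem_union_right _ (cfl_mem _ _ _ _ _)

lemma gen_planeF (p q : ℝ) (hpq : FormCoeff p q) (t : Fin 9) : Gen fun x M =>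
    Controls (flag (cvec p q (x (t, 2))) 6) {planeF p q (tri x t)} M := by
  refine gen_controls_comb (ι := Fin 6) (R := fun k x => cfl p q (by norm_num) (x (t, 2)) k)
    (a := fun k x => coo₂ (x (t, 2)) (yv p q (tri x t)) (yv p q (tri x t)) k)
    (fun k => polyVec_coo₂ _ (.yv p q t) (.yv p q t) k)
    (PolyFun.const 1) (fun _ => 0) one_ne_zero (fun x => ?_) fun x k => cfl_mem _ _ _ _ _
  rw [one_smul]
  exact bilv_comb (bform_yv hpq (tri x t) 2) (bform_yv hpq (tri x t) 2)

lemma gen_planeF_span (p q : ℝ) (hpq : FormCoeff p q) : Gen fun x M =>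
    Controls (Finset.univ.biUnion fun t => {planeF p q (tri x t)}) stdSet M := by
  obtain ⟨w, hw⟩ := planeF_span hpq
  exact gen_controls_std (fun t x => planeF p q (tri x t)) (fun t => .planeF p q t)
    (fun κ => w κ.1 κ.2) hw _ fun _ t => Finset.mem_biUnion.2
      ⟨t, Finset.mem_univ _, Finset.mem_singleton_self _⟩

lemma gen_planeH (p q : ℝ) (hpq : FormCoeff p q) : Gen fun x M =>
    HanData (fun t => zset p q (tri x t) ∪ flag (cvec p q (x (t, 2))) 6)
      (dualOf fun t => planeH p q (tri x t)) M := by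
  obtain ⟨w, hw⟩ := planeH_span hpq
  refine gen_hanData (ι := (Bool × Bool) ⊕ Fin 6)
    (fun t => Sum.elim (fun b x => bilv p q (ypair p q (tri x t) b.1) (ypair p q (tri x t) b.2))
      (fun k x => cfl p q (by norm_num) (x (t, 2)) k)) ?_
    (fun t x => planeH p q (tri x t)) (fun t => .planeH p q t) ?_ ?_
    ⟨fun κ => w κ.1 κ.2, detOf_ne_zero hw⟩
    (fun x t => zset p q (tri x t) ∪ flag (cvec p q (x (t, 2))) 6) ?_
  · rintro t (b | k)
    · exact .bilv p q (polyVec_ypair p q t _) (polyVec_ypair p q t _)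
    · exact .cfl p q _ (t, 2) k
  · rintro t (b | k) x
    · exact bilv_dot_planeH hpq (tri x t) (fun j => bform_ypair hpq (tri x t) j b.1)
        fun j => bform_ypair hpq (tri x t) j b.2
    · exact cfl_six_dot_planeH hpq (tri x t) k
  · refine fun t => ⟨fun κ => triPt κ.2, fun v hv => ?_⟩
    exact tri_plane hpq v (hv (.inl (false, false))) (hv (.inl (false, true)))
      (hv (.inl (true, true))) fun k => hv (.inr k)
  · rintro x t (b | k)
    · exact Finset.mem_union_left _ (Finset.mem_image_of_mem _ (Finset.mem_univ b))
    · exact Finset.mem_union_right _ (cfl_mem _ _ _ _ _)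

lemma gen_ptH (p q : ℝ) (hpq : FormCoeff p q) (j : Fin 3) : Gen fun x M =>
    HanData (fun t => flag (cvec p q (x (t, j))) 8) (dualOf fun t => ptH p q (x (t, j))) M :=
  gen_hanData (ι := Fin 8) (fun t k x => cfl p q (by norm_num) (x (t, j)) k)
    (fun t k => .cfl p q (by norm_num) (t, j) k) (fun t x => ptH p q (x (t, j))) (fun t => .ptH p q (t, j))
    (fun _ k _ => cfl_eight_dot_ptH hpq _ k)
    (fun _ => ⟨fun _ => (0, 0), fun v hv => origin_eight hpq v hv⟩)
    ⟨fun κ => gridPt κ.1, detOf_ne_zero (grid_normal hpq)⟩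
    (fun x t => flag (cvec p q (x (t, j))) 8) fun _ _ _ => cfl_mem _ _ _ _ _

lemma gen_flag_full (p q : ℝ) (hpq : FormCoeff p q) (κ : Idx) : Gen fun x M =>
    Controls (flag (cvec p q (x κ)) 9) stdSet M :=
  gen_controls_std (fun k x => cfl p q le_rfl (x κ) k) (fun k => .cfl p q _ κ k)
    (fun _ => (0, 0)) (fun v hv => origin_full hpq v hv) _ fun _ _ => cfl_mem _ _ _ _ _

lemma gen_flag_bdd (p q : ℝ) (κ : Idx) : Gen fun x M =>
    Controls stdSet (flag (cvec p q (x κ)) 9) M :=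
  gen_std_controls (p := fun k x => cvec p q (x κ) k) (fun _ => .cvec p q _ _) fun x z hz => by
    obtain ⟨k, -, rfl⟩ := Finset.mem_image.1 hz
    exact ⟨k, rfl⟩

/-- Twenty-seven generic points are in quantitatively general position. -/
lemma gen_genPos (p q : ℝ) (hpq : FormCoeff p q) : Gen fun x M =>
    GenPos (fun t j => cvec p q (x (t, j))) (fun j => dualOf fun t => ptH p q (x (t, j))) M := by
  have three := (((Gen.all (gen_lineF_left p q)).and (.all (gen_lineF_right p q))).and
    (gen_lineF_span p q hpq)).and (gen_lineH p q hpq)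
  have six := (((((Gen.all (gen_zset p q fun w => bform_ypair hpq w 0)).and
    (.all (gen_zset p q fun w => bform_ypair hpq w 1))).and
    (.all (gen_six_span p q hpq))).and (.all (gen_planeF p q hpq))).and
    (gen_planeF_span p q hpq)).and (gen_planeH p q hpq)
  have rest := (((Gen.all (gen_line p q hpq)).and (.all (gen_ptH p q hpq))).and
    (.all (gen_flag_full p q hpq))).and (.all (gen_flag_bdd p q))
  refine ((three.and six).and rest).congr ?_
  rintro x - M hM ⟨⟨⟨⟨⟨a1, a2⟩, a3⟩, a4⟩, ⟨⟨⟨⟨⟨b1, b2⟩, b3⟩, b4⟩, b5⟩, b6⟩⟩, ⟨⟨c1, c2⟩, c3⟩, c4⟩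
  refine ⟨c1, ⟨_, _, a1, a2, a3, a4⟩, ⟨fun t => planeF p q (tri x t), _, _,
    fun t => card_zset_le p q (tri x t), b1, b2, b3,
    fun t => ?_, b4, b5, b6⟩, c2, fun t j => c4 (t, j), fun t j => c3 (t, j)⟩
  refine controls_of_subset ?_ hM
  rw [Finset.singleton_subset_iff]
  exact Finset.mem_image.2 ⟨(false, false), Finset.mem_univ _, rfl⟩

/-! ### Transversality of the dual functionals -/

lemma eval_freeze_self (κ : Idx × Fin 2) (x : Par) :
    (fun κ' => (freeze κ x κ').eval (val x κ)) = val x := by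
  ext κ'
  by_cases h : κ' = κ
  · subst h; simp [freeze]
  · simp [freeze, h]

lemma eval_freeze_fst (i : Idx) (x : Par) (r : ℝ) :
    (fun κ' => (freeze (i, 0) x κ').eval r) = val (Function.update x i (r, (x i).2)) := by
  ext ⟨k', b'⟩
  by_cases hk : k' = i
  · subst hk
    fin_cases b' <;> simp [val, freeze]
  · fin_cases b' <;> simp [val, freeze, hk]

lemma eval_pderiv {i : Idx} {x : Par} {p : MvPolynomial (Idx × Fin 2) ℝ} {f : Par → ℝ}
    (hf : ∀ x, f x = MvPolynomial.eval (val x) p) {d : ℝ}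
    (hd : HasDerivAt (fun r => f (Function.update x i (r, (x i).2))) d (x i).1) :
    MvPolynomial.eval (val x) (MvPolynomial.pderiv (i, 0) p) = d := by
  have h1 := (MvPolynomial.aeval (freeze (i, 0) x) p).hasDerivAt (val x (i, 0))
  rw [derivative_freeze, eval_freeze, eval_freeze_self] at h1
  have e : (fun r => (MvPolynomial.aeval (freeze (i, 0) x) p).eval r)
      = fun r => f (Function.update x i (r, (x i).2)) := by
    ext r
    rw [eval_freeze, eval_freeze_fst, hf]
  rw [e] at h1
  exact h1.unique hd

/-- Multiplying a dual functional by a vector amounts to replacing a column. -/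
lemma dualOf_dotProduct_eq_detOf (h : Fin 9 → V9) (s : Fin 9) (w : V9) :
    dualOf h s ⬝ᵥ w = detOf (Function.update h s w) := by
  have h1 : dualOf h s ⬝ᵥ w = ((Matrix.of fun k t => h t k).adjugate *ᵥ w) s := rfl
  rw [h1, ← Matrix.cramer_eq_adjugate_mulVec, Matrix.cramer_apply, detOf]
  congr 1
  ext k t
  by_cases ht : t = s
  · subst ht; simp
  · simp [ht]

/-- Reconstruction of a vector from its dual coordinates. -/
lemma detOf_smul_eq_sum (h : Fin 9 → V9) (v : V9) :
    detOf h • v = ∑ t, (dualOf h t ⬝ᵥ v) • h t := by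
  have h1 : (Matrix.of fun k t => h t k) *ᵥ ((Matrix.of fun k t => h t k).adjugate *ᵥ v)
      = detOf h • v := by
    rw [Matrix.mulVec_mulVec, Matrix.mul_adjugate, Matrix.smul_mulVec, Matrix.one_mulVec]
    rfl
  rw [← h1]
  ext k
  simp only [Matrix.mulVec, dotProduct, Finset.sum_apply, Pi.smul_apply, smul_eq_mul, Matrix.of_apply]
  exact Finset.sum_congr rfl fun t _ => mul_comm _ _

section transversality

variable {h : Fin 9 → Par → V9} {hp : Fin 9 → Fin 9 → MvPolynomial (Idx × Fin 2) ℝ}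
  {κ : Fin 9 → Idx × Fin 2}

/-- The polynomials defining the dual functionals. -/
noncomputable def dualPoly (hp : Fin 9 → Fin 9 → MvPolynomial (Idx × Fin 2) ℝ) :
    Matrix (Fin 9) (Fin 9) (MvPolynomial (Idx × Fin 2) ℝ) :=
  (Matrix.of fun k t => hp t k).adjugate

lemma eval_dualPoly (hh : ∀ t k x, h t x k = MvPolynomial.eval (val x) (hp t k)) (x : Par)
    (s k : Fin 9) : MvPolynomial.eval (val x) (dualPoly hp s k) = dualOf (fun t => h t x) s k := by
  have := RingHom.map_adjugate (MvPolynomial.eval (val x)) (Matrix.of fun k t => hp t k)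
  have h2 := congrFun (congrFun this s) k
  rw [dualOf]
  have e : (Matrix.of fun k t => h t x k)
      = (MvPolynomial.eval (val x)).mapMatrix (Matrix.of fun k t => hp t k) := by
    ext a b
    simp [hh]
  rw [e]
  exact h2

lemma eval_pderiv_dualPoly_dot (hh : ∀ t k x, h t x k = MvPolynomial.eval (val x) (hp t k))
    (hind : ∀ t τ k x, τ ≠ t → MvPolynomial.eval (val x) (MvPolynomial.pderiv (κ t) (hp τ k)) = 0)
    (x : Par) (s t τ : Fin 9) (hts : t ≠ s) :
    (∑ k, MvPolynomial.eval (val x) (MvPolynomial.pderiv (κ t) (dualPoly hp s k)) * h τ x k)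
      = (if τ = s then MvPolynomial.eval (val x)
          (MvPolynomial.pderiv (κ t) (Matrix.of fun k t => hp t k).det) else 0)
        - (if τ = t then ∑ k, dualOf (fun t => h t x) s k *
            MvPolynomial.eval (val x) (MvPolynomial.pderiv (κ t) (hp t k)) else 0) := by
  have h1 : ∑ k, dualPoly hp s k * hp τ k
      = if τ = s then (Matrix.of fun k t => hp t k).det else 0 := by
    have := congrFun (congrFun (Matrix.adjugate_mul (Matrix.of fun k t => hp t k)) s) τ
    rw [Matrix.mul_apply] at this
    simp only [Matrix.of_apply] at this
    rw [dualPoly, this]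
    simp [Matrix.one_apply, eq_comm]
  have h2 := congrArg (fun P => MvPolynomial.eval (val x) (MvPolynomial.pderiv (κ t) P)) h1
  simp only [map_sum, MvPolynomial.pderiv_mul, map_add, map_mul, eval_dualPoly hh, ← hh,
    Finset.sum_add_distrib] at h2
  rw [eq_sub_iff_add_eq]
  convert h2 using 1
  · congr 1
    split_ifs with hτ
    · subst hτ; rfl
    · exact (Finset.sum_eq_zero fun k _ => by rw [hind t τ k x hτ, mul_zero]).symm
  · split_ifs <;> simp

/-- Outside an exceptional set of parameters, dual functionals vary transversally. -/
lemma exists_gen_transversal (hh : ∀ t, PolyVec (h t)) (i : Fin 9 → Idx)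
    (hind : ∀ t τ x r, τ ≠ t → h τ (Function.update x (i t) (r, (x (i t)).2)) = h τ x)
    (s : Fin 9) (hdet : ∃ x₀, (detOf fun t => h t x₀) ≠ 0)
    (hder : ∀ t, t ≠ s → ∃ x₀ w, (∀ k, HasDerivAt
      (fun r => h t (Function.update x₀ (i t) (r, (x₀ (i t)).2)) k) (w k) (x₀ (i t)).1) ∧
        (dualOf (fun t => h t x₀) s ⬝ᵥ w) ≠ 0) :
    ∃ K : Par → ℝ → Prop, Gen K ∧ ∃ C : ℝ, 0 ≤ C ∧ ∀ M : ℝ, 1 ≤ M → ∀ v : V9, ∀ b ρ : ℝ,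
      0 < b → 0 ≤ ρ → (∃ k, b ≤ |v k|) →
      lawP {x | x ∈ cube ∧ K x M ∧ |dualOf (fun t => h t x) s ⬝ᵥ v| ≤ ρ}
        ≤ ENNReal.ofReal (C * M ^ 2 * (ρ / b)) := by
  choose hp hhp using hh
  have hhp' : ∀ t k x, h t x k = MvPolynomial.eval (val x) (hp t k) := fun t k x => hhp t k x
  set κ : Fin 9 → Idx × Fin 2 := fun t => (i t, 0) with hκ
  have hind' : ∀ t τ k x, τ ≠ t →
      MvPolynomial.eval (val x) (MvPolynomial.pderiv (κ t) (hp τ k)) = 0 := by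
    intro t τ k x hτ
    refine eval_pderiv (f := fun x => h τ x k) (fun x => hhp' τ k x) ?_
    simp only [hind t τ x _ hτ]
    exact hasDerivAt_const _ _
  set D : Par → ℝ := fun x => detOf fun t => h t x with hD
  have hDp : PolyFun D := polyFun_detOf fun t k => ⟨hp t k, hhp' t k⟩
  set c : Fin 9 → Par → ℝ := fun t x => ∑ k, dualOf (fun t => h t x) s k *
    MvPolynomial.eval (val x) (MvPolynomial.pderiv (κ t) (hp t k)) with hc
  have hcp : ∀ t, PolyFun (c t) := fun t => PolyFun.sum _ fun k =>
    (polyVec_dualOf (fun t k => ⟨hp t k, hhp' t k⟩) s k).mul ⟨_, fun _ => rfl⟩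
  set e : Fin 9 → Par → ℝ := fun t x => MvPolynomial.eval (val x)
    (MvPolynomial.pderiv (κ t) (Matrix.of fun k t => hp t k).det) with he
  have hep : ∀ t, PolyFun (e t) := fun t => ⟨_, fun _ => rfl⟩
  obtain ⟨B, hB, hBh, hBe⟩ : ∃ B : ℝ, 1 ≤ B ∧ (∀ x ∈ cube, ∀ t k, |h t x k| ≤ B) ∧
      ∀ x ∈ cube, ∀ t, |e t x| ≤ B := by
    obtain ⟨B1, hB1, h1⟩ := exists_bound_family (ι := Fin 9 × Fin 9)
      (f := fun tk x => h tk.1 x tk.2) fun tk => ⟨hp tk.1 tk.2, hhp' tk.1 tk.2⟩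
    obtain ⟨B2, hB2, h2⟩ := exists_bound_family hep
    exact ⟨max B1 B2, hB1.trans (le_max_left _ _),
      fun x hx t k => (h1 x hx (t, k)).trans (le_max_left _ _),
      fun x hx t => (h2 x hx t).trans (le_max_right _ _)⟩
  obtain ⟨N, hN⟩ : ∃ N : ℕ, ∀ k, (dualPoly hp s k).totalDegree ≤ N :=
    ⟨∑ k, (dualPoly hp s k).totalDegree, fun k =>
      Finset.single_le_sum (f := fun k => (dualPoly hp s k).totalDegree) (fun _ _ => Nat.zero_le _)
        (Finset.mem_univ k)⟩
  have hB0 : 0 < B := by linarith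
  refine ⟨fun x M => 1 ≤ M * |D x| ∧ ∀ t, t ≠ s → 1 ≤ M * |c t x|, ?_,
    9 * (2 * (N + 1)) * (18 * B ^ 2), by positivity, ?_⟩
  · obtain ⟨x₀, hx₀⟩ := hdet
    refine (Gen.of_ne hDp x₀ hx₀).and (Gen.all fun t => ?_)
    by_cases hts : t = s
    · exact Gen.triv fun x _ M _ hh => absurd hts hh
    · obtain ⟨x₁, w, hw, hne⟩ := hder t hts
      refine (Gen.of_ne (hcp t) x₁ ?_).congr fun x _ M _ hh _ => hh
      convert hne using 1
      refine Finset.sum_congr rfl fun k _ => ?_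
      congr 1
      exact eval_pderiv (hhp' t k) (hw k)
  intro M hM v b ρ hb hρ ⟨k₀, hk₀⟩
  have hM0 : 0 < M := by linarith
  by_cases hbig : b ≤ 18 * B ^ 2 * M ^ 2 * ρ
  · refine prob_le_one.trans ?_
    rw [ENNReal.one_le_ofReal]
    have h1 : 1 ≤ 18 * B ^ 2 * M ^ 2 * ρ / b := by rwa [one_le_div hb]
    have h2 : (1:ℝ) ≤ 9 * (2 * (N + 1)) := by
      have : (0:ℝ) ≤ N := Nat.cast_nonneg N
      linarith
    calc (1:ℝ) ≤ 9 * (2 * (N + 1)) * (18 * B ^ 2 * M ^ 2 * ρ / b) := by nlinarith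
      _ = _ := by ring
  push Not at hbig
  set P : MvPolynomial (Idx × Fin 2) ℝ := ∑ k, MvPolynomial.C (v k) * dualPoly hp s k with hP
  have hPdeg : P.totalDegree ≤ N := by
    refine (MvPolynomial.totalDegree_finsetSum _ _).trans (Finset.sup_le fun k _ => ?_)
    refine (MvPolynomial.totalDegree_mul _ _).trans ?_
    rw [MvPolynomial.totalDegree_C, zero_add]
    exact hN k
  have hPe : ∀ x, MvPolynomial.eval (val x) P = dualOf (fun t => h t x) s ⬝ᵥ v := by
    intro x
    rw [hP, map_sum, dotProduct]
    refine Finset.sum_congr rfl fun k _ => ?_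
    rw [map_mul, MvPolynomial.eval_C, eval_dualPoly hhp', mul_comm]
  set τ₀ := b / (18 * B * M) with hτ₀
  have hτ₀p : 0 < τ₀ := by positivity
  have hsub : {x | x ∈ cube ∧ (1 ≤ M * |D x| ∧ ∀ t, t ≠ s → 1 ≤ M * |c t x|) ∧
      |dualOf (fun t => h t x) s ⬝ᵥ v| ≤ ρ} ⊆ ⋃ t : Fin 9,
      {x | |MvPolynomial.eval (val x) P| ≤ ρ ∧
        τ₀ ≤ |MvPolynomial.eval (val x) (MvPolynomial.pderiv (κ t) P)|} := by
    rintro x ⟨hx, ⟨hDx, hcx⟩, hρx⟩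
    have hD0 : D x ≠ 0 := by
      intro h0
      rw [h0, abs_zero, mul_zero] at hDx
      linarith
    set X : Fin 9 → ℝ := fun t => (dualOf (fun t => h t x) t ⬝ᵥ v) / D x with hX
    have hv : ∀ k, v k = ∑ t, X t * h t x k := by
      intro k
      have := congrFun (detOf_smul_eq_sum (fun t => h t x) v) k
      simp only [Pi.smul_apply, smul_eq_mul, Finset.sum_apply] at this
      have h3 : D x * v k = D x * ∑ t, X t * h t x k := by
        rw [Finset.mul_sum]
        refine this.trans (Finset.sum_congr rfl fun t _ => ?_)
        simp only [hX]
        field_simp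
      exact mul_left_cancel₀ hD0 h3
    have hXs : |X s| ≤ M * ρ := by
      rw [hX, abs_div, div_le_iff₀ (abs_pos.2 hD0)]
      calc _ ≤ ρ * 1 := by linarith
        _ ≤ ρ * (M * |D x|) := mul_le_mul_of_nonneg_left hDx hρ
        _ = _ := by ring
    obtain ⟨t, ht⟩ : ∃ t, b / (9 * B) ≤ |X t| := by
      by_contra! hcon
      have : |v k₀| < b := by
        rw [hv k₀]
        calc _ ≤ ∑ t, |X t * h t x k₀| := Finset.abs_sum_le_sum_abs _ _
          _ < ∑ _t : Fin 9, b / 9 := by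
            refine Finset.sum_lt_sum_of_nonempty Finset.univ_nonempty fun t _ => ?_
            rw [abs_mul]
            calc _ ≤ |X t| * B := mul_le_mul_of_nonneg_left (hBh x hx t k₀) (abs_nonneg _)
              _ < b / (9 * B) * B := mul_lt_mul_of_pos_right (hcon t) hB0
              _ = b / 9 := by field_simp
          _ = b := by simp; ring
      linarith
    have hsmall : B * (M * ρ) ≤ b / (18 * B * M) := by
      rw [le_div_iff₀ (by positivity)]
      calc _ = 18 * B ^ 2 * M ^ 2 * ρ := by ring
        _ ≤ b := hbig.le
    have hts : t ≠ s := by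
      rintro rfl
      have h4 : b / (9 * B) ≤ b / (18 * B * M) :=
        ht.trans (hXs.trans (le_trans (le_mul_of_one_le_left (by positivity) hB) hsmall))
      rw [div_le_div_iff_of_pos_left hb (by positivity) (by positivity)] at h4
      nlinarith
    refine Set.mem_iUnion.2 ⟨t, ⟨by rw [hPe]; exact hρx, ?_⟩⟩
    have hder : MvPolynomial.eval (val x) (MvPolynomial.pderiv (κ t) P) = X s * e t x - X t * c t x := by
      have h5 : MvPolynomial.eval (val x) (MvPolynomial.pderiv (κ t) P) =
          ∑ k, MvPolynomial.eval (val x) (MvPolynomial.pderiv (κ t) (dualPoly hp s k)) * v k := by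
        rw [hP, map_sum, map_sum]
        refine Finset.sum_congr rfl fun k _ => ?_
        rw [MvPolynomial.pderiv_C_mul, map_mul, MvPolynomial.eval_C, mul_comm]
      rw [h5]
      simp only [hv, Finset.mul_sum]
      rw [Finset.sum_comm]
      have h6 : ∀ τ, ∑ k, MvPolynomial.eval (val x) (MvPolynomial.pderiv (κ t) (dualPoly hp s k)) *
          (X τ * h τ x k) = X τ * ((if τ = s then e t x else 0) - if τ = t then c t x else 0) := by
        intro τ
        rw [← eval_pderiv_dualPoly_dot hhp' hind' x s t τ hts, Finset.mul_sum]
        exact Finset.sum_congr rfl fun k _ => by ring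
      simp only [h6, mul_sub, Finset.sum_sub_distrib, mul_ite, mul_zero, Finset.sum_ite_eq',
        Finset.mem_univ, if_true]
    have h7 : |X t * c t x| - |X s * e t x| ≤ |X s * e t x - X t * c t x| := by
      rw [abs_sub_comm]
      exact abs_sub_abs_le_abs_sub _ _
    have h8 : |X s * e t x| ≤ M * ρ * B := by
      rw [abs_mul]
      exact mul_le_mul hXs (hBe x hx t) (abs_nonneg _) (by positivity)
    have h9 : b / (9 * B * M) ≤ |X t * c t x| := by
      rw [abs_mul]
      have h10 : 1 / M ≤ |c t x| := by
        rw [div_le_iff₀ hM0, mul_comm]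
        exact hcx t hts
      calc _ = b / (9 * B) * (1 / M) := by field_simp
        _ ≤ _ := mul_le_mul ht h10 (by positivity) (abs_nonneg _)
    have h11 : b / (9 * B * M) = 2 * τ₀ := by rw [hτ₀]; field_simp; norm_num
    rw [hder]
    have h12 : M * ρ * B ≤ τ₀ := by rw [hτ₀]; linarith
    linarith
  calc _ ≤ _ := measure_mono hsub
    _ ≤ ∑ t : Fin 9, _ := measure_iUnion_fintype_le _ _
    _ ≤ ∑ _t : Fin 9, ENNReal.ofReal (2 * (N + 1) * (ρ / τ₀)) :=
        Finset.sum_le_sum fun t _ => lawP_slice (κ t) P hPdeg hτ₀p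
    _ = ENNReal.ofReal (9 * (2 * (N + 1) * (ρ / τ₀))) := by
        rw [Finset.sum_const, Finset.card_univ, Fintype.card_fin, nsmul_eq_mul,
          ENNReal.ofReal_mul (p := 9) (by norm_num)]
        norm_num
    _ ≤ _ := by
        apply ENNReal.ofReal_le_ofReal
        have h13 : ρ / τ₀ = 18 * B * M * (ρ / b) := by rw [hτ₀]; field_simp
        have h14 : 18 * B * M ≤ 18 * B ^ 2 * M ^ 2 := by
          have : 1 * 1 ≤ B * M := mul_le_mul hB hM zero_le_one hB0.le
          nlinarith
        rw [h13]
        have h15 : 0 ≤ ρ / b := by positivity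
        calc _ = 9 * (2 * ((N:ℝ) + 1)) * (18 * B * M) * (ρ / b) := by ring
          _ ≤ 9 * (2 * ((N:ℝ) + 1)) * (18 * B ^ 2 * M ^ 2) * (ρ / b) := by gcongr
          _ = _ := by ring

end transversality

/-! ### Transversality for the dual functionals of nine points -/

lemma hasDerivAt_zero_poly (a b d e g : ℝ) :
    HasDerivAt (fun r : ℝ => a + b * r + r ^ 2 * (d + e * r + g * r ^ 2)) b 0 := by
  have h := (((hasDerivAt_id (0:ℝ)).const_mul b).const_add a).add
    (((hasDerivAt_id (0:ℝ)).pow 2).mul ((((hasDerivAt_id (0:ℝ)).const_mul e).const_add d).add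
      (((hasDerivAt_id (0:ℝ)).pow 2).const_mul g)))
  have h' : HasDerivAt (fun r : ℝ => a + b * r + r ^ 2 * (d + e * r + g * r ^ 2)) _ 0 := h
  simpa using h'

/-- The derivative of `ptH` at the origin in the first direction. -/
def ptW (p q : ℝ) : V9 := ![0, 0, 0, 0, 0, 0, -2 * p, -2 * q, 0]

lemma hasDerivAt_ptH (p q : ℝ) (k : Fin 9) :
    HasDerivAt (fun r => ptH p q (r, 0) k) (ptW p q k) 0 := by
  have key : ∃ a d e g : ℝ, (fun r => ptH p q (r, 0) k)
      = fun r => a + ptW p q k * r + r ^ 2 * (d + e * r + g * r ^ 2) := by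
    refine forall_fin_nine (P := fun k => ∃ a d e g : ℝ, (fun r => ptH p q (r, 0) k)
      = fun r => a + ptW p q k * r + r ^ 2 * (d + e * r + g * r ^ 2)) |>.2 ⟨?_, ?_, ?_, ?_, ?_, ?_, ?_, ?_, ?_⟩ k <;>
    simp only [ptH, outerT, bform, flatv, nv, ptW, Matrix.cons_val]
    · exact ⟨0, 0, 0, p ^ 2 / 2, by ext r; ring⟩
    · exact ⟨0, 0, -p ^ 2, 0, by ext r; ring⟩
    · exact ⟨0, 0, -p * q, 0, by ext r; ring⟩
    · exact ⟨0, 2 * p ^ 2 - (p * (p ^ 2 + q ^ 2) + 2 * p * q ^ 2 - p) / 2 * p, 0, 0, by ext r; ring⟩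
    · exact ⟨0, 2 * p * q - (p * (p ^ 2 + q ^ 2) + 2 * p * q ^ 2 - p) / 2 * q, 0, 0, by ext r; ring⟩
    · exact ⟨0, 2 * q ^ 2 - (p * (p ^ 2 + q ^ 2) + 2 * p * q ^ 2 - p) / 2 * p, 0, 0, by ext r; ring⟩
    · exact ⟨0, 0, 0, 0, by ext r; ring⟩
    · exact ⟨0, 0, 0, 0, by ext r; ring⟩
    · exact ⟨2, 0, 0, 0, by ext r; ring⟩
  obtain ⟨a, d, e, g, h⟩ := key
  rw [h]
  exact hasDerivAt_zero_poly _ _ _ _ _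

lemma grid_normal_tangent {p q : ℝ} (hpq : FormCoeff p q) (v : V9) (hw : ptW p q ⬝ᵥ v = 0)
    (h : ∀ t, t ≠ 1 → ptH p q (gridPt t) ⬝ᵥ v = 0) : v = 0 := by
  have h0 := h 0 (by decide)
  have h2 := h 2 (by decide)
  have h3 := h 3 (by decide)
  have h4 := h 4 (by decide)
  have h5 := h 5 (by decide)
  have h6 := h 6 (by decide)
  have h7 := h 7 (by decide)
  have h8 := h 8 (by decide)
  rw [dot9] at hw
  simp only [ptH, outerT_dot, bform, flatv, nv, gridPt, ptW, Matrix.cons_val] at h0 h2 h3 h4 h5 h6 h7 h8 hw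
  apply eq_zero_of_coords
  rcases hpq with ⟨rfl, rfl⟩ | ⟨rfl, rfl⟩ <;> norm_num at h0 h2 h3 h4 h5 h6 h7 h8 hw <;>
    refine ⟨?_, ?_, ?_, ?_, ?_, ?_, ?_, ?_, ?_⟩ <;> linarith

lemma exists_gen_transversal_ptH {p q : ℝ} (hpq : FormCoeff p q) (j : Fin 3) (s : Fin 9) :
    ∃ K : Par → ℝ → Prop, Gen K ∧ ∃ C : ℝ, 0 ≤ C ∧ ∀ M : ℝ, 1 ≤ M → ∀ v : V9, ∀ b ρ : ℝ,
      0 < b → 0 ≤ ρ → (∃ k, b ≤ |v k|) →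
      lawP {x | x ∈ cube ∧ K x M ∧ |dualOf (fun t => ptH p q (x (t, j))) s ⬝ᵥ v| ≤ ρ}
        ≤ ENNReal.ofReal (C * M ^ 2 * (ρ / b)) := by
  refine exists_gen_transversal (h := fun t x => ptH p q (x (t, j))) (fun t => .ptH p q (t, j))
    (fun t => (t, j)) ?_ s ⟨fun κ => gridPt κ.1, detOf_ne_zero (grid_normal hpq)⟩ ?_
  · intro t τ x r hτ
    rw [Function.update_of_ne]
    simpa using hτ
  · intro t hts
    obtain ⟨σ, h4, h1⟩ : ∃ σ : Equiv.Perm (Fin 9), σ t = 4 ∧ σ s = 1 := by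
      refine ⟨(Equiv.swap t 4).trans (Equiv.swap (Equiv.swap t 4 s) 1), ?_, ?_⟩
      · rw [Equiv.trans_apply, Equiv.swap_apply_left, Equiv.swap_apply_of_ne_of_ne]
        · intro h
          apply hts
          conv_lhs at h => rw [← Equiv.swap_apply_left t (4 : Fin 9)]
          exact (Equiv.swap t 4).injective h
        · decide
      · rw [Equiv.trans_apply, Equiv.swap_apply_left]
    refine ⟨fun κ => gridPt (σ κ.1), ptW p q, fun k => ?_, ?_⟩
    · have e : gridPt 4 = (0, 0) := rfl
      simpa [h4, e] using hasDerivAt_ptH p q k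
    · rw [dualOf_dotProduct_eq_detOf]
      refine detOf_ne_zero fun v hv => grid_normal_tangent hpq v ?_ fun k hk => ?_
      · simpa using hv s
      · have hne : σ.symm k ≠ s := by
          rintro rfl
          exact hk (by rw [← h1, Equiv.apply_symm_apply])
        simpa [Function.update_of_ne hne] using hv (σ.symm k)

/-! ### Averaging arguments -/

section averaging

variable {Ω ι : Type*} [MeasurableSpace Ω] {P : Measure Ω} [IsProbabilityMeasure P] {F : Finset ι}

lemma measurable_card_filter_mem {Q : ι → Set Ω} (hQ : ∀ w ∈ F, MeasurableSet (Q w)) :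
    Measurable fun x => ((F.filter fun w => x ∈ Q w).card : ℝ) := by
  have : (fun x => ((F.filter fun w => x ∈ Q w).card : ℝ))
      = fun x => ∑ w ∈ F, (Q w).indicator (fun _ => (1 : ℝ)) x := by
    ext x
    rw [Finset.card_filter]
    push_cast
    rfl
  rw [this]
  exact Finset.measurable_fun_sum _ fun w hw => measurable_const.indicator (hQ w hw)

lemma integral_card_filter_mem {Q : ι → Set Ω} (hQ : ∀ w ∈ F, MeasurableSet (Q w)) :
    ∫ x, ((F.filter fun w => x ∈ Q w).card : ℝ) ∂P = ∑ w ∈ F, P.real (Q w) := by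
  have : (fun x => ((F.filter fun w => x ∈ Q w).card : ℝ))
      = fun x => ∑ w ∈ F, (Q w).indicator (fun _ => (1 : ℝ)) x := by
    ext x
    rw [Finset.card_filter]
    push_cast
    rfl
  rw [this, integral_finsetSum _ fun w hw => (integrable_const _).indicator (hQ w hw)]
  exact Finset.sum_congr rfl fun w hw => integral_indicator_one (hQ w hw)

lemma integrable_card_filter_mem {Q : ι → Set Ω} (hQ : ∀ w ∈ F, MeasurableSet (Q w)) :
    Integrable (fun x => ((F.filter fun w => x ∈ Q w).card : ℝ)) P := by
  refine Integrable.of_bound (measurable_card_filter_mem hQ).aestronglyMeasurable F.card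
    (.of_forall fun x => ?_)
  rw [Real.norm_natCast]
  exact_mod_cast Finset.card_filter_le _ _

/-- A point lying in many sets of a family, and outside small exceptional sets. -/
lemma exists_mem_many (hF : F.Nonempty) {Q V : ι → Set Ω} {N : Set Ω}
    (hQ : ∀ w ∈ F, MeasurableSet (Q w)) {η : ℝ} (hη : 0 < η)
    (hV : ∀ w ∈ F, P (V w) ≤ ENNReal.ofReal η) (hN : P N ≤ ENNReal.ofReal η)
    (hsum : 4 * η * F.card ≤ ∑ w ∈ F, P.real (Q w)) :
    ∃ x, x ∉ N ∧ 2 * η * F.card ≤ (F.filter fun w => x ∈ Q w ∧ x ∉ V w).card := by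
  set Q' : ι → Set Ω := fun w => Q w \ (toMeasurable P N ∪ toMeasurable P (V w)) with hQ'
  have hm : ∀ w ∈ F, MeasurableSet (Q' w) := fun w hw =>
    (hQ w hw).diff ((measurableSet_toMeasurable _ _).union (measurableSet_toMeasurable _ _))
  obtain ⟨x, hx⟩ := exists_integral_le (integrable_card_filter_mem (P := P) hm)
  rw [integral_card_filter_mem hm] at hx
  have h1 : ∀ w ∈ F, P.real (Q w) - 2 * η ≤ P.real (Q' w) := by
    intro w hw
    have e1 : ∀ S : Set Ω, P S ≤ ENNReal.ofReal η → P.real (toMeasurable P S) ≤ η := fun S hS => by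
      rw [measureReal_def, measure_toMeasurable]
      exact ENNReal.toReal_le_of_le_ofReal hη.le hS
    have e2 := le_measureReal_sdiff (μ := P) (s₂ := toMeasurable P N ∪ toMeasurable P (V w)) (s₁ := Q w)
    have e3 := measureReal_union_le (μ := P) (toMeasurable P N) (toMeasurable P (V w))
    have := e1 _ hN
    have := e1 _ (hV w hw)
    change _ ≤ P.real (Q w \ _)
    linarith
  have h2 := Finset.sum_le_sum h1
  rw [Finset.sum_sub_distrib, Finset.sum_const, nsmul_eq_mul] at h2
  have h3 : 2 * η * F.card ≤ ((F.filter fun w => x ∈ Q' w).card : ℝ) := by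
    refine le_trans (by linarith) (hx.trans_eq ?_)
    congr
  have hFp : (0:ℝ) < F.card := by exact_mod_cast hF.card_pos
  have h4 : (0:ℝ) < ((F.filter fun w => x ∈ Q' w).card : ℝ) := by
    have : 0 < 2 * η * F.card := by positivity
    linarith
  refine ⟨x, ?_, h3.trans ?_⟩
  · obtain ⟨w, hw⟩ := Finset.card_pos.1 (by exact_mod_cast h4)
    exact fun hxN => (Finset.mem_filter.1 hw).2.2 (Or.inl (subset_toMeasurable _ _ hxN))
  · refine Nat.cast_le.2 (Finset.card_le_card fun w hw => ?_)
    obtain ⟨hwF, hw⟩ := Finset.mem_filter.1 hw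
    exact Finset.mem_filter.2 ⟨hwF, hw.1, fun h => hw.2 (Or.inr (subset_toMeasurable _ _ h))⟩

lemma mul_card_le_sum_measureReal {Q : ι → Set Ω} (hQ : ∀ w ∈ F, MeasurableSet (Q w)) {a b : ℝ}
    (ha : 0 ≤ a)
    (h : ENNReal.ofReal b ≤ P {x | a ≤ ((F.filter fun w => x ∈ Q w).card : ℝ)}) :
    a * b ≤ ∑ w ∈ F, P.real (Q w) := by
  rw [← integral_card_filter_mem hQ]
  have h1 := mul_meas_ge_le_integral_of_nonneg (μ := P)
    (.of_forall fun x => Nat.cast_nonneg _) (integrable_card_filter_mem (P := P) hQ) a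
  refine le_trans (mul_le_mul_of_nonneg_left ?_ ha) h1
  exact (ENNReal.ofReal_le_iff_le_toReal (measure_ne_top _ _)).1 h

/-- If many indices are bad at many parameters, then many indices are bad at independent
parameters simultaneously. -/
lemma pow_mul_card_le_sum_lawP (hF : F.Nonempty) {B : ι → Set (ℝ × ℝ)}
    (hB : ∀ w ∈ F, MeasurableSet (B w)) {β : ℝ} (hβ : 0 ≤ β)
    (h : ENNReal.ofReal β ≤ mPar {u | β * F.card ≤ ((F.filter fun w => u ∈ B w).card : ℝ)}) :
    β ^ 54 * F.card ≤ ∑ w ∈ F, lawP.real {x | ∀ κ, x κ ∈ B w} := by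
  have h1 := mul_card_le_sum_measureReal hB (by positivity) h
  have h2 : ∀ w, lawP.real {x | ∀ κ, x κ ∈ B w} = mPar.real (B w) ^ 27 := by
    intro w
    have e : {x : Par | ∀ κ, x κ ∈ B w} = Set.univ.pi fun _ => B w := by
      ext x; simp
    rw [measureReal_def, e, lawP, Measure.pi_pi, Finset.prod_const, ENNReal.toReal_pow]
    rfl
  simp only [h2]
  have hFp : (0:ℝ) < F.card := by exact_mod_cast hF.card_pos
  have h3 := pow_sum_div_card_le_sum_pow (s := F) (f := fun w => mPar.real (B w))
    (fun w _ => measureReal_nonneg) 26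
  refine le_trans ?_ h3
  rw [le_div_iff₀ (by positivity)]
  calc _ = (β * F.card * β) ^ 27 := by ring
    _ ≤ _ := by gcongr

end averaging

/-! ### Projections along random functionals -/

section projections

variable {X Ω : Type*} [MeasurableSpace X] {P : Measure X} [IsProbabilityMeasure P] {F : Finset Ω}

lemma measureReal_many_le {S : Ω → Set X} {a b : ℝ} (ha : 0 < a)
    (h : ∑ w ∈ F, P.real (S w) ≤ b) :
    P.real {x | a < ((F.filter fun w => x ∈ S w).card : ℝ)} ≤ b / a := by
  have hm : ∀ w ∈ F, MeasurableSet (toMeasurable P (S w)) := fun w _ => measurableSet_toMeasurable _ _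
  have h1 := mul_meas_ge_le_integral_of_nonneg (μ := P)
    (.of_forall fun x => Nat.cast_nonneg _) (integrable_card_filter_mem (P := P) hm) a
  rw [integral_card_filter_mem hm] at h1
  simp only [measureReal_def, measure_toMeasurable] at h1 h
  rw [le_div_iff₀ ha, mul_comm]
  refine le_trans (mul_le_mul_of_nonneg_left ?_ ha.le) (h1.trans h)
  refine ENNReal.toReal_mono (measure_ne_top _ _) (measure_mono fun x hx => ?_)
  refine (Set.mem_ofPred_eq ▸ hx : a < _).le.trans (Nat.cast_le.2 (Finset.card_le_card fun w hw => ?_))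
  rw [Finset.mem_filter] at hw ⊢
  exact ⟨hw.1, subset_toMeasurable _ _ hw.2⟩

lemma measureReal_le_shells {S : V9 → Set X} {K σ ℓ : ℝ} (hσ : 0 < σ) (hK : 0 ≤ K)
    (hS : ∀ v : V9, ∀ b : ℝ, 0 < b → (∃ k, b ≤ |v k|) → P.real (S v) ≤ K * (σ / b))
    {v : V9} (hv : ∀ k, |v k| ≤ Real.exp ℓ * σ) :
    P.real (S v) ≤ (if ∀ k, |v k| ≤ σ then 1 else 0) + ∑ n ∈ Finset.range ⌈ℓ⌉₊,
      if ∀ k, |v k| ≤ Real.exp (n + 1) * σ then K * Real.exp (-n) else 0 := by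
  have hnn : ∀ n ∈ Finset.range ⌈ℓ⌉₊,
      0 ≤ if ∀ k, |v k| ≤ Real.exp (n + 1) * σ then K * Real.exp (-n) else 0 := fun n _ => by
    split_ifs <;> positivity
  by_cases h0 : ∀ k, |v k| ≤ σ
  · rw [if_pos h0]
    have := Finset.sum_nonneg hnn
    have : P.real (S v) ≤ 1 := measureReal_le_one
    linarith
  have hex : ∃ m : ℕ, ∀ k, |v k| ≤ Real.exp m * σ := ⟨⌈ℓ⌉₊, fun k => (hv k).trans (by
    gcongr
    exact Nat.le_ceil ℓ)⟩
  obtain ⟨n, hn⟩ : ∃ n, Nat.find hex = n + 1 := Nat.exists_eq_succ_of_ne_zero fun h => by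
    have := Nat.find_spec hex
    rw [h] at this
    exact h0 fun k => by simpa using this k
  have hle : Nat.find hex ≤ ⌈ℓ⌉₊ := Nat.find_min' hex fun k => (hv k).trans (by
    gcongr
    exact Nat.le_ceil ℓ)
  have hspec := Nat.find_spec hex
  have hmin := Nat.find_min hex (m := n) (by omega)
  rw [hn] at hspec hle
  push Not at hmin
  obtain ⟨k, hk⟩ := hmin
  have h1 := hS v (Real.exp n * σ) (by positivity) ⟨k, hk.le⟩
  rw [if_neg h0, zero_add]
  refine le_trans ?_ (Finset.single_le_sum hnn (Finset.mem_range.2 hle))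
  rw [if_pos (by exact_mod_cast hspec)]
  refine h1.trans_eq ?_
  rw [Real.exp_neg]
  field_simp

/-- Projections along random functionals: on average, few points of a Frostman set are close to a
given one after projection. -/
lemma sum_measureReal_le {ξ : Ω → V9} {C₁ r₀ α : ℝ} (hC₁ : 0 ≤ C₁) (hα : α ∈ Set.Ioo (0:ℝ) 9)
    {w : Ω} (hball : ∀ r, r₀ ≤ r →
      ((F.filter fun w' => ∀ k, |ξ w' k - ξ w k| ≤ r).card : ℝ) ≤ C₁ * r ^ α * F.card)
    {S : V9 → Set X} {K σ ℓ : ℝ} (hσ : 0 < σ) (hK : 0 ≤ K)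
    (hS : ∀ v : V9, ∀ b : ℝ, 0 < b → (∃ k, b ≤ |v k|) → P.real (S v) ≤ K * (σ / b))
    (hℓ : 0 ≤ ℓ) (hσr : r₀ ≤ σ) :
    ∑ w' ∈ F.filter (fun w' => ∀ k, |ξ w' k - ξ w k| ≤ Real.exp ℓ * σ), P.real (S (ξ w' - ξ w))
      ≤ (ℓ + 2) * (K + 1) * Real.exp 9 * C₁ * (Real.exp ℓ * σ) ^ α * Real.exp (-(min α 1 * ℓ))
        * F.card := by
  obtain ⟨hα0, hα9⟩ := hα
  set G := F.filter (fun w' => ∀ k, |ξ w' k - ξ w k| ≤ Real.exp ℓ * σ) with hG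
  set D := Real.exp 9 * Real.exp ((α - min α 1) * ℓ) with hD
  have hm : 0 ≤ α - min α 1 := by linarith [min_le_left α 1]
  have hm1 : α - 1 ≤ α - min α 1 := by linarith [min_le_right α 1]
  have hmℓ := mul_nonneg hm hℓ
  have hcard : ∀ r, r₀ ≤ r →
      ((G.filter fun w' => ∀ k, |(ξ w' - ξ w) k| ≤ r).card : ℝ) ≤ C₁ * r ^ α * F.card := fun r hr =>
    (Nat.cast_le.2 (Finset.card_le_card (Finset.filter_subset_filter _ (Finset.filter_subset _ _)))).trans
      (hball r hr)
  have h0 : C₁ * σ ^ α * F.card ≤ D * (C₁ * σ ^ α * F.card) := by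
    refine le_mul_of_one_le_left (by positivity) ?_
    rw [hD, ← Real.exp_add]
    exact Real.one_le_exp (by positivity)
  have hn : ∀ n ∈ Finset.range ⌈ℓ⌉₊, K * Real.exp (-n) * (C₁ * (Real.exp (n + 1) * σ) ^ α * F.card)
      ≤ K * (D * (C₁ * σ ^ α * F.card)) := by
    intro n hn
    have hnℓ : (n : ℝ) ≤ ℓ := (Nat.lt_ceil.1 (Finset.mem_range.1 hn)).le
    have e1 : Real.exp (-n) * Real.exp ((n + 1) * α) ≤ D := by
      rw [hD, ← Real.exp_add, ← Real.exp_add, Real.exp_le_exp]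
      have a1 : (n:ℝ) * (α - 1) ≤ (α - min α 1) * ℓ := by
        calc (n:ℝ) * (α - 1) ≤ n * (α - min α 1) := by gcongr
          _ ≤ ℓ * (α - min α 1) := by gcongr
          _ = _ := mul_comm _ _
      linarith
    rw [Real.mul_rpow (Real.exp_pos _).le hσ.le, ← Real.exp_mul]
    calc _ = K * ((Real.exp (-n) * Real.exp ((n + 1) * α)) * (C₁ * σ ^ α * F.card)) := by ring
      _ ≤ _ := by gcongr
  calc _ ≤ ∑ w' ∈ G, ((if ∀ k, |(ξ w' - ξ w) k| ≤ σ then (1:ℝ) else 0) + ∑ n ∈ Finset.range ⌈ℓ⌉₊,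
      if ∀ k, |(ξ w' - ξ w) k| ≤ Real.exp (n + 1) * σ then K * Real.exp (-n) else 0) :=
        Finset.sum_le_sum fun w' hw' => measureReal_le_shells hσ hK hS (Finset.mem_filter.1 hw').2
    _ = ((G.filter fun w' => ∀ k, |(ξ w' - ξ w) k| ≤ σ).card : ℝ) + ∑ n ∈ Finset.range ⌈ℓ⌉₊,
        K * Real.exp (-n) *
          ((G.filter fun w' => ∀ k, |(ξ w' - ξ w) k| ≤ Real.exp (n + 1) * σ).card : ℝ) := by
        rw [Finset.sum_add_distrib, Finset.sum_comm, Finset.sum_boole]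
        congr 1
        refine Finset.sum_congr rfl fun n _ => ?_
        rw [← Finset.sum_filter, Finset.sum_const, nsmul_eq_mul, mul_comm]
    _ ≤ D * (C₁ * σ ^ α * F.card) + ∑ _n ∈ Finset.range ⌈ℓ⌉₊, K * (D * (C₁ * σ ^ α * F.card)) := by
        refine add_le_add ((hcard σ hσr).trans h0) (Finset.sum_le_sum fun n hn' => ?_)
        refine le_trans (mul_le_mul_of_nonneg_left (hcard _ ?_) (by positivity)) (hn n hn')
        refine hσr.trans (le_mul_of_one_le_left hσ.le (Real.one_le_exp (by positivity)))
    _ = (1 + ⌈ℓ⌉₊ * K) * (D * (C₁ * σ ^ α * F.card)) := by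
        rw [Finset.sum_const, Finset.card_range, nsmul_eq_mul]
        ring
    _ ≤ ((ℓ + 2) * (K + 1)) * (D * (C₁ * σ ^ α * F.card)) := by
        gcongr
        have := Nat.ceil_lt_add_one hℓ
        nlinarith
    _ = _ := by
        have e2 : D * σ ^ α = Real.exp 9 * (Real.exp ℓ * σ) ^ α * Real.exp (-(min α 1 * ℓ)) := by
          rw [hD, Real.mul_rpow (Real.exp_pos _).le hσ.le, ← Real.exp_mul,
            show (α - min α 1) * ℓ = ℓ * α + -(min α 1 * ℓ) by ring, Real.exp_add]
          ring
        calc _ = ((ℓ + 2) * (K + 1)) * C₁ * F.card * (D * σ ^ α) := by ring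
          _ = _ := by rw [e2]; ring

end projections

/-! ### Entropy of a configuration in general position -/

lemma forall_mem_scaled_stdSet {ρ : ℝ} (hρ : 0 < ρ) (v : V9) :
    (∀ x ∈ scaled ρ stdSet, |x ⬝ᵥ v| ≤ 1) ↔ ∀ k, |v k| ≤ ρ := by
  simp only [scaled, stdSet, Finset.mem_image, Finset.mem_univ, true_and, forall_exists_index,
    and_imp, forall_apply_eq_imp_iff, smul_dotProduct, single_dotProduct, one_mul, smul_eq_mul,
    abs_mul, abs_of_pos (inv_pos.2 hρ), inv_mul_le_iff₀ hρ, mul_one]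

lemma forall_mem_relSet {ρ ρ' : ℝ} (hρ : 0 < ρ) (hρ' : 0 < ρ') (g v : V9) :
    (∀ x ∈ relSet ρ ρ' {g}, |x ⬝ᵥ v| ≤ 1) ↔ |g ⬝ᵥ v| ≤ ρ ∧ ∀ k, |v k| ≤ ρ' := by
  rw [← forall_mem_scaled_stdSet hρ']
  simp only [relSet, Finset.mem_union, or_imp, forall_and]
  refine and_congr ?_ Iff.rfl
  simp only [scaled, Finset.image_singleton, Finset.mem_singleton, forall_eq, smul_dotProduct,
    smul_eq_mul, abs_mul, abs_of_pos (inv_pos.2 hρ), inv_mul_le_iff₀ hρ, mul_one]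

lemma forall_mem_boxSet {s : Fin 5 → ℝ} (hs : ∀ a, 0 < s a) (c : Fin 9 → V9) (v : V9) :
    (∀ x ∈ boxSet s c, |x ⬝ᵥ v| ≤ 1) ↔ ∀ k, |c k ⬝ᵥ v| ≤ s (lev k) := by
  simp only [boxSet, Finset.mem_image, Finset.mem_univ, true_and, forall_exists_index,
    forall_apply_eq_imp_iff, smul_dotProduct, smul_eq_mul,
    abs_mul, abs_of_pos (inv_pos.2 (hs _)), inv_mul_le_iff₀ (hs _), mul_one]

/-- Counting estimates at a configuration in general position are constrained by entropy. -/
lemma log_le_of_genPos {Ω : Type*} {F A : Finset Ω} {ξ : Ω → V9} (hA : A.Nonempty) (hAF : A ⊆ F)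
    {b C₁ Λ T M α : ℝ} (hb : 0 < b) (hC₁ : 0 < C₁) (hΛ : 0 < Λ) (hT : 0 < T) (hM : 1 ≤ M)
    {s : Fin 5 → ℝ} (hs : ∀ a, 0 < s a) (hmono : Monotone s) (hbA : b * F.card ≤ A.card)
    {cv : Fin 9 → Fin 3 → Fin 9 → V9} {g : Fin 3 → Fin 9 → V9} (hg : GenPos cv g M)
    (hball : ∀ w ∈ A, ∀ a, ((F.filter fun w' => ∀ k, |ξ w' k - ξ w k| ≤ s a).card : ℝ)
      ≤ C₁ * s a ^ α * F.card)
    (hproj : ∀ w ∈ A, ∀ j a, ((F.filter fun w' => |g j a ⬝ᵥ (ξ w' - ξ w)| ≤ s 3 ∧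
      ∀ k, |ξ w' k - ξ w k| ≤ s 4).card : ℝ) ≤ Λ * F.card)
    (hbox : ∀ w ∈ A, ∀ t j, T * F.card ≤
      ((F.filter fun w' => ∀ k, |cv t j k ⬝ᵥ (ξ w' - ξ w)| ≤ s (lev k)).card : ℝ)) :
    27 * Real.log b - 189 / 8 * Real.log C₁ - 27 / 8 * Real.log Λ
      - α * (3 * Real.log (s 0) + 6 * Real.log (s 1) + 9 * Real.log (s 2) + 45 / 8 * Real.log (s 3))
    ≤ 27 * (9 * Real.log 5 - Real.log T) + 90000 * Real.log (2 * M + 3) := by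
  have main := (subLike_obsEnt ξ hA).sum_boxSet (by norm_num) hM hs hmono hg
  have h1 : ∀ a, Real.log b - (Real.log C₁ + α * Real.log (s a)) ≤ obsEnt A ξ (scaled (s a) stdSet) := by
    intro a
    have := le_obsEnt_of_card_le (ξ := ξ) hA hAF hb (N := C₁ * s a ^ α)
      (mul_pos hC₁ (Real.rpow_pos_of_pos (hs a) _)) hbA (X := scaled (s a) stdSet) (fun w hw => by
        simpa only [forall_mem_scaled_stdSet (hs a), Pi.sub_apply] using hball w hw a)
    rwa [Real.log_mul hC₁.ne' (Real.rpow_pos_of_pos (hs a) _).ne', Real.log_rpow (hs a)] at this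
  have h2 : ∀ j a, Real.log b - Real.log Λ ≤ obsEnt A ξ (relSet (s 3) (s 4) {g j a}) := fun j a =>
    le_obsEnt_of_card_le (ξ := ξ) hA hAF hb hΛ hbA (fun w hw => by
      simpa only [forall_mem_relSet (hs 3) (hs 4), Pi.sub_apply] using hproj w hw j a)
  have h3 : ∀ t j, obsEnt A ξ (boxSet s (cv t j)) ≤ 9 * Real.log 5 - Real.log T := by
    intro t j
    have e1 := obsEnt_le_of_le_card (ξ := ξ) hA hAF hT (X := boxSet s (cv t j)) (fun w hw => by
      simpa only [forall_mem_boxSet hs] using hbox w hw t j)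
    have e2 : ((boxSet s (cv t j)).card : ℝ) ≤ 9 := by
      exact_mod_cast Finset.card_image_le.trans_eq (by simp)
    have e3 : 0 ≤ Real.log 5 := Real.log_nonneg (by norm_num)
    nlinarith
  have h4 : (27:ℝ) * (Real.log b - Real.log Λ) ≤ ∑ j, ∑ a, obsEnt A ξ (relSet (s 3) (s 4) {g j a}) := by
    have := Finset.sum_le_sum fun j (_ : j ∈ (Finset.univ : Finset (Fin 3))) =>
      Finset.sum_le_sum fun a (_ : a ∈ (Finset.univ : Finset (Fin 9))) => h2 j a
    refine le_trans (le_of_eq ?_) this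
    simp only [Finset.sum_const, Finset.card_univ, Fintype.card_fin, nsmul_eq_mul]
    push_cast
    ring
  have h5 : ∑ t, ∑ j, obsEnt A ξ (boxSet s (cv t j)) ≤ 27 * (9 * Real.log 5 - Real.log T) := by
    have := Finset.sum_le_sum fun t (_ : t ∈ (Finset.univ : Finset (Fin 9))) =>
      Finset.sum_le_sum fun j (_ : j ∈ (Finset.univ : Finset (Fin 3))) => h3 t j
    refine this.trans (le_of_eq ?_)
    simp only [Finset.sum_const, Finset.card_univ, Fintype.card_fin, nsmul_eq_mul]
    push_cast
    ring
  have := h1 0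
  have := h1 1
  have := h1 2
  have := h1 3
  unfold lossUnit at main
  linarith

/-! ### A configuration in general position made of bad parameters -/

/-- The parameters at which a box around `w` is overcrowded. -/
def badPar {Ω : Type*} (p q T : ℝ) (s : Fin 5 → ℝ) (F : Finset Ω) (ξ : Ω → V9) (w : Ω) :
    Set (ℝ × ℝ) :=
  {u | (|u.1| ≤ 1 ∧ |u.2| ≤ 1) ∧ T * F.card <
    ((F.filter fun w' => ∀ k, |cvec p q u k ⬝ᵥ (ξ w' - ξ w)| ≤ s (lev k)).card : ℝ)}

lemma continuous_cvec_dotProduct (p q : ℝ) (k : Fin 9) (v : V9) :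
    Continuous fun u => cvec p q u k ⬝ᵥ v := by
  fin_cases k <;> simp only [cvec, nv, nr, ns, e4, bilv_dot, Matrix.cons_val, Fin.reduceFinMk,
    Fin.zero_eta, Fin.mk_one, Fin.isValue] <;> fun_prop

lemma measurableSet_badPar {Ω : Type*} (p q T : ℝ) (s : Fin 5 → ℝ) (F : Finset Ω) (ξ : Ω → V9)
    (w : Ω) : MeasurableSet (badPar p q T s F ξ w) := by
  have h1 : IsClosed {u : ℝ × ℝ | |u.1| ≤ 1 ∧ |u.2| ≤ 1} :=
    (isClosed_le (f := fun u : ℝ × ℝ => |u.1|) (by fun_prop) continuous_const).and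
      (isClosed_le (f := fun u : ℝ × ℝ => |u.2|) (by fun_prop) continuous_const)
  have h2 : ∀ w' ∈ F, MeasurableSet {u | ∀ k, |cvec p q u k ⬝ᵥ (ξ w' - ξ w)| ≤ s (lev k)} := by
    intro w' _
    rw [Set.ofPred_forall]
    exact (isClosed_iInter fun k => isClosed_le (continuous_cvec_dotProduct p q k _).abs
      continuous_const).measurableSet
  have h3 : Measurable fun u => ((F.filter fun w' =>
      ∀ k, |cvec p q u k ⬝ᵥ (ξ w' - ξ w)| ≤ s (lev k)).card : ℝ) := by
    convert measurable_card_filter_mem h2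
    rfl
  exact h1.measurableSet.inter (measurableSet_lt measurable_const h3)

lemma exists_genPos_bad {p q : ℝ} (hpq : FormCoeff p q) : ∃ C c : ℝ, 0 < c ∧ 0 ≤ C ∧
    ∀ {Ω : Type} {F : Finset Ω} (_ : F.Nonempty) {ξ : Ω → V9} {C₁ r₀ α ℓ T β M : ℝ}
      {s : Fin 5 → ℝ}, 0 < C₁ → α ∈ Set.Ioo (0:ℝ) 9 → 0 ≤ ℓ → 0 < β → 1 ≤ M → 0 < s 3 →
      r₀ ≤ s 3 → s 4 = Real.exp ℓ * s 3 → C * M ^ (-c) ≤ β ^ 54 / 4 →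
      (∀ w ∈ F, ∀ r, r₀ ≤ r →
        ((F.filter fun w' => ∀ k, |ξ w' k - ξ w k| ≤ r).card : ℝ) ≤ C₁ * r ^ α * F.card) →
      ENNReal.ofReal β ≤
        mPar {u | β * F.card ≤ ((F.filter fun w => u ∈ badPar p q T s F ξ w).card : ℝ)} →
      ∃ x : Par, GenPos (fun t j => cvec p q (x (t, j)))
          (fun j => dualOf fun t => ptH p q (x (t, j))) M ∧
        ∃ A ⊆ F, A.Nonempty ∧ β ^ 54 / 2 * F.card ≤ A.card ∧
          ∀ w ∈ A, (∀ κ, x κ ∈ badPar p q T s F ξ w) ∧ ∀ j a,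
            ((F.filter fun w' => |dualOf (fun t => ptH p q (x (t, j))) a ⬝ᵥ (ξ w' - ξ w)| ≤ s 3 ∧
              ∀ k, |ξ w' k - ξ w k| ≤ s 4).card : ℝ) ≤
            (108 / β ^ 54 * ((ℓ + 2) * (C * M ^ 2 + 1) * Real.exp 9 * C₁ * s 4 ^ α *
              Real.exp (-(min α 1 * ℓ)))) * F.card := by
  choose K hK D hD hKD using fun (y : Fin 3 × Fin 9) => exists_gen_transversal_ptH hpq y.1 y.2
  obtain ⟨C₀, c, hc, hC₀, hgen⟩ := (gen_genPos p q hpq).and (Gen.all hK)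
  have hDs : ∀ y, D y ≤ C₀ + ∑ y, D y := fun y =>
    (Finset.single_le_sum (fun y _ => hD y) (Finset.mem_univ y)).trans (by linarith)
  have hDn : 0 ≤ ∑ y, D y := Finset.sum_nonneg fun y _ => hD y
  refine ⟨C₀ + ∑ y, D y, c, hc, by linarith, ?_⟩
  intro Ω F hF ξ C₁ r₀ α ℓ T β M s hC₁ hα hℓ hβ hM hs3 hr0 hs4 hCM hball hmany
  set C := C₀ + ∑ y, D y with hC
  have hM0 : 0 < M := by linarith
  have hFp : (0:ℝ) < F.card := by exact_mod_cast hF.card_pos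
  set B₀ := (ℓ + 2) * (C * M ^ 2 + 1) * Real.exp 9 * C₁ * s 4 ^ α * Real.exp (-(min α 1 * ℓ))
    with hB₀
  have hCn : 0 ≤ C := by linarith
  have hB₀pos : 0 < B₀ := by
    have : 0 < s 4 := by rw [hs4]; positivity
    positivity
  set Λ := 108 / β ^ 54 * B₀ with hΛ
  have hΛpos : 0 < Λ := by positivity
  set S : Fin 3 × Fin 9 → V9 → Set Par := fun y v => {x | x ∈ cube ∧ K y x M ∧
    |dualOf (fun t => ptH p q (x (t, y.1))) y.2 ⬝ᵥ v| ≤ s 3} with hS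
  set near : Ω → Finset Ω := fun w => F.filter fun w' => ∀ k, |ξ w' k - ξ w k| ≤ s 4 with hnear
  set V₁ : Fin 3 × Fin 9 → Ω → Set Par := fun y w =>
    {x | Λ * F.card < (((near w).filter fun w' => x ∈ S y (ξ w' - ξ w)).card : ℝ)} with hV₁
  have hV₁le : ∀ y, ∀ w ∈ F, lawP (V₁ y w) ≤ ENNReal.ofReal (β ^ 54 / 108) := by
    intro y w hw
    have h1 : ∑ w' ∈ near w, lawP.real (S y (ξ w' - ξ w)) ≤ B₀ * F.card := by
      simp only [hnear, hs4, hB₀]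
      refine sum_measureReal_le hC₁.le hα (hball w hw) hs3 (by positivity) ?_ hℓ hr0
      intro v b hb hv
      have h2 := hKD y M hM v b (s 3) hb hs3.le hv
      refine ENNReal.toReal_le_of_le_ofReal (by positivity) (h2.trans ?_)
      refine ENNReal.ofReal_le_ofReal ?_
      gcongr
      exact hDs y
    have h2 : lawP.real (V₁ y w) ≤ B₀ * F.card / (Λ * F.card) := by
      convert measureReal_many_le (a := Λ * F.card) (by positivity) h1
    have h3 : B₀ * F.card / (Λ * F.card) = β ^ 54 / 108 := by
      rw [hΛ]
      field_simp
    rw [h3] at h2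
    exact (ENNReal.le_ofReal_iff_toReal_le (measure_ne_top _ _) (by positivity)).2 h2
  have hη : 0 < β ^ 54 / 4 := by positivity
  have hV : ∀ w ∈ F, lawP (⋃ y, V₁ y w) ≤ ENNReal.ofReal (β ^ 54 / 4) := by
    intro w hw
    refine (measure_iUnion_fintype_le _ _).trans
      ((Finset.sum_le_sum fun y _ => hV₁le y w hw).trans ?_)
    rw [← ENNReal.ofReal_sum_of_nonneg fun _ _ => by positivity]
    refine ENNReal.ofReal_le_ofReal (le_of_eq ?_)
    simp only [Finset.sum_const, Finset.card_univ, Fintype.card_prod, Fintype.card_fin, nsmul_eq_mul]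
    push_cast
    ring
  have hN := (hgen M hM).trans (ENNReal.ofReal_le_ofReal
    ((mul_le_mul_of_nonneg_right (by linarith) (by positivity)).trans hCM))
  have hsum := pow_mul_card_le_sum_lawP hF (fun w _ => measurableSet_badPar p q T s F ξ w) hβ.le hmany
  have hQ : ∀ w ∈ F, MeasurableSet {x : Par | ∀ κ, x κ ∈ badPar p q T s F ξ w} := by
    intro w _
    rw [Set.ofPred_forall]
    exact MeasurableSet.iInter fun κ => (measurableSet_badPar p q T s F ξ w).preimage
      (measurable_pi_apply κ)
  obtain ⟨x, hxN, hx⟩ := exists_mem_many hF hQ hη hV hN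
    (by rw [show 4 * (β ^ 54 / 4) = β ^ 54 by ring]; exact hsum)
  set A := F.filter fun w => x ∈ {x : Par | ∀ κ, x κ ∈ badPar p q T s F ξ w} ∧ x ∉ ⋃ y, V₁ y w
    with hA
  have hAcard : β ^ 54 / 2 * F.card ≤ A.card := by
    calc β ^ 54 / 2 * F.card = 2 * (β ^ 54 / 4) * F.card := by ring
      _ ≤ _ := by convert hx
  have hAne : A.Nonempty := by
    rw [← Finset.card_pos]
    have : (0:ℝ) < A.card := lt_of_lt_of_le (by positivity) hAcard
    exact_mod_cast this
  have hcube : x ∈ cube := by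
    obtain ⟨w, hw⟩ := hAne
    have h1 : ∀ κ, x κ ∈ badPar p q T s F ξ w := (Finset.mem_filter.1 hw).2.1
    rintro ⟨k, b⟩
    rw [val]
    split_ifs
    exacts [(h1 k).1.1, (h1 k).1.2]
  have hgood := not_not.1 fun h => hxN ⟨hcube, h⟩
  refine ⟨x, hgood.1, A, Finset.filter_subset _ _, hAne, hAcard, fun w hw => ?_⟩
  obtain ⟨hwF, hw1, hw2⟩ := Finset.mem_filter.1 hw
  refine ⟨hw1, fun j a => ?_⟩
  have h3 : x ∉ V₁ (j, a) w := fun h => hw2 (Set.mem_iUnion.2 ⟨_, h⟩)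
  have h4 : (((near w).filter fun w' => x ∈ S (j, a) (ξ w' - ξ w)).card : ℝ) ≤ Λ * F.card :=
    not_lt.1 h3
  refine le_trans (Nat.cast_le.2 (Finset.card_le_card fun w' hw' => ?_)) h4
  obtain ⟨e1, e2, e3⟩ := Finset.mem_filter.1 hw'
  exact Finset.mem_filter.2 ⟨Finset.mem_filter.2 ⟨e1, e3⟩, hcube, hgood.2 (j, a), e2⟩

/-! ### The bad parameters have small measure -/

/-- The scales of the boxes. -/
noncomputable def scale (ℓ δ : ℝ) (a : Fin 5) : ℝ := Real.exp (((a : ℕ) - 2 : ℝ) * ℓ) * δ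

lemma scale_pos {δ : ℝ} (hδ : 0 < δ) (ℓ : ℝ) (a : Fin 5) : 0 < scale ℓ δ a :=
  mul_pos (Real.exp_pos _) hδ

lemma scale_mono {ℓ δ : ℝ} (hℓ : 0 ≤ ℓ) (hδ : 0 ≤ δ) : Monotone (scale ℓ δ) := by
  intro a b hab
  have : ((a : ℕ) : ℝ) ≤ (b : ℕ) := by exact_mod_cast hab
  unfold scale
  gcongr

lemma log_scale {δ : ℝ} (hδ : 0 < δ) (ℓ : ℝ) (a : Fin 5) :
    Real.log (scale ℓ δ a) = ((a : ℕ) - 2 : ℝ) * ℓ + Real.log δ := by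
  rw [scale, Real.log_mul (Real.exp_pos _).ne' hδ.ne', Real.log_exp]

/-- The numerical contradiction behind the nonconcentration estimate. -/
lemma false_of_log_le {ℓ D ε κ μ α φ E X logC₁ logb logΛ logT logM a₁ a₂ : ℝ} (hℓ : 0 ≤ ℓ)
    (hκ : 0 ≤ κ) (hε : 0 < ε) (hε1 : ε < 1) (hD : 2 * ℓ ≤ D) (hE : E = 2000 * (κ + 1))
    (hφ : 8 * φ ≤ μ - α / 9)
    (hb : logb = -(54 * (ε * ℓ)) - Real.log 2)
    (hΛ : logΛ ≤ Real.log 108 + 54 * (ε * ℓ) + (a₁ + ε * ℓ) + (a₂ + 2 * (κ * ε * ℓ)) + 9 + logC₁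
      + α * (2 * ℓ - D) - μ * ℓ)
    (hT : logT = X + logC₁ - φ * ℓ - (α - E * Real.sqrt ε) * D)
    (hM : logM ≤ Real.log 5 + κ * ε * ℓ)
    (hX : X = Real.log 2 + (Real.log 108 + a₁ + a₂ + 9) / 8 + 90243 / 27 * Real.log 5 + 1)
    (main : 27 * logb - 189 / 8 * logC₁ - 27 / 8 * logΛ
      - α * (3 * ((0 - 2) * ℓ + -D) + 6 * ((1 - 2) * ℓ + -D) + 9 * ((2 - 2) * ℓ + -D)
        + 45 / 8 * ((3 - 2) * ℓ + -D)) ≤ 27 * (9 * Real.log 5 - logT) + 90000 * logM) : False := by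
  have hs : ε ≤ Real.sqrt ε := Real.le_sqrt_of_sq_le (by nlinarith)
  have h1 : E * (ε * (2 * ℓ)) ≤ E * Real.sqrt ε * D := by
    rw [mul_assoc]
    have : 0 ≤ E := by rw [hE]; positivity
    gcongr
  have h2 : 8 * φ * ℓ ≤ (μ - α / 9) * ℓ := mul_le_mul_of_nonneg_right hφ hℓ
  have h3 : 0 ≤ ε * ℓ := by positivity
  have h4 : 0 ≤ κ * ε * ℓ := by positivity
  rw [hE] at h1 hT
  rw [hT, hb, hX] at main
  nlinarith

lemma log_add_two_le {ε ℓ : ℝ} (hε : 0 < ε) (hℓ : 0 ≤ ℓ) :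
    Real.log (ℓ + 2) ≤ Real.log (2 + 1 / ε) + ε * ℓ := by
  have h : Real.log ((2 + 1 / ε) * Real.exp (ε * ℓ)) = Real.log (2 + 1 / ε) + ε * ℓ := by
    rw [Real.log_mul (by positivity) (Real.exp_pos _).ne', Real.log_exp]
  rw [← h]
  refine Real.log_le_log (by positivity) ?_
  have h1 : (2 + 1 / ε) * (ε * ℓ + 1) = ℓ + 2 + 2 * (ε * ℓ) + 1 / ε := by
    field_simp
    ring
  have h2 : 0 < 1 / ε := by positivity
  have h3 : (2 + 1 / ε) * (ε * ℓ + 1) ≤ (2 + 1 / ε) * Real.exp (ε * ℓ) :=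
    mul_le_mul_of_nonneg_left (Real.add_one_le_exp _) (by positivity)
  have h4 : 0 ≤ ε * ℓ := by positivity
  linarith

lemma mPar_bad_lt {p q : ℝ} (hpq : FormCoeff p q) : ∃ E : ℝ, 1 ≤ E ∧ ∀ ε : ℝ, 0 < ε → ε < 1 →
    ∃ L Cε : ℝ, 1 ≤ L ∧ 1 ≤ Cε ∧ ∀ {Ω : Type} {F : Finset Ω} (_ : F.Nonempty) {ξ : Ω → V9}
      {C₁ r₀ α φ ℓ δ : ℝ}, 0 < C₁ → α ∈ Set.Ioo (0:ℝ) 9 → 8 * φ ≤ min α 1 - α / 9 →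
      (∀ w ∈ F, ∀ r, r₀ ≤ r →
        ((F.filter fun w' => ∀ k, |ξ w' k - ξ w k| ≤ r).card : ℝ) ≤ C₁ * r ^ α * F.card) →
      L ≤ ℓ → 0 < δ → δ ≤ Real.exp (-(2 * ℓ)) → r₀ ≤ scale ℓ δ 0 →
      mPar {u | Real.exp (-(ε * ℓ)) * F.card ≤ ((F.filter fun w => u ∈ badPar p q
        (Cε * C₁ * Real.exp (-(φ * ℓ)) * δ ^ (α - E * Real.sqrt ε)) (scale ℓ δ) F ξ w).card : ℝ)}
      < ENNReal.ofReal (Real.exp (-(ε * ℓ))) := by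
  obtain ⟨C, c, hc, hC, hcore⟩ := exists_genPos_bad hpq
  set κ := 55 / c with hκ
  have hκ0 : 0 < κ := by positivity
  refine ⟨2000 * (κ + 1), by linarith, fun ε hε hε1 => ?_⟩
  set X := Real.log 2 + (Real.log 108 + Real.log (2 + 1 / ε) + Real.log (C + 1) + 9) / 8
    + 90243 / 27 * Real.log 5 + 1 with hX
  have hX0 : 0 ≤ X := by
    have h1 : 0 ≤ Real.log (2 + 1 / ε) := Real.log_nonneg (by
      have : 0 < 1 / ε := by positivity
      linarith)
    have h2 : 0 ≤ Real.log (C + 1) := Real.log_nonneg (by linarith)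
    have h3 : 0 ≤ Real.log 2 := Real.log_nonneg (by norm_num)
    have h4 : 0 ≤ Real.log 108 := Real.log_nonneg (by norm_num)
    have h5 : 0 ≤ Real.log 5 := Real.log_nonneg (by norm_num)
    positivity
  refine ⟨1 + 4 * C / ε, Real.exp X, ?_, Real.one_le_exp hX0, ?_⟩
  · have : 0 ≤ 4 * C / ε := by positivity
    linarith
  intro Ω F hF ξ C₁ r₀ α φ ℓ δ hC₁ hα hφ hball hL hδ hδ1 hr₀
  have hℓ : 0 ≤ ℓ := by
    have : 0 ≤ 4 * C / ε := by positivity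
    linarith
  have hεℓ : 0 ≤ ε * ℓ := by positivity
  set T := Real.exp X * C₁ * Real.exp (-(φ * ℓ)) * δ ^ (α - 2000 * (κ + 1) * Real.sqrt ε) with hT
  have hTpos : 0 < T := by positivity
  set s := scale ℓ δ with hs
  have hspos : ∀ a, 0 < s a := scale_pos hδ ℓ
  have hmono : Monotone s := scale_mono hℓ hδ.le
  set M := Real.exp (κ * ε * ℓ) with hM
  have hM1 : 1 ≤ M := Real.one_le_exp (by positivity)
  set β := Real.exp (-(ε * ℓ)) with hβ
  have hβ0 : 0 < β := Real.exp_pos _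
  have hlogβ : Real.log (β ^ 54) = -(54 * (ε * ℓ)) := by
    rw [Real.log_pow, hβ, Real.log_exp]
    push_cast
    ring
  by_contra hcon
  have hCM : C * M ^ (-c) ≤ β ^ 54 / 4 := by
    have e1 : M ^ (-c) = Real.exp (-(55 * (ε * ℓ))) := by
      rw [hM, ← Real.exp_mul, hκ]
      congr 1
      field_simp
    have e2 : β ^ 54 = Real.exp (-(55 * (ε * ℓ))) * Real.exp (ε * ℓ) := by
      rw [hβ, ← Real.exp_nat_mul, ← Real.exp_add]
      congr 1
      push_cast
      ring
    have e3 : 4 * C ≤ Real.exp (ε * ℓ) := by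
      have : 4 * C / ε ≤ ℓ := by linarith
      rw [div_le_iff₀ hε] at this
      linarith [Real.add_one_le_exp (ε * ℓ)]
    rw [e1, e2]
    nlinarith [Real.exp_pos (-(55 * (ε * ℓ)))]
  have hs4 : s 4 = Real.exp ℓ * s 3 := by
    simp only [hs, scale]
    rw [← mul_assoc, ← Real.exp_add]
    congr 2
    norm_num
    ring
  obtain ⟨x, hx, A, hAF, hAne, hA, hw⟩ := hcore hF hC₁ hα hℓ hβ0 hM1 (hspos 3)
    (hr₀.trans (hmono (Fin.zero_le _))) hs4 hCM hball (not_lt.1 hcon)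
  set Λ := 108 / β ^ 54 * ((ℓ + 2) * (C * M ^ 2 + 1) * Real.exp 9 * C₁ * s 4 ^ α *
    Real.exp (-(min α 1 * ℓ))) with hΛ
  have hs4pos := Real.rpow_pos_of_pos (hspos 4) α
  have hΛpos : 0 < Λ := by positivity
  have main := log_le_of_genPos hAne hAF (b := β ^ 54 / 2) (by positivity) hC₁ hΛpos hTpos hM1 hspos
    hmono hA hx (fun w hwA a => hball w (hAF hwA) _ (hr₀.trans (hmono (Fin.zero_le _))))
    (fun w hwA => (hw w hwA).2) (fun w hwA t j => ((hw w hwA).1 (t, j)).2.le)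
  rw [hs, log_scale hδ, log_scale hδ, log_scale hδ, log_scale hδ] at main
  refine false_of_log_le (D := -Real.log δ) (logC₁ := Real.log C₁) hℓ hκ0.le hε hε1 ?_ rfl hφ
    (logb := Real.log (β ^ 54 / 2)) ?_ (logΛ := Real.log Λ) ?_ (logT := Real.log T) (X := X) ?_
    (logM := Real.log (2 * M + 3)) ?_ hX ?_
  · have := Real.log_le_log hδ hδ1
    rw [Real.log_exp] at this
    linarith
  · rw [Real.log_div (by positivity) (by norm_num), hlogβ]
  · have e1 : Real.log Λ = Real.log 108 - Real.log (β ^ 54) + (Real.log (ℓ + 2)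
        + Real.log (C * M ^ 2 + 1) + 9 + Real.log C₁ + α * Real.log (s 4) - min α 1 * ℓ) := by
      rw [hΛ, Real.log_mul (by positivity) (by positivity), Real.log_div (by norm_num) (by positivity),
        Real.log_mul (by positivity) (Real.exp_pos _).ne', Real.log_mul (by positivity) hs4pos.ne',
        Real.log_mul (by positivity) hC₁.ne', Real.log_mul (by positivity) (Real.exp_pos _).ne',
        Real.log_mul (by positivity) (by positivity), Real.log_exp, Real.log_exp,
        Real.log_rpow (hspos 4)]
      ring
    have e2 := log_add_two_le hε hℓ
    have e3 : Real.log (C * M ^ 2 + 1) ≤ Real.log (C + 1) + 2 * (κ * ε * ℓ) := by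
      have h1 : 2 * (κ * ε * ℓ) = Real.log (M ^ 2) := by
        rw [Real.log_pow, hM, Real.log_exp]
        push_cast
        ring
      rw [h1, ← Real.log_mul (by positivity) (by positivity)]
      have h2 : 1 ≤ M ^ 2 := one_le_pow₀ hM1
      exact Real.log_le_log (by positivity) (by rw [add_mul]; linarith)
    have e4 : Real.log (s 4) = 2 * ℓ + Real.log δ := by
      rw [hs, log_scale hδ]
      norm_num
    rw [e1, hlogβ, e4]
    linarith
  · rw [hT, Real.log_mul (by positivity) (Real.rpow_pos_of_pos hδ _).ne',
      Real.log_mul (by positivity) (Real.exp_pos _).ne', Real.log_mul (Real.exp_pos _).ne' hC₁.ne',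
      Real.log_exp, Real.log_exp, Real.log_rpow hδ]
    ring
  · have : κ * ε * ℓ = Real.log M := by rw [hM, Real.log_exp]
    rw [this, ← Real.log_mul (by norm_num) (by positivity)]
    exact Real.log_le_log (by positivity) (by linarith)
  · refine le_trans (le_of_eq ?_) main
    norm_num

/-! ### Coordinates on the representation -/

/-- The first coefficient of the form `Qmat i`. -/
def pCoeff (i : Fin 2) : ℝ := if i = 0 then 0 else 1

/-- The second coefficient of the form `Qmat i`. -/
def qCoeff (i : Fin 2) : ℝ := if i = 0 then 1 else 0

lemma formCoeff (i : Fin 2) : FormCoeff (pCoeff i) (qCoeff i) := by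
  fin_cases i <;> simp [FormCoeff, pCoeff, qCoeff]

/-- The normalised form, a signed permutation matrix. -/
def Qnorm (i : Fin 2) : M4 :=
  !![0, 0, 0, -1; 0, pCoeff i, qCoeff i, 0; 0, qCoeff i, pCoeff i, 0; -1, 0, 0, 0]

lemma Qnorm_mul_self (i : Fin 2) : Qnorm i * Qnorm i = 1 := by
  fin_cases i <;> ext a b <;> fin_cases a <;> fin_cases b <;>
    simp [Qnorm, pCoeff, qCoeff, Matrix.mul_apply, Fin.sum_univ_four]

lemma Qnorm_transpose (i : Fin 2) : (Qnorm i)ᵀ = Qnorm i := by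
  ext a b
  fin_cases a <;> fin_cases b <;> simp [Qnorm]

lemma exists_Qmat_eq (i : Fin 2) : ∃ c : ℝ, c ≠ 0 ∧ Qmat i = c • Qnorm i := by
  refine ⟨if i = 0 then 1 / 2 else 1, by split_ifs <;> norm_num, ?_⟩
  fin_cases i <;> ext a b <;> fin_cases a <;> fin_cases b <;>
    simp [Qmat, Qnorm, pCoeff, qCoeff]

/-- Elements of the representation correspond to symmetric matrices. -/
lemma isSymm_mul_Qnorm {i : Fin 2} {w : M4} (hw : w ∈ rSpace i) : (w * Qnorm i)ᵀ = w * Qnorm i := by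
  obtain ⟨c, hc, hQ⟩ := exists_Qmat_eq i
  have h1 : -(Qmat i * wᵀ * (Qmat i)⁻¹) + w = 0 := hw.2
  have h2 : (Qmat i)⁻¹ = c⁻¹ • Qnorm i := by
    refine Matrix.inv_eq_right_inv ?_
    rw [hQ, Matrix.smul_mul, Matrix.mul_smul, smul_smul, Qnorm_mul_self, mul_inv_cancel₀ hc, one_smul]
  have h3 : w = Qnorm i * wᵀ * Qnorm i := by
    rw [h2, hQ, Matrix.smul_mul, Matrix.smul_mul, Matrix.mul_smul, smul_smul, mul_inv_cancel₀ hc,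
      one_smul] at h1
    exact (neg_add_eq_zero.1 h1).symm
  rw [Matrix.transpose_mul, Qnorm_transpose]
  nth_rewrite 2 [h3]
  rw [Matrix.mul_assoc, Qnorm_mul_self, Matrix.mul_one]

lemma trace_mul_Qnorm {i : Fin 2} {w : M4} (hw : w ∈ rSpace i) : (w * Qnorm i) 0 3 =
    pCoeff i / 2 * ((w * Qnorm i) 1 1 + (w * Qnorm i) 2 2) + qCoeff i * (w * Qnorm i) 1 2 := by
  have h1 : w.trace = 0 := hw.1
  have h2 := isSymm_mul_Qnorm hw
  have h3 : w = (w * Qnorm i) * Qnorm i := by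
    rw [Matrix.mul_assoc, Qnorm_mul_self, Matrix.mul_one]
  set S := w * Qnorm i
  have h30 : S 3 0 = S 0 3 := congrFun (congrFun h2 0) 3
  have h21 : S 2 1 = S 1 2 := congrFun (congrFun h2 1) 2
  rw [h3] at h1
  simp [Matrix.trace, Matrix.mul_apply, Fin.sum_univ_four, Qnorm] at h1
  rw [h30, h21] at h1
  linarith

/-- Coordinates on the representation. -/
def coord (i : Fin 2) (w : M4) : V9 :=
  let S := w * Qnorm i
  ![S 0 0, S 0 1, S 0 2, S 1 1, S 1 2, S 2 2, S 1 3, S 2 3, S 3 3]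

lemma coord_sub (i : Fin 2) (w w' : M4) : coord i (w - w') = coord i w - coord i w' := by
  ext k
  fin_cases k <;> simp [coord, Matrix.sub_mul]

lemma bilv_dot_coord {i : Fin 2} {w : M4} (hw : w ∈ rSpace i) (x y : Fin 4 → ℝ) :
    bilv (pCoeff i) (qCoeff i) x y ⬝ᵥ coord i w = x ⬝ᵥ (w * Qnorm i) *ᵥ y := by
  have h2 := isSymm_mul_Qnorm hw
  have h03 := trace_mul_Qnorm hw
  rw [bilv_dot]
  simp only [coord, Matrix.cons_val]
  set S := w * Qnorm i
  have h (a b : Fin 4) : S a b = S b a := congrFun (congrFun h2 b) a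
  simp only [dotProduct, Matrix.mulVec, Fin.sum_univ_four]
  rw [h 1 0, h 2 0, h 2 1, h 3 0, h 3 1, h 3 2, h03]
  ring

lemma abs_le_mnorm (X : M4) (a b : Fin 4) : |X a b| ≤ mnorm X :=
  le_ciSup (f := fun p : Fin 4 × Fin 4 => |X p.1 p.2|) (Set.finite_range _).bddAbove (a, b)

lemma abs_mul_Qnorm_le {i : Fin 2} {X : M4} {r : ℝ} (h : ∀ a b, |X a b| ≤ r) (a b : Fin 4) :
    |(X * Qnorm i) a b| ≤ r := by
  fin_cases i <;> fin_cases b <;>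
    simpa [Matrix.mul_apply, Fin.sum_univ_four, Qnorm, pCoeff, qCoeff] using h a _

lemma mnorm_le_of_coord {i : Fin 2} {w : M4} (hw : w ∈ rSpace i) {r : ℝ}
    (h : ∀ k, |coord i w k| ≤ r) : mnorm w ≤ r := by
  have h2 := isSymm_mul_Qnorm hw
  have h03 := trace_mul_Qnorm hw
  have h3 : w = (w * Qnorm i) * Qnorm i := by
    rw [Matrix.mul_assoc, Qnorm_mul_self, Matrix.mul_one]
  refine ciSup_le fun ab => ?_
  rw [h3]
  refine abs_mul_Qnorm_le ?_ _ _
  simp only [coord, forall_fin_nine, Matrix.cons_val] at h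
  set S := w * Qnorm i
  have hs (a b : Fin 4) : S a b = S b a := congrFun (congrFun h2 b) a
  obtain ⟨h0, h1, h2, h3, h4, h5, h6, h7, h8⟩ := h
  have h9 : |S 0 3| ≤ r := by
    rw [h03]
    rw [abs_le] at h3 h4 h5 ⊢
    rcases formCoeff i with ⟨hp, hq⟩ | ⟨hp, hq⟩ <;> rw [hp, hq] <;> constructor <;> linarith
  intro a b
  fin_cases a <;> fin_cases b <;> first | assumption | (rw [hs]; assumption)

/-! ### The action in coordinates -/

/-- The rows of the unipotent matrices. -/
noncomputable def unipRow (i : Fin 2) (u : ℝ × ℝ) : Fin 4 → Fin 4 → ℝ :=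
  ![nv (pCoeff i) (qCoeff i) u, nr (pCoeff i) (qCoeff i) u, ns (pCoeff i) (qCoeff i) u, e4]

lemma uMat_eq (i : Fin 2) (u : ℝ × ℝ) : uMat i u.1 u.2 = unipRow i u := by
  fin_cases i <;> ext a b <;> fin_cases a <;> fin_cases b <;>
    simp [uMat, unipRow, nv, nr, ns, e4, pCoeff, qCoeff] <;> ring

lemma uMat_mul_Qnorm (i : Fin 2) (r s : ℝ) : uMat i r s * Qnorm i * (uMat i r s)ᵀ = Qnorm i := by
  fin_cases i <;> ext a b <;> fin_cases a <;> fin_cases b <;>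
    simp [uMat, Qnorm, pCoeff, qCoeff, Matrix.mul_apply, Fin.sum_univ_four] <;> ring

lemma aMat_mul_Qnorm (i : Fin 2) (ℓ : ℝ) : aMat ℓ * Qnorm i * (aMat ℓ)ᵀ = Qnorm i := by
  have h : Real.exp ℓ * Real.exp (-ℓ) = 1 := by rw [← Real.exp_add]; simp
  have h' : Real.exp (-ℓ) * Real.exp ℓ = 1 := by rw [← Real.exp_add]; simp
  ext a b
  fin_cases a <;> fin_cases b <;>
    simp [aMat, Qnorm, Matrix.mul_apply, Matrix.diagonal, h, h']

lemma Adm_mul_Qnorm {i : Fin 2} {g : M4} (hg : g * Qnorm i * gᵀ = Qnorm i) (w : M4) :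
    Adm g w * Qnorm i = g * (w * Qnorm i) * gᵀ := by
  have h1 : g⁻¹ = Qnorm i * gᵀ * Qnorm i := by
    refine Matrix.inv_eq_right_inv ?_
    rw [← Matrix.mul_assoc, ← Matrix.mul_assoc, hg, Qnorm_mul_self]
  rw [Adm, h1]
  simp only [Matrix.mul_assoc, Qnorm_mul_self, Matrix.mul_one]

lemma Adm_mul_Qnorm_apply (i : Fin 2) (ℓ : ℝ) (u : ℝ × ℝ) (w : M4) (a b : Fin 4) :
    (Adm (aMat ℓ * uMat i u.1 u.2) w * Qnorm i) a b =
      ![Real.exp ℓ, 1, 1, Real.exp (-ℓ)] a * ![Real.exp ℓ, 1, 1, Real.exp (-ℓ)] b *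
        (unipRow i u a ⬝ᵥ (w * Qnorm i) *ᵥ unipRow i u b) := by
  have hg : aMat ℓ * uMat i u.1 u.2 * Qnorm i * (aMat ℓ * uMat i u.1 u.2)ᵀ = Qnorm i := by
    rw [Matrix.transpose_mul]
    calc _ = aMat ℓ * (uMat i u.1 u.2 * Qnorm i * (uMat i u.1 u.2)ᵀ) * (aMat ℓ)ᵀ := by
          simp only [Matrix.mul_assoc]
      _ = _ := by rw [uMat_mul_Qnorm, aMat_mul_Qnorm]
  rw [Adm_mul_Qnorm hg, Matrix.transpose_mul]
  have h : aMat ℓ * uMat i u.1 u.2 * (w * Qnorm i) * ((uMat i u.1 u.2)ᵀ * (aMat ℓ)ᵀ) =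
      aMat ℓ * (uMat i u.1 u.2 * ((w * Qnorm i) * (uMat i u.1 u.2)ᵀ)) * aMat ℓ := by
    rw [aMat, Matrix.diagonal_transpose]
    simp only [Matrix.mul_assoc]
  rw [h, aMat, Matrix.mul_diagonal, Matrix.diagonal_mul, uMat_eq]
  rw [mul_right_comm]
  rfl

lemma abs_cvec_dotProduct_le {i : Fin 2} {ℓ δ : ℝ} {u : ℝ × ℝ} {w : M4} (hw : w ∈ rSpace i)
    (h : mnorm (Adm (aMat ℓ * uMat i u.1 u.2) w) ≤ δ) (k : Fin 9) :
    |cvec (pCoeff i) (qCoeff i) u k ⬝ᵥ coord i w| ≤ scale ℓ δ (lev k) := by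
  have wt (a : Fin 4) : ![Real.exp ℓ, 1, 1, Real.exp (-ℓ)] a
      = Real.exp ((![1, 0, 0, -1] : Fin 4 → ℝ) a * ℓ) := by
    fin_cases a <;> simp
  have key (a b : Fin 4) : |unipRow i u a ⬝ᵥ (w * Qnorm i) *ᵥ unipRow i u b| ≤
      Real.exp (-((![1, 0, 0, -1] : Fin 4 → ℝ) a + (![1, 0, 0, -1] : Fin 4 → ℝ) b) * ℓ) * δ := by
    have h1 := abs_mul_Qnorm_le (i := i) (fun a b => (abs_le_mnorm _ a b).trans h) a b
    rw [Adm_mul_Qnorm_apply, abs_mul, wt, wt, ← Real.exp_add, Real.abs_exp, ← add_mul] at h1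
    rw [neg_mul, Real.exp_neg, ← div_eq_inv_mul, le_div_iff₀ (Real.exp_pos _), mul_comm]
    exact h1
  revert k
  rw [forall_fin_nine]
  simp only [cvec, Matrix.cons_val, bilv_dot_coord hw, scale, lev]
  refine ⟨(key 0 0).trans_eq ?_, (key 0 1).trans_eq ?_, (key 0 2).trans_eq ?_,
    (key 1 1).trans_eq ?_, (key 1 2).trans_eq ?_, (key 2 2).trans_eq ?_, (key 1 3).trans_eq ?_,
    (key 2 3).trans_eq ?_, (key 3 3).trans_eq ?_⟩ <;>
  · simp only [Matrix.cons_val]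
    congr 2
    norm_num

lemma mul_phiFn_le {α : ℝ} (hα : α ∈ Set.Ioo (0:ℝ) 9) : 8 * phiFn α ≤ min α 1 - α / 9 := by
  obtain ⟨h0, h9⟩ := hα
  unfold phiFn
  rcases min_cases α 1 with h | h <;> rcases min_cases (8 / 9 * α) (1 - α / 9) with h' | h' <;>
    linarith

lemma mU_inter_le (B : Set (ℝ × ℝ)) : mU (uSq ∩ B) ≤ mPar B := by
  have h : mPar = (4⁻¹ : ENNReal) • (volume.restrict uSq : Measure (ℝ × ℝ)) := by
    rw [mPar, nuI, Measure.prod_smul_left, Measure.prod_smul_right, Measure.prod_restrict, smul_smul,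
      ← ENNReal.mul_inv (by simp) (by simp), show (2 : ENNReal) * 2 = 4 by norm_num]
    rfl
  rw [h, mU, Measure.smul_apply, smul_eq_mul, ENNReal.div_eq_inv_mul, Set.inter_comm]
  refine mul_le_mul_right ?_ _
  exact Measure.le_restrict_apply _ _

/-- nonconcentration improvement for a_ℓ u-images of Frostman sets in 𝔯ᵢ. -/
theorem stmt3 (i : Fin 2) :
    ∃ E : ℝ, 1 ≤ E ∧
    ∀ ε : ℝ, 0 < ε →
    ∃ Lε Cε : ℝ, 1 ≤ Lε ∧ 1 ≤ Cε ∧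
    ∀ C α δ₀ : ℝ, 1 ≤ C → α ∈ Set.Ioo (0:ℝ) 9 → δ₀ ∈ Set.Ioo (0:ℝ) 1 → ε < α / 10 ^ 10 →
    ∀ F : Finset M4,
      (∀ w ∈ F, w ∈ rSpace i ∧ mnorm w ≤ 1) →
      (∀ (x : M4) (δ : ℝ), δ₀ ≤ δ →
        ((F.filter (fun w => mnorm (w - x) ≤ δ)).card : ℝ) ≤ C * δ ^ α * F.card) →
    ∀ ℓ : ℝ, Lε ≤ ℓ →
    ∀ δ : ℝ, Real.exp (2*ℓ) * δ₀ ≤ δ → δ ≤ Real.exp (-(2*ℓ)) →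
    ∃ J ⊆ uSq,
      mU (uSq \ J) ≤ ENNReal.ofReal (Cε * Real.exp (-(ε * ℓ))) ∧
      ∀ p ∈ J, ∃ Fu ⊆ F,
        ((F \ Fu).card : ℝ) ≤ Cε * Real.exp (-(ε * ℓ)) * F.card ∧
        ∀ w ∈ Fu,
          ((Fu.filter (fun w' =>
              mnorm (Adm (aMat ℓ * uMat i p.1 p.2) w' - Adm (aMat ℓ * uMat i p.1 p.2) w)
                ≤ δ)).card : ℝ)
            ≤ Cε * C * Real.exp (-(phiFn α * ℓ)) * δ ^ (α - E * Real.sqrt ε) * F.card := by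
  obtain ⟨E, hE, hcore⟩ := mPar_bad_lt (formCoeff i)
  refine ⟨E, hE, fun ε hε => ?_⟩
  by_cases hε1 : ε < 1
  swap
  · refine ⟨1, 1, le_rfl, le_rfl, fun C α δ₀ _ hα _ hεα => absurd hεα ?_⟩
    have := hα.2
    norm_num
    linarith
  obtain ⟨L, Cε, hL, hCε, hbad⟩ := hcore ε hε hε1
  refine ⟨L, Cε, hL, hCε, fun C α δ₀ hC hα hδ₀ _ F hF hball ℓ hℓ δ hδ hδ1 => ?_⟩
  have hδpos : 0 < δ := lt_of_lt_of_le (mul_pos (Real.exp_pos _) hδ₀.1) hδ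
  rcases F.eq_empty_or_nonempty with rfl | hFne
  · refine ⟨uSq, subset_rfl, by simp [mU], fun p _ => ⟨∅, subset_rfl, by simp, by simp⟩⟩
  have hball' : ∀ w ∈ F, ∀ r, δ₀ ≤ r →
      ((F.filter fun w' => ∀ k, |coord i w' k - coord i w k| ≤ r).card : ℝ) ≤ C * r ^ α * F.card := by
    intro w hw r hr
    refine le_trans (Nat.cast_le.2 (Finset.card_le_card fun w' hw' => ?_)) (hball w r hr)
    rw [Finset.mem_filter] at hw' ⊢
    refine ⟨hw'.1, mnorm_le_of_coord (sub_mem (hF w' hw'.1).1 (hF w hw).1) fun k => ?_⟩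
    rw [coord_sub, Pi.sub_apply]
    exact hw'.2 k
  have hr₀ : δ₀ ≤ scale ℓ δ 0 := by
    have h : scale ℓ δ 0 = (Real.exp (2 * ℓ))⁻¹ * δ := by
      rw [scale, ← Real.exp_neg]
      norm_num
    rw [h, ← div_eq_inv_mul, le_div_iff₀ (Real.exp_pos _), mul_comm]
    exact hδ
  have hsmall := hbad hFne (by linarith) hα (mul_phiFn_le hα) hball' hℓ hδpos hδ1 hr₀
  set T := Cε * C * Real.exp (-(phiFn α * ℓ)) * δ ^ (α - E * Real.sqrt ε)
  set bad : ℝ × ℝ → Finset M4 := fun u =>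
    F.filter fun w => u ∈ badPar (pCoeff i) (qCoeff i) T (scale ℓ δ) F (coord i) w
  set B : Set (ℝ × ℝ) := {u | Real.exp (-(ε * ℓ)) * F.card ≤ ((bad u).card : ℝ)}
  have hle : Real.exp (-(ε * ℓ)) ≤ Cε * Real.exp (-(ε * ℓ)) :=
    le_mul_of_one_le_left (Real.exp_pos _).le hCε
  refine ⟨uSq \ B, Set.sdiff_subset, ?_, fun u hu => ⟨F \ bad u, Finset.sdiff_subset, ?_, ?_⟩⟩
  · rw [Set.sdiff_sdiff_right_self]
    exact (mU_inter_le B).trans (hsmall.le.trans (ENNReal.ofReal_le_ofReal hle))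
  · rw [Finset.sdiff_sdiff_eq_self (Finset.filter_subset _ _)]
    exact (not_le.1 hu.2).le.trans (mul_le_mul_of_nonneg_right hle (Nat.cast_nonneg _))
  · intro w hw
    obtain ⟨hwF, hwb⟩ := Finset.mem_sdiff.1 hw
    have hnot : ¬ T * F.card < ((F.filter fun w' => ∀ k, |cvec (pCoeff i) (qCoeff i) u k ⬝ᵥ
        (coord i w' - coord i w)| ≤ scale ℓ δ (lev k)).card : ℝ) := by
      intro h
      exact hwb (Finset.mem_filter.2 ⟨hwF, ⟨abs_le.2 hu.1.1, abs_le.2 hu.1.2⟩, h⟩)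
    refine le_trans (Nat.cast_le.2 (Finset.card_le_card fun w' hw' => ?_)) (not_lt.1 hnot)
    rw [Finset.mem_filter] at hw' ⊢
    have hwF' := (Finset.mem_sdiff.1 hw'.1).1
    refine ⟨hwF', fun k => ?_⟩
    rw [← coord_sub]
    refine abs_cvec_dotProduct_le (sub_mem (hF w' hwF').1 (hF w hwF).1) (le_of_eq_of_le ?_ hw'.2) k
    rw [Adm, Adm, Adm, Matrix.mul_sub, Matrix.sub_mul]
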